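/- Let q > 1 be an integer and assume that every Dirichlet L-function L(s,χ) attached to a Dirichlet character χ mod q satisfies the Riemann Hypothesis. Let k > 2 be a fixed real number. Then there is a constant C depending only on k such that ∑_{χ ∈ X_q^+} |θ(1,χ)|^{2k} ≤ C · φ(q) · q^{k/2} · (log q)^{(k−1)²}, where X_q^+ is the set of even primitive Dirichlet characters modulo q. -/

import Mathlib

open Complex Real Finset

def dirichletRH {q : ℕ} [NeZero q] (χ : DirichletCharacter ℂ q) : Prop :=
  ∀ s : ℂ, 0 < s.re → s.re < 1 → DirichletCharacter.LFunction χ s = 0 → s.re = 1 / 2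

/-- The theta function `θ(x,χ) = ∑_{n=1}^∞ χ(n) n^κ e^{-π n² x / q}` where `κ = (1-χ(-1))/2`. -/
noncomputable def dirichletTheta {q : ℕ} (χ : DirichletCharacter ℂ q) (x : ℝ) : ℂ :=
  ∑' n : ℕ, χ n * (n : ℂ) ^ (if χ (-1) = 1 then 0 else 1) *
    Complex.exp (-(Real.pi) * n ^ 2 * x / q)


/-- differentiable logarithm on convex open sets -/
lemma continuous_log_differentiable {U : Set ℂ} (hUo : IsOpen U) {f h : ℂ → ℂ}
    (hf : DifferentiableOn ℂ f U) (hh : ContinuousOn h U) (he : ∀ z ∈ U, Complex.exp (h z) = f z) :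
    DifferentiableOn ℂ h U := by
  intro z hz
  apply DifferentiableAt.differentiableWithinAt
  have hU : U ∈ nhds z := hUo.mem_nhds hz
  have hc : ContinuousAt h z := hh.continuousAt hU
  have hfz : DifferentiableAt ℂ f z := hf.differentiableAt hU
  have hf0 : f z ≠ 0 := by rw [← he z hz]; exact Complex.exp_ne_zero _
  have h1 : ∀ᶠ w in nhds z, h w = Complex.log (f w / f z) + h z := by
    have h2 : ∀ᶠ w in nhds z, ‖h w - h z‖ < 1 := by
      have := Metric.tendsto_nhds.1 hc 1 one_pos
      simpa [dist_eq_norm] using this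
    filter_upwards [h2, hU] with w hw hwU
    rw [← he w hwU, ← he z hz, ← Complex.exp_sub]
    have him : |(h w - h z).im| < 1 := lt_of_le_of_lt (Complex.abs_im_le_norm _) hw
    rw [abs_lt] at him
    rw [Complex.log_exp (by linarith [Real.pi_gt_three]) (by linarith [Real.pi_gt_three])]
    ring
  have h3 : DifferentiableAt ℂ (fun w => Complex.log (f w / f z) + h z) z := by
    apply DifferentiableAt.add_const
    apply DifferentiableAt.clog
    · exact hfz.div_const _
    · rw [div_self hf0]; simp
  exact h3.congr_of_eventuallyEq h1

lemma exists_log_of_convex {U : Set ℂ} (hUo : IsOpen U) (hUc : Convex ℝ U) (hne : U.Nonempty)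
    {f : ℂ → ℂ} (hf : DifferentiableOn ℂ f U) (h0 : ∀ z ∈ U, f z ≠ 0) :
    ∃ h : ℂ → ℂ, DifferentiableOn ℂ h U ∧ ∀ z ∈ U, Complex.exp (h z) = f z := by
  have hs : IsSimplyConnected U := by
    have := hUc.contractibleSpace hne
    exact (inferInstance : SimplyConnectedSpace U)
  obtain ⟨h, hc, he⟩ := Complex.exists_continuousOn_eqOn_exp_comp hs hUo hf.continuousOn
    (by rintro ⟨z, hz, h⟩; exact h0 z hz h)
  exact ⟨h, continuous_log_differentiable hUo hf hc he, he⟩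

lemma BC_center {c : ℂ} {R M : ℝ} {f : ℂ → ℂ} (hR : 0 < R) (hM : 0 < M)
    (hf : DifferentiableOn ℂ f (Metric.ball c R))
    (hb : ∀ z ∈ Metric.ball c R, (f z).re ≤ (f c).re + M) {z : ℂ} (hz : z ∈ Metric.ball c R) :
    ‖f z - f c‖ ≤ 2 * M * ‖z - c‖ / (R - ‖z - c‖) := by
  have := Complex.borelCaratheodory_zero (f := fun w => f (c + w) - f c) (M := M) (R := R)
    (z := z - c) hM ?_ ?_ hR ?_ (by simp)
  · simpa using this
  · apply DifferentiableOn.sub_const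
    apply hf.comp (by fun_prop)
    intro w hw
    simpa [dist_eq_norm] using hw
  · intro w hw
    have := hb (c + w) (by simpa [dist_eq_norm] using hw)
    simp only [Set.mem_ofPred_eq, sub_re]; linarith
  · simpa [dist_eq_norm] using hz

/-- log-derivative style bounds for a zero free function with controlled growth -/
lemma BC_log {c : ℂ} {R M : ℝ} {f : ℂ → ℂ} (hR : 0 < R) (hM : 0 < M)
    (hf : DifferentiableOn ℂ f (Metric.ball c R)) (h0 : ∀ z ∈ Metric.ball c R, f z ≠ 0)
    (hb : ∀ z ∈ Metric.ball c R, ‖f z‖ ≤ Real.exp M * ‖f c‖) :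
    ∃ h : ℂ → ℂ, DifferentiableOn ℂ h (Metric.ball c R) ∧
      (∀ z ∈ Metric.ball c R, Complex.exp (h z) = f z) ∧
      ∀ z ∈ Metric.ball c R, ‖h z - h c‖ ≤ 2 * M * ‖z - c‖ / (R - ‖z - c‖) := by
  obtain ⟨h, hd, he⟩ := exists_log_of_convex Metric.isOpen_ball (convex_ball c R)
    ⟨c, by simpa⟩ hf h0
  refine ⟨h, hd, he, fun z hz => BC_center hR hM hd ?_ hz⟩
  intro w hw
  have h1 := hb w hw
  rw [← he w hw, ← he c (by simpa), Complex.norm_exp, Complex.norm_exp, ← Real.exp_add,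
    Real.exp_le_exp] at h1
  linarith

lemma deriv2_log_bound {c : ℂ} {R M : ℝ} {f : ℂ → ℂ} (hR : 0 < R) (hM : 0 < M)
    (hf : DifferentiableOn ℂ f (Metric.ball c R)) (h0 : ∀ z ∈ Metric.ball c R, f z ≠ 0)
    (hb : ∀ z ∈ Metric.ball c R, ‖f z‖ ≤ Real.exp M * ‖f c‖) :
    ‖deriv (logDeriv f) c‖ ≤ 16 * M / R ^ 2 := by
  obtain ⟨h, hd, he, hB⟩ := BC_log hR hM hf h0 hb
  have hl : ∀ z ∈ Metric.ball c R, logDeriv f z = deriv h z := by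
    intro z hz
    have hn := Metric.isOpen_ball.mem_nhds hz
    have e1 : f =ᶠ[nhds z] fun w => Complex.exp (h w) := by
      filter_upwards [hn] with w hw using (he w hw).symm
    rw [logDeriv_apply, e1.deriv_eq, ← he z hz]
    have := (hd.differentiableAt hn).hasDerivAt.cexp
    rw [this.deriv]
    field_simp [Complex.exp_ne_zero]
  have hcn : Metric.ball c R ∈ nhds c := Metric.ball_mem_nhds c hR
  have e2 : logDeriv f =ᶠ[nhds c] deriv h := by
    filter_upwards [hcn] with w hw using hl w hw
  rw [e2.deriv_eq]
  have e3 : deriv (deriv h) c = iteratedDeriv 2 (fun z => h z - h c) c := by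
    rw [iteratedDeriv_succ, iteratedDeriv_one]
    have : deriv (fun z => h z - h c) = deriv h := by
      ext z; simp
    rw [this]
  rw [e3]
  have hsub : Metric.closedBall c (R/2) ⊆ Metric.ball c R :=
    Metric.closedBall_subset_ball (by linarith)
  have := Complex.norm_iteratedDeriv_le_of_forall_mem_sphere_norm_le (c := c) (R := R/2) (C := 2*M)
    (f := fun z => h z - h c) 2 (by linarith) ?_ ?_
  · refine this.trans (le_of_eq ?_)
    simp [Nat.factorial]; field_simp; ring
  · apply DifferentiableOn.diffContOnCl
    rw [closure_ball _ (by linarith)]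
    exact (hd.mono hsub).sub_const _
  · intro z hz
    have hz' : ‖z - c‖ = R/2 := by simpa [dist_eq_norm] using hz
    have := hB z (hsub (Metric.sphere_subset_closedBall hz))
    rw [hz'] at this
    refine this.trans (le_of_eq ?_)
    field_simp; ring

/-- derivative bound for functions of nonnegative real part -/
lemma deriv_bound_re_nonneg {c : ℂ} {R : ℝ} {F : ℂ → ℂ} (hR : 0 < R)
    (hf : DifferentiableOn ℂ F (Metric.ball c R)) (h0 : ∀ z ∈ Metric.ball c R, 0 ≤ (F z).re) :
    ‖deriv F c‖ ≤ 4 * (F c).re / R := by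
  have hg : 0 ≤ (F c).re := h0 c (by simpa)
  have key : ∀ ε > 0, ‖deriv F c‖ ≤ 4 * ((F c).re + ε) / R := by
    intro ε hε
    have hsub : Metric.closedBall c (R/2) ⊆ Metric.ball c R :=
      Metric.closedBall_subset_ball (by linarith)
    have h1 := Complex.norm_deriv_le_of_forall_mem_sphere_norm_le (c := c) (R := R/2)
      (C := 2*((F c).re + ε)) (f := fun z => F z - F c) (by linarith) ?_ ?_
    · rw [deriv_sub_const] at h1
      refine h1.trans (le_of_eq ?_)
      field_simp; ring
    · apply DifferentiableOn.diffContOnCl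
      rw [closure_ball _ (by linarith)]
      exact (hf.mono hsub).sub_const _
    · intro z hz
      have hz' : ‖z - c‖ = R/2 := by simpa [dist_eq_norm] using hz
      have := BC_center (f := fun z => - F z) (M := (F c).re + ε) hR (by linarith) hf.neg
        (by intro w hw; simp; linarith [h0 w hw]) (hsub (Metric.sphere_subset_closedBall hz))
      rw [hz'] at this
      have e : ‖F z - F c‖ = ‖-F z - -F c‖ := by rw [← norm_neg]; congr 1; ring
      rw [e]
      refine this.trans (le_of_eq ?_)
      field_simp; ring
  have : Filter.Tendsto (fun ε : ℝ => 4 * ((F c).re + ε) / R) (nhdsWithin 0 (Set.Ioi 0))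
      (nhds (4 * ((F c).re + 0) / R)) := by
    apply Filter.Tendsto.mono_left _ nhdsWithin_le_nhds
    apply Continuous.tendsto
    fun_prop
  rw [add_zero] at this
  exact ge_of_tendsto this (by filter_upwards [self_mem_nhdsWithin] with ε hε using key ε hε)


noncomputable def Kbeta (a b : ℝ) : ℝ := ∫ x : ℝ in (0)..1, ‖(x : ℂ) ^ ((a : ℂ) - 1) * (1 - (x : ℂ)) ^ ((b : ℂ) - 1)‖

lemma Kbeta_nonneg (a b : ℝ) : 0 ≤ Kbeta a b :=
  intervalIntegral.integral_nonneg zero_le_one (fun _ _ => norm_nonneg _)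

lemma norm_betaIntegral_le {a b : ℝ} (ha : 0 < a) (hb : 0 < b) {u v : ℂ} (hu : a ≤ u.re)
    (hv : b ≤ v.re) : ‖Complex.betaIntegral u v‖ ≤ Kbeta a b := by
  unfold Complex.betaIntegral Kbeta
  have hI := (Complex.betaIntegral_convergent (u := (a : ℂ)) (v := (b : ℂ)) (by simpa) (by simpa)).norm
  rw [intervalIntegral.integral_of_le zero_le_one, intervalIntegral.integral_of_le zero_le_one]
  rw [intervalIntegrable_iff_integrableOn_Ioc_of_le zero_le_one] at hI
  apply MeasureTheory.norm_integral_le_of_norm_le hI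
  have h1 : ∀ᵐ x ∂(MeasureTheory.volume.restrict (Set.Ioc (0:ℝ) 1)), x ∈ Set.Ioc (0:ℝ) 1 :=
    MeasureTheory.ae_restrict_mem measurableSet_Ioc
  have h2 : ∀ᵐ x ∂(MeasureTheory.volume.restrict (Set.Ioc (0:ℝ) 1)), x ≠ 1 :=
    MeasureTheory.ae_restrict_of_ae (by simp [MeasureTheory.ae_iff])
  filter_upwards [h1, h2] with x hx hx1
  have hx0 : 0 < x := hx.1
  have hx2 : 0 < 1 - x := by
    have := lt_of_le_of_ne hx.2 hx1
    linarith
  have e : (1 - (x:ℂ)) = ((1 - x : ℝ) : ℂ) := by push_cast; ring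
  rw [e, norm_mul, norm_mul, Complex.norm_cpow_eq_rpow_re_of_pos hx0, Complex.norm_cpow_eq_rpow_re_of_pos hx2,
    Complex.norm_cpow_eq_rpow_re_of_pos hx0, Complex.norm_cpow_eq_rpow_re_of_pos hx2]
  simp only [sub_re, ofReal_re, one_re]
  gcongr ?_ * ?_
  · exact Real.rpow_le_rpow_of_exponent_ge hx0 hx.2 (by linarith)
  · exact Real.rpow_le_rpow_of_exponent_ge hx2 (by linarith) (by linarith)

lemma norm_Gamma_mul_le {a b : ℝ} (ha : 0 < a) (hb : 0 < b) {u v : ℂ} (hu : a ≤ u.re)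
    (hv : b ≤ v.re) : ‖Complex.Gamma u‖ * ‖Complex.Gamma v‖ ≤ Kbeta a b * ‖Complex.Gamma (u + v)‖ := by
  rw [← norm_mul, Complex.Gamma_mul_Gamma_eq_betaIntegral (by linarith) (by linarith), norm_mul, mul_comm]
  gcongr
  exact norm_betaIntegral_le ha hb hu hv

lemma Gamma_ratio_small {a : ℝ} (ha : 0 < a) : ∃ C : ℝ, 0 < C ∧ ∀ z : ℂ, 1/16 ≤ z.re →
    ‖Complex.Gamma z‖ ≤ C * ‖Complex.Gamma (z + a)‖ := by
  have hG : 0 < ‖Complex.Gamma a‖ := norm_pos_iff.2 (Complex.Gamma_ne_zero_of_re_pos (by simpa))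
  refine ⟨(Kbeta (1/16) a + 1) / ‖Complex.Gamma a‖, by have := Kbeta_nonneg (1/16) a; positivity, fun z hz => ?_⟩
  have := norm_Gamma_mul_le (a := 1/16) (b := a) (by norm_num) ha (u := z) (v := a) hz (by simp)
  rw [div_mul_eq_mul_div, le_div_iff₀ hG]
  nlinarith [norm_nonneg (Complex.Gamma (z + a))]

lemma Gamma_shift_bound : ∃ C : ℝ, 1 ≤ C ∧ ∀ c w : ℂ, 1/4 ≤ c.re → ‖w‖ ≤ 1/8 →
    ‖Complex.Gamma (c + w)‖ ≤ C * ‖c‖ * ‖Complex.Gamma c‖ := by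
  have hcpt : IsCompact (Metric.closedBall (0:ℂ) (1/8)) := isCompact_closedBall _ _
  have hre : ∀ w ∈ Metric.closedBall (0:ℂ) (1/8), 7/8 ≤ (1 - w).re := by
    intro w hw
    have h1 : ‖w‖ ≤ 1/8 := by simpa using hw
    have := (abs_le.1 ((Complex.abs_re_le_norm w).trans h1)).2
    simp; linarith
  have hcont : ContinuousOn (fun w : ℂ => ‖Complex.Gamma (1 - w)‖) (Metric.closedBall (0:ℂ) (1/8)) := by
    intro w hw
    apply ContinuousAt.continuousWithinAt
    apply ContinuousAt.norm
    have h2 := hre w hw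
    have hd : DifferentiableAt ℂ Complex.Gamma (1 - w) := by
      apply Complex.differentiableAt_Gamma
      intro m hm
      rw [hm] at h2
      have hm0 : (0:ℝ) ≤ m := Nat.cast_nonneg m
      simp at h2; linarith
    exact ContinuousAt.comp (g := Complex.Gamma) hd.continuousAt (by fun_prop)
  obtain ⟨w0, hw0, hmin⟩ := hcpt.exists_isMinOn ⟨0, by simp⟩ hcont
  set m := ‖Complex.Gamma (1 - w0)‖
  have hm : 0 < m := norm_pos_iff.2 (Complex.Gamma_ne_zero_of_re_pos (by linarith [hre w0 hw0]))
  refine ⟨(Kbeta (1/8) (7/8)) / m + 1, by have := Kbeta_nonneg (1/8) (7/8); have : 0 ≤ Kbeta (1/8) (7/8) / m := by positivity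
                                          linarith, fun c w hc hw => ?_⟩
  have hw' : w ∈ Metric.closedBall (0:ℂ) (1/8) := by simpa using hw
  have h1 := norm_Gamma_mul_le (a := 1/8) (b := 7/8) (by norm_num) (by norm_num) (u := c + w) (v := 1 - w)
    (by have := (abs_le.1 ((Complex.abs_re_le_norm w).trans hw)).1
        simp; linarith) (hre w hw')
  have e : c + w + (1 - w) = c + 1 := by ring
  have hc0 : c ≠ 0 := by intro h; rw [h] at hc; simp at hc; linarith
  rw [e, Complex.Gamma_add_one c hc0, norm_mul] at h1
  have h2 : m ≤ ‖Complex.Gamma (1 - w)‖ := hmin hw'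
  have h3 : ‖Complex.Gamma (c + w)‖ * m ≤ Kbeta (1/8) (7/8) * (‖c‖ * ‖Complex.Gamma c‖) :=
    (mul_le_mul_of_nonneg_left h2 (norm_nonneg _)).trans h1
  rw [← le_div_iff₀ hm] at h3
  refine h3.trans ?_
  have : 0 ≤ ‖c‖ * ‖Complex.Gamma c‖ := by positivity
  calc _ = Kbeta (1/8) (7/8) / m * (‖c‖ * ‖Complex.Gamma c‖) := by ring
    _ ≤ (Kbeta (1/8) (7/8) / m + 1) * (‖c‖ * ‖Complex.Gamma c‖) := by gcongr; linarith
    _ = _ := by ring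

lemma Gamma_deriv2 : ∃ C : ℝ, 0 < C ∧ ∀ c : ℂ, 1/4 ≤ c.re →
    ‖deriv (logDeriv Complex.Gamma) c‖ ≤ C * Real.log (2 + ‖c‖) := by
  obtain ⟨C, hC, h⟩ := Gamma_shift_bound
  refine ⟨1024 * (Real.log C / Real.log 2 + 1), ?_, fun c hc => ?_⟩
  · have : 0 ≤ Real.log C := Real.log_nonneg hC
    have : 0 < Real.log 2 := Real.log_pos (by norm_num)
    positivity
  have hl2 : 0 < Real.log 2 := Real.log_pos (by norm_num)
  have hlC : 0 ≤ Real.log C := Real.log_nonneg hC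
  have hl : Real.log 2 ≤ Real.log (2 + ‖c‖) := Real.log_le_log (by norm_num) (by linarith [norm_nonneg c])
  have hre : ∀ z ∈ Metric.ball c (1/8), 1/8 ≤ z.re := by
    intro z hz
    have h1 : ‖z - c‖ < 1/8 := by simpa [dist_eq_norm] using hz
    have := (abs_le.1 ((Complex.abs_re_le_norm (z - c)).trans h1.le)).1
    simp at this; linarith
  have := deriv2_log_bound (c := c) (R := 1/8) (M := Real.log C + Real.log (2 + ‖c‖)) (f := Complex.Gamma)
    (by norm_num) (by linarith) ?_ ?_ ?_
  · refine this.trans ?_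
    have h3 : Real.log C ≤ Real.log C / Real.log 2 * Real.log (2 + ‖c‖) := by
      rw [div_mul_eq_mul_div, le_div_iff₀ hl2]; gcongr
    rw [show (16 * (Real.log C + Real.log (2 + ‖c‖)) / (1/8)^2) = 1024 * (Real.log C + Real.log (2 + ‖c‖)) by ring]
    nlinarith
  · intro z hz
    apply DifferentiableAt.differentiableWithinAt
    apply Complex.differentiableAt_Gamma
    intro m hm
    have h2 := hre z hz
    rw [hm] at h2
    have hm0 : (0:ℝ) ≤ m := Nat.cast_nonneg m
    simp at h2; linarith
  · intro z hz
    exact Complex.Gamma_ne_zero_of_re_pos (by linarith [hre z hz])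
  · intro z hz
    have h1 : ‖z - c‖ < 1/8 := by simpa [dist_eq_norm] using hz
    have h4 := h c (z - c) hc h1.le
    rw [add_sub_cancel] at h4
    refine h4.trans ?_
    rw [Real.exp_add, Real.exp_log (by linarith), Real.exp_log (by linarith [norm_nonneg c])]
    gcongr
    linarith

lemma Gamma_quarter_decay (N : ℕ) : ∃ C : ℝ, 0 < C ∧ ∀ y : ℝ,
    ‖Complex.Gamma (1/4 + y * Complex.I)‖ ≤ C * (1 + |y|) ^ (-(N:ℝ)) := by
  have key : ∀ N : ℕ, ∀ y : ℝ, ‖Complex.Gamma (1/4 + y * Complex.I)‖ * (1/8 * (1 + |y|)) ^ N ≤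
      ‖Complex.Gamma (1/4 + N + y * Complex.I)‖ := by
    intro N
    induction N with
    | zero => intro y; simp
    | succ n ih =>
      intro y
      have hne : (1/4 + n + y * Complex.I : ℂ) ≠ 0 := by
        intro h
        have := congrArg Complex.re h
        simp at this
        have hm0 : (0:ℝ) ≤ n := Nat.cast_nonneg n
        linarith
      have e : (1/4 + ((n+1 : ℕ) : ℂ) + y * Complex.I) = (1/4 + n + y * Complex.I) + 1 := by push_cast; ring
      rw [e, Complex.Gamma_add_one _ hne, norm_mul, pow_succ, ← mul_assoc, mul_comm]
      have h1 : 1/8 * (1 + |y|) ≤ ‖(1/4 + n + y * Complex.I : ℂ)‖ := by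
        have a1 : |(1/4 + n + y * Complex.I : ℂ).re| ≤ _ := Complex.abs_re_le_norm _
        have a2 : |(1/4 + n + y * Complex.I : ℂ).im| ≤ _ := Complex.abs_im_le_norm _
        simp at a1 a2
        have hm0 : (0:ℝ) ≤ n := Nat.cast_nonneg n
        rw [abs_of_nonneg (by positivity)] at a1
        have e1 : (1/4 + n + y * Complex.I : ℂ) = (4⁻¹ + n + y * Complex.I : ℂ) := by norm_num
        rw [e1]
        linarith
      exact mul_le_mul h1 (ih y) (by positivity) (norm_nonneg _)
  have hB : ∀ y : ℝ, ‖Complex.Gamma (1/4 + N + y * Complex.I)‖ ≤ Real.Gamma (1/4 + N) := by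
    intro y
    have hpos : (0:ℝ) < 1/4 + N := by positivity
    rw [Complex.Gamma_eq_integral (by simp; positivity), Real.Gamma_eq_integral hpos, Complex.GammaIntegral]
    apply MeasureTheory.norm_integral_le_of_norm_le (Real.GammaIntegral_convergent hpos)
    filter_upwards [MeasureTheory.ae_restrict_mem measurableSet_Ioi] with x hx
    rw [norm_mul, Complex.norm_cpow_eq_rpow_re_of_pos hx, Complex.norm_real, Real.norm_eq_abs,
      abs_of_pos (Real.exp_pos _)]
    simp
  refine ⟨Real.Gamma (1/4 + N) * 8 ^ N, by have := Real.Gamma_pos_of_pos (s := 1/4 + (N:ℝ)) (by positivity); positivity, fun y => ?_⟩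
  have h1 := (key N y).trans (hB y)
  rw [mul_pow, ← mul_assoc] at h1
  have hp : 0 < (1 + |y|) ^ N := by positivity
  rw [Real.rpow_neg (by positivity), Real.rpow_natCast, ← div_eq_mul_inv, le_div_iff₀ hp]
  have : (1/8:ℝ)^N * 8^N = 1 := by rw [← mul_pow]; norm_num
  calc _ = (‖Complex.Gamma (1/4 + y * Complex.I)‖ * (1/8)^N * (1 + |y|)^N) * 8^N := by
        rw [mul_right_comm _ _ ((8:ℝ)^N), mul_assoc _ ((1/8:ℝ)^N), this, mul_one]
    _ ≤ _ := by gcongr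


lemma char_sum_range_bound {q : ℕ} [NeZero q] {χ : DirichletCharacter ℂ q} (hχ : χ ≠ 1) (n : ℕ) :
    ‖∑ k ∈ range n, χ (k : ZMod q)‖ ≤ q := by
  have hper : ∑ k ∈ range q, χ (k : ZMod q) = 0 := by
    rw [← MulChar.sum_eq_zero_of_ne_one hχ]
    refine Finset.sum_nbij' (fun k : ℕ => (k : ZMod q)) (fun a => a.val) ?_ ?_ ?_ ?_ ?_
    · intro a _; simp
    · intro a _; simpa using ZMod.val_lt a
    · intro a ha; exact ZMod.val_cast_of_lt (by simpa using ha)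
    · intro a _; simp
    · intro a _; rfl
  have hmul : ∀ m : ℕ, ∑ k ∈ range (q * m), χ (k : ZMod q) = 0 := by
    intro m
    induction m with
    | zero => simp
    | succ m ih =>
      rw [Nat.mul_succ, Finset.sum_range_add, ih, zero_add, ← hper]
      apply Finset.sum_congr rfl
      intro x _
      simp
  conv_lhs => rw [← Nat.div_add_mod n q]
  rw [Finset.sum_range_add, hmul, zero_add]
  refine (norm_sum_le _ _).trans ?_
  refine (Finset.sum_le_sum (fun i _ => DirichletCharacter.norm_le_one χ _)).trans ?_
  simp
  exact (Nat.mod_lt n (NeZero.pos q)).le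

lemma char_sum_Icc_bound {q : ℕ} [NeZero q] {χ : DirichletCharacter ℂ q} (hχ : χ ≠ 1) (n : ℕ) :
    ‖∑ k ∈ Icc 1 n, χ (k : ZMod q)‖ ≤ 2 * q := by
  have e : ∑ k ∈ Icc 1 n, χ (k : ZMod q) = (∑ k ∈ range (n+1), χ (k : ZMod q)) - ∑ k ∈ range 1, χ (k : ZMod q) := by
    rw [← Finset.sum_Ico_eq_sub _ (by omega)]
    rfl
  rw [e]
  refine (norm_sub_le _ _).trans ?_
  linarith [char_sum_range_bound hχ (n+1), char_sum_range_bound hχ 1]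

lemma L_eq_integral {q : ℕ} [NeZero q] {χ : DirichletCharacter ℂ q} (hχ : χ ≠ 1) {s : ℂ} (hs : 0 < s.re) :
    DirichletCharacter.LFunction χ s =
      s * ∫ t in Set.Ioi (1 : ℝ), (∑ k ∈ Icc 1 ⌊t⌋₊, χ (k : ZMod q)) * (t:ℂ) ^ (-(s + 1)) := by
  set S : ℝ → ℂ := fun t => ∑ k ∈ Icc 1 ⌊t⌋₊, χ (k : ZMod q) with hS
  have hSb : ∀ t, ‖S t‖ ≤ 2 * q := fun t => char_sum_Icc_bound hχ _
  have hSm : Measurable S := by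
    have : S = (fun n : ℕ => ∑ k ∈ Icc 1 n, χ (k : ZMod q)) ∘ (fun t : ℝ => ⌊t⌋₊) := rfl
    rw [this]
    exact (measurable_from_top).comp Nat.measurable_floor
  set f : ℝ → ℂ := fun t => (Set.Ioi (1:ℝ)).indicator S t with hf
  have hfb : ∀ t, ‖f t‖ ≤ 2 * q := by
    intro t
    simp only [hf]
    exact (norm_indicator_le_norm_self _ _).trans (hSb t)
  have hfm : Measurable f := hSm.indicator measurableSet_Ioi
  have e1 : ∀ s : ℂ, ∫ t in Set.Ioi (1 : ℝ), S t * (t:ℂ) ^ (-(s + 1)) = mellin f (-s) := by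
    intro s
    unfold mellin
    have : (Set.Ioi (1:ℝ)) ⊆ Set.Ioi 0 := Set.Ioi_subset_Ioi zero_le_one
    rw [← MeasureTheory.integral_indicator measurableSet_Ioi, ← MeasureTheory.integral_indicator measurableSet_Ioi]
    congr 1
    ext t
    by_cases ht : 1 < t
    · have h0 : 0 < t := by linarith
      simp [hf, Set.indicator, ht, h0]
      rw [mul_comm]; congr 2; ring
    · by_cases h0 : 0 < t <;> simp [hf, Set.indicator, ht, h0]
  have hloc : MeasureTheory.LocallyIntegrableOn f (Set.Ioi 0) := by
    apply MeasureTheory.LocallyIntegrable.locallyIntegrableOn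
    have : MeasureTheory.LocallyIntegrable (fun _ : ℝ => (2 * q : ℝ)) := MeasureTheory.locallyIntegrable_const _
    exact this.mono hfm.aestronglyMeasurable (Filter.Eventually.of_forall fun t => by
      rw [Real.norm_eq_abs, abs_of_nonneg (by positivity)]; exact hfb t)
  have hdiff : ∀ s : ℂ, 0 < s.re → DifferentiableAt ℂ (fun s => mellin f (-s)) s := by
    intro s hs
    have h1 : DifferentiableAt ℂ (mellin f) (-s) := by
      apply mellin_differentiableAt_of_isBigO_rpow (a := 0) (b := -s.re - 1) hloc
      · apply Asymptotics.IsBigO.of_bound (2*q)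
        filter_upwards with t
        simpa using hfb t
      · simpa
      · apply Asymptotics.IsBigO.of_bound 1
        have : Set.Ioo (0:ℝ) 1 ∈ nhdsWithin (0:ℝ) (Set.Ioi 0) := Ioo_mem_nhdsGT zero_lt_one
        filter_upwards [this] with t ht
        have : f t = 0 := by simp [hf, Set.indicator]; intro h; linarith [ht.2]
        rw [this]; simp
      · simp
    exact h1.comp s (by fun_prop)
  rw [e1]
  have hopen : IsOpen {s : ℂ | 0 < s.re} := isOpen_lt continuous_const Complex.continuous_re
  have hconn : IsPreconnected {s : ℂ | 0 < s.re} := (convex_halfSpace_re_gt 0).isPreconnected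
  have A1 : AnalyticOnNhd ℂ (DirichletCharacter.LFunction χ) {s : ℂ | 0 < s.re} :=
    ((DirichletCharacter.differentiable_LFunction hχ).differentiableOn).analyticOnNhd hopen
  have A2 : AnalyticOnNhd ℂ (fun s => s * mellin f (-s)) {s : ℂ | 0 < s.re} := by
    apply DifferentiableOn.analyticOnNhd _ hopen
    intro s hs
    exact (differentiableAt_id.mul (hdiff s hs)).differentiableWithinAt
  refine A1.eqOn_of_preconnected_of_eventuallyEq A2 hconn (z₀ := 2) (by simp) ?_ hs
  have h2 : {s : ℂ | 1 < s.re} ∈ nhds (2:ℂ) := (isOpen_lt continuous_const Complex.continuous_re).mem_nhds (by simp)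
  filter_upwards [h2] with s hs
  have hs' : 1 < s.re := hs
  rw [DirichletCharacter.LFunction_eq_LSeries χ hs', ← e1]
  apply LSeries_eq_mul_integral (fun n => χ (n : ZMod q)) (r := 0) le_rfl (by linarith)
  · exact ZMod.LSeriesSummable_of_one_lt_re χ hs'
  · apply Asymptotics.IsBigO.of_bound (2*q)
    filter_upwards with n
    simpa using char_sum_Icc_bound hχ n

lemma L_growth {q : ℕ} [NeZero q] {χ : DirichletCharacter ℂ q} (hχ : χ ≠ 1) {s : ℂ} (hs : 1/16 ≤ s.re) :
    ‖DirichletCharacter.LFunction χ s‖ ≤ 32 * q * ‖s‖ := by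
  rw [L_eq_integral hχ (by linarith), norm_mul]
  have h : ‖∫ t in Set.Ioi (1 : ℝ), (∑ k ∈ Icc 1 ⌊t⌋₊, χ (k : ZMod q)) * (t:ℂ) ^ (-(s + 1))‖ ≤
      ∫ t in Set.Ioi (1 : ℝ), (2 * q) * t ^ (-(s.re + 1)) := by
    apply MeasureTheory.norm_integral_le_of_norm_le
    · apply MeasureTheory.Integrable.const_mul
      exact integrableOn_Ioi_rpow_of_lt (by linarith) zero_lt_one
    · filter_upwards [MeasureTheory.ae_restrict_mem measurableSet_Ioi] with t ht
      have ht0 : (0:ℝ) < t := lt_trans zero_lt_one ht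
      rw [norm_mul, Complex.norm_cpow_eq_rpow_re_of_pos ht0]
      simp only [neg_re, add_re, one_re]
      gcongr
      exact char_sum_Icc_bound hχ _
  rw [MeasureTheory.integral_const_mul, integral_Ioi_rpow_of_lt (by linarith) zero_lt_one] at h
  have e : -(s.re + 1) + 1 = - s.re := by ring
  rw [e, Real.one_rpow, neg_div_neg_eq] at h
  have : 1 / s.re ≤ 16 := by rw [div_le_iff₀ (by linarith)]; linarith
  calc _ ≤ ‖s‖ * (2 * q * 16) := by gcongr; exact h.trans (by gcongr)
    _ = _ := by ring


/-- terms of the prime power expansion of `log L` -/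
noncomputable def lterm {q : ℕ} (χ : DirichletCharacter ℂ q) (s : ℂ) (pe : Nat.Primes × ℕ) : ℂ :=
  (χ (pe.1 : ℕ) * ((pe.1 : ℕ) : ℂ) ^ (-s)) ^ (pe.2 + 1) / ((pe.2 + 1 : ℕ) : ℂ)

lemma lterm_norm_le {q : ℕ} (χ : DirichletCharacter ℂ q) (s : ℂ) (pe : Nat.Primes × ℕ) {σ : ℝ}
    (hσ : σ ≤ s.re) :
    ‖lterm χ s pe‖ ≤ (((pe.1 : ℕ) ^ (pe.2 + 1) : ℕ) : ℝ) ^ (-σ) := by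
  have hp : (0:ℝ) < (pe.1 : ℕ) := by exact_mod_cast pe.1.2.pos
  have hp1 : (1:ℝ) ≤ (pe.1 : ℕ) := by exact_mod_cast pe.1.2.one_lt.le
  unfold lterm
  rw [norm_div, norm_pow, norm_mul, Complex.norm_natCast, Complex.norm_natCast_cpow_of_pos pe.1.2.pos]
  have h1 : ‖χ ((pe.1 : ℕ) : ZMod q)‖ ≤ 1 := DirichletCharacter.norm_le_one χ _
  have h2 : ((pe.1 : ℕ) : ℝ) ^ (-s).re ≤ ((pe.1 : ℕ) : ℝ) ^ (-σ) :=
    Real.rpow_le_rpow_of_exponent_le hp1 (by simpa using hσ)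
  have h3 : (1:ℝ) ≤ ((pe.2 + 1 : ℕ) : ℝ) := by push_cast; linarith [(Nat.cast_nonneg pe.2 : (0:ℝ) ≤ pe.2)]
  have e : (((pe.1 : ℕ) ^ (pe.2 + 1) : ℕ) : ℝ) ^ (-σ) = (((pe.1 : ℕ) : ℝ) ^ (-σ)) ^ (pe.2 + 1) := by
    rw [Nat.cast_pow, Real.rpow_pow_comm hp.le]
  rw [e]
  refine (div_le_self (by positivity) (by exact_mod_cast h3)).trans ?_
  gcongr
  calc _ ≤ 1 * ((pe.1 : ℕ) : ℝ) ^ (-σ) := by gcongr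
    _ = _ := one_mul _

lemma primes_pow_inj : Function.Injective (fun pe : Nat.Primes × ℕ => ((pe.1 : ℕ) ^ (pe.2 + 1))) := by
  rintro ⟨p, e⟩ ⟨p', e'⟩ h
  have h' : (p:ℕ) ^ (e+1) = (p':ℕ)^(e'+1) := h
  have hpp : (p:ℕ) = p' := by
    have : (p:ℕ) ∣ (p':ℕ)^(e'+1) := by rw [← h']; exact dvd_pow_self _ (by omega)
    exact (Nat.prime_dvd_prime_iff_eq p.2 p'.2).1 (p.2.dvd_of_dvd_pow this)
  rw [hpp] at h'
  have := Nat.pow_right_injective p'.2.two_le h'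
  exact Prod.ext (Subtype.ext hpp) (by simpa using this)

lemma summable_primes_pow {σ : ℝ} (hσ : 1 < σ) :
    Summable (fun pe : Nat.Primes × ℕ => (((pe.1 : ℕ) ^ (pe.2 + 1) : ℕ) : ℝ) ^ (-σ)) :=
  (Real.summable_nat_rpow.2 (by linarith : -σ < -1)).comp_injective primes_pow_inj

lemma lterm_summable {q : ℕ} (χ : DirichletCharacter ℂ q) {s : ℂ} (hs : 1 < s.re) :
    Summable (lterm χ s) :=
  Summable.of_norm_bounded (summable_primes_pow hs) (fun pe => lterm_norm_le χ s pe le_rfl)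

lemma exp_lterm {q : ℕ} [NeZero q] (χ : DirichletCharacter ℂ q) {s : ℂ} (hs : 1 < s.re) :
    Complex.exp (∑' pe, lterm χ s pe) = DirichletCharacter.LFunction χ s := by
  rw [DirichletCharacter.LFunction_eq_LSeries χ hs, ← DirichletCharacter.LSeries_eulerProduct_exp_log χ hs]
  congr 1
  rw [(lterm_summable χ hs).tsum_prod]
  congr 1
  ext p
  have hp : (0:ℝ) < (p : ℕ) := by exact_mod_cast p.2.pos
  have hp1 : (1:ℝ) < (p : ℕ) := by exact_mod_cast p.2.one_lt
  have hz : ‖χ ((p : ℕ) : ZMod q) * ((p : ℕ) : ℂ) ^ (-s)‖ < 1 := by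
    rw [norm_mul, Complex.norm_natCast_cpow_of_pos p.2.pos]
    have h1 : ‖χ ((p : ℕ) : ZMod q)‖ ≤ 1 := DirichletCharacter.norm_le_one χ _
    have h2 : ((p : ℕ) : ℝ) ^ (-s).re < 1 := Real.rpow_lt_one_of_one_lt_of_neg hp1 (by simp; linarith)
    have h3 : 0 ≤ ((p : ℕ) : ℝ) ^ (-s).re := by positivity
    nlinarith [norm_nonneg (χ ((p : ℕ) : ZMod q))]
  have h := Complex.hasSum_taylorSeries_neg_log hz
  rw [← hasSum_nat_add_iff' 1] at h
  simp only [sum_range_one, pow_zero, Nat.cast_zero, div_zero, sub_zero] at h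
  exact h.tsum_eq

lemma lterm_differentiable {q : ℕ} (χ : DirichletCharacter ℂ q) (pe : Nat.Primes × ℕ) :
    Differentiable ℂ (fun s => lterm χ s pe) := by
  unfold lterm
  have hp : ((pe.1 : ℕ) : ℂ) ≠ 0 := by exact_mod_cast pe.1.2.ne_zero
  intro s
  apply DifferentiableAt.div_const
  apply DifferentiableAt.pow
  apply DifferentiableAt.const_mul
  exact DifferentiableAt.const_cpow (by fun_prop) (Or.inl hp)

lemma lsum_differentiableOn {q : ℕ} (χ : DirichletCharacter ℂ q) :
    DifferentiableOn ℂ (fun s => ∑' pe, lterm χ s pe) {s | 1 < s.re} := by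
  intro s hs
  have hs' : 1 < s.re := hs
  apply DifferentiableAt.differentiableWithinAt
  set σ := (1 + s.re) / 2
  have ho : IsOpen {z : ℂ | σ < z.re} := isOpen_lt continuous_const Complex.continuous_re
  have : DifferentiableOn ℂ (fun s => ∑' pe, lterm χ s pe) {z : ℂ | σ < z.re} := by
    apply differentiableOn_tsum_of_summable_norm (summable_primes_pow (σ := σ) (by simp only [σ]; linarith))
      (fun pe => (lterm_differentiable χ pe).differentiableOn) ho
    intro pe w hw
    exact lterm_norm_le χ w pe (le_of_lt hw)
  exact this.differentiableAt (ho.mem_nhds (by simp only [σ, Set.mem_ofPred_eq]; linarith))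

lemma L_ne_zero {q : ℕ} [NeZero q] {χ : DirichletCharacter ℂ q} (hχ : χ ≠ 1) (hRH : dirichletRH χ)
    {s : ℂ} (hs : 1/2 < s.re) : DirichletCharacter.LFunction χ s ≠ 0 := by
  intro h
  by_cases h1 : s.re < 1
  · have := hRH s (by linarith) h1 h
    linarith
  · exact DirichletCharacter.LFunction_ne_zero_of_one_le_re χ (Or.inl hχ) (not_lt.1 h1) h

lemma exists_logL {q : ℕ} [NeZero q] {χ : DirichletCharacter ℂ q} (hχ : χ ≠ 1) (hRH : dirichletRH χ) :
    ∃ l : ℂ → ℂ, DifferentiableOn ℂ l {s | 1/2 < s.re} ∧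
      (∀ s : ℂ, 1/2 < s.re → Complex.exp (l s) = DirichletCharacter.LFunction χ s) ∧
      ∀ s : ℂ, 1 < s.re → l s = ∑' pe, lterm χ s pe := by
  have ho : IsOpen {z : ℂ | 1/2 < z.re} := isOpen_lt continuous_const Complex.continuous_re
  have ho1 : IsOpen {z : ℂ | 1 < z.re} := isOpen_lt continuous_const Complex.continuous_re
  obtain ⟨h, hd, he⟩ := exists_log_of_convex ho (convex_halfSpace_re_gt (1/2)) ⟨2, by simp; norm_num⟩
    ((DirichletCharacter.differentiable_LFunction hχ).differentiableOn) (fun z hz => L_ne_zero hχ hRH hz)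
  set d : ℂ → ℂ := fun s => h s - ∑' pe, lterm χ s pe with hdd
  have hdiff : DifferentiableOn ℂ d {z : ℂ | 1 < z.re} :=
    (hd.mono (fun z hz => by simp only [Set.mem_ofPred_eq] at *; linarith)).sub (lsum_differentiableOn χ)
  have hexp : ∀ z ∈ {z : ℂ | 1 < z.re}, Complex.exp (d z) = 1 := by
    intro z hz
    have hz' : 1 < z.re := hz
    simp only [hdd, Complex.exp_sub]
    rw [he z (by simp only [Set.mem_ofPred_eq]; linarith), exp_lterm χ hz', div_self]
    exact L_ne_zero hχ hRH (by linarith)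
  have hder : Set.EqOn (deriv d) 0 {z : ℂ | 1 < z.re} := by
    intro z hz
    have hn := ho1.mem_nhds hz
    have h1 := (hdiff.differentiableAt hn).hasDerivAt.cexp
    have e1 : (fun w => Complex.exp (d w)) =ᶠ[nhds z] fun _ => (1:ℂ) := by
      filter_upwards [hn] with w hw using hexp w hw
    have h2 : HasDerivAt (fun w => Complex.exp (d w)) 0 z := (hasDerivAt_const z (1:ℂ)).congr_of_eventuallyEq e1
    have := h1.unique h2
    simpa [Complex.exp_ne_zero] using this
  obtain ⟨c, hc⟩ := ho1.exists_is_const_of_deriv_eq_zero (convex_halfSpace_re_gt 1).isPreconnected hdiff hder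
  have hc1 : Complex.exp c = 1 := by
    rw [← hc 2 (by simp)]; exact hexp 2 (by simp)
  refine ⟨fun s => h s - c, hd.sub_const _, ?_, ?_⟩
  · intro s hs
    rw [Complex.exp_sub, hc1, div_one]
    exact he s hs
  · intro s hs
    have := hc s hs
    simp only [hdd] at this
    rw [← this]; ring

lemma logL_growth {q : ℕ} [NeZero q] {χ : DirichletCharacter ℂ q} (hχ : χ ≠ 1)
    {l : ℂ → ℂ} (hd : DifferentiableOn ℂ l {s | 1/2 < s.re})
    (he : ∀ s : ℂ, 1/2 < s.re → Complex.exp (l s) = DirichletCharacter.LFunction χ s)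
    (hs1 : ∀ s : ℂ, 1 < s.re → l s = ∑' pe, lterm χ s pe) {δ : ℝ} (hδ : 0 < δ) (hδ1 : δ ≤ 1) :
    ∃ C : ℝ, 0 < C ∧ ∀ s : ℂ, 1/2 + δ ≤ s.re → ‖l s‖ ≤ C * (1 + ‖s‖) := by
  set K := ∑' pe : Nat.Primes × ℕ, (((pe.1 : ℕ) ^ (pe.2 + 1) : ℕ) : ℝ) ^ (-(2:ℝ)) with hK
  have hK0 : 0 ≤ K := tsum_nonneg (fun _ => by positivity)
  have h2 : ∀ s : ℂ, 2 ≤ s.re → ‖l s‖ ≤ K := by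
    intro s hs
    rw [hs1 s (by linarith)]
    exact tsum_of_norm_bounded (summable_primes_pow (by norm_num)).hasSum (fun pe => lterm_norm_le χ s pe hs)
  obtain ⟨q', hq'⟩ : ∃ q' : ℝ, q' = (q : ℝ) := ⟨_, rfl⟩
  have hq1 : 0 ≤ q' := by rw [hq']; exact Nat.cast_nonneg q
  refine ⟨8/δ * (128 * q' + 2*K + 1) + K, by positivity, fun s hs => ?_⟩
  have hn0 := norm_nonneg s
  by_cases hs2 : 2 ≤ s.re
  · refine (h2 s hs2).trans ?_
    have : 0 ≤ 8/δ * (128 * q' + 2*K + 1) := by positivity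
    nlinarith
  push Not at hs2
  set c : ℂ := 2 + s.im * Complex.I with hc
  have hcs : ‖s - c‖ = 2 - s.re := by
    have : s - c = ((s.re - 2 : ℝ) : ℂ) := by
      apply Complex.ext <;> simp [hc]
    rw [this, Complex.norm_real, Real.norm_eq_abs, abs_of_neg (by linarith)]; ring
  have hcn : ‖c‖ ≤ 2 + ‖s‖ := by
    refine (norm_add_le _ _).trans ?_
    simp
    exact Complex.abs_im_le_norm s
  set M := 32 * q' * (4 + ‖s‖) + K + 1 with hM
  have hM0 : 0 < M := by positivity
  have hball : ∀ z ∈ Metric.ball c (3/2 - δ/2), 1/2 < z.re := by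
    intro z hz
    have h1 : ‖z - c‖ < 3/2 - δ/2 := by simpa [dist_eq_norm] using hz
    have := (abs_lt.1 ((Complex.abs_re_le_norm (z - c)).trans_lt h1)).1
    simp [hc] at this; linarith
  have hBC := BC_center (c := c) (R := 3/2 - δ/2) (M := M) (f := l) (z := s) (by linarith) hM0
    (hd.mono (fun z hz => hball z hz)) ?_ (by simp [dist_eq_norm, hcs]; linarith)
  · have hlc : ‖l c‖ ≤ K := h2 c (by simp [hc])
    rw [hcs] at hBC
    have hden : δ/2 ≤ 3/2 - δ/2 - (2 - s.re) := by linarith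
    have h3 : 2 * M * (2 - s.re) / (3/2 - δ/2 - (2 - s.re)) ≤ 2 * M * 2 / (δ/2) := by
      apply div_le_div₀ (by positivity) _ (by positivity) hden
      gcongr; linarith
    have h4 : ‖l s‖ ≤ 2 * M * 2 / (δ/2) + K := by
      calc ‖l s‖ = ‖(l s - l c) + l c‖ := by ring_nf
        _ ≤ _ := norm_add_le _ _
        _ ≤ _ := by linarith
    refine h4.trans ?_
    have h5 : M ≤ (128 * q' + 2*K + 1) * (1 + ‖s‖) := by rw [hM]; nlinarith [mul_nonneg hq1 hn0, mul_nonneg hK0 hn0]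
    calc 2 * M * 2 / (δ/2) + K = 8/δ * M + K := by field_simp; ring
      _ ≤ 8/δ * ((128 * q' + 2*K + 1) * (1 + ‖s‖)) + K * (1 + ‖s‖) := by
          gcongr; nlinarith
      _ = _ := by ring
  · intro z hz
    have hz1 := hball z hz
    have h1 : ‖z - c‖ < 3/2 - δ/2 := by simpa [dist_eq_norm] using hz
    have hzn : ‖z‖ ≤ 4 + ‖s‖ := by
      calc ‖z‖ = ‖(z - c) + c‖ := by ring_nf
        _ ≤ _ := norm_add_le _ _
        _ ≤ _ := by linarith
    have hL := L_growth hχ (s := z) (by linarith)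
    rw [← he z hz1, Complex.norm_exp, ← hq'] at hL
    have h6 : (l z).re ≤ 32 * q' * (4 + ‖s‖) := by
      calc (l z).re ≤ Real.exp (l z).re := by linarith [Real.add_one_le_exp (l z).re]
        _ ≤ _ := hL
        _ ≤ _ := by gcongr
    have hlc : ‖l c‖ ≤ K := h2 c (by simp [hc])
    have := (abs_le.1 ((Complex.abs_re_le_norm (l c)).trans hlc)).1
    rw [hM]; linarith


lemma half_open (c : ℝ) : IsOpen {z : ℂ | c < z.re} := isOpen_lt continuous_const Complex.continuous_re

lemma LFunction_conj {q : ℕ} [NeZero q] {χ : DirichletCharacter ℂ q} (hχ : χ ≠ 1) (s : ℂ) :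
    DirichletCharacter.LFunction χ⁻¹ ((starRingEnd ℂ) s) = (starRingEnd ℂ) (DirichletCharacter.LFunction χ s) := by
  have hχ' : χ⁻¹ ≠ 1 := inv_ne_one.2 hχ
  set f : ℂ → ℂ := fun z => (starRingEnd ℂ) (DirichletCharacter.LFunction χ⁻¹ ((starRingEnd ℂ) z)) with hf
  have hfd : Differentiable ℂ f := by
    intro z
    have := (DirichletCharacter.differentiable_LFunction hχ').differentiableAt (x := (starRingEnd ℂ) z)
    have h2 := this.conj_conj
    simpa [hf, Function.comp_def] using h2
  have hgd := DirichletCharacter.differentiable_LFunction hχ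
  have heq : f = DirichletCharacter.LFunction χ := by
    refine AnalyticOnNhd.eq_of_eventuallyEq (z₀ := 2) (𝕜 := ℂ) ?_ ?_ ?_
    · exact fun z _ => (hfd.analyticAt z)
    · exact fun z _ => (hgd.analyticAt z)
    · filter_upwards [(half_open 1).mem_nhds (show (2:ℂ) ∈ {z : ℂ | 1 < z.re} by simp)] with z hz
      have hz : 1 < z.re := hz
      simp only [hf]
      rw [DirichletCharacter.LFunction_eq_LSeries χ hz, DirichletCharacter.LFunction_eq_LSeries χ⁻¹ (by simpa using hz),
        LSeries, LSeries, Complex.conj_tsum]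
      congr 1; ext n
      rcases eq_or_ne n 0 with rfl | hn
      · simp
      · rw [LSeries.term_of_ne_zero hn, LSeries.term_of_ne_zero hn, map_div₀]
        congr 1
        · rw [← MulChar.star_eq_inv, MulChar.star_apply]; simp
        · rw [Complex.cpow_conj _ _ (by rw [Complex.natCast_arg]; exact Real.pi_pos.ne)]; simp
  have := congrFun heq s
  simp only [hf] at this
  rw [← this]; simp

lemma Gammaℝ_conj (s : ℂ) : Complex.Gammaℝ ((starRingEnd ℂ) s) = (starRingEnd ℂ) (Complex.Gammaℝ s) := by
  rw [Complex.Gammaℝ_def, Complex.Gammaℝ_def, map_mul, ← Complex.Gamma_conj]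
  congr 1
  · rw [show -(starRingEnd ℂ) s / 2 = (starRingEnd ℂ) (-s/2) by simp [map_ofNat], Complex.cpow_conj _ _ (by rw [Complex.arg_ofReal_of_nonneg Real.pi_pos.le]; exact Real.pi_pos.ne)]
    simp
  · simp [map_ofNat]

lemma completed_eq {q : ℕ} [NeZero q] {χ : DirichletCharacter ℂ q} (he : χ.Even) {s : ℂ} (hs : 0 < s.re) :
    DirichletCharacter.completedLFunction χ s = Complex.Gammaℝ s * DirichletCharacter.LFunction χ s := by
  rw [DirichletCharacter.LFunction_eq_completed_div_gammaFactor χ s (Or.inl (by rintro rfl; simp at hs)), he.gammaFactor_def]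
  field_simp [Complex.Gammaℝ_ne_zero_of_re_pos hs]

lemma inv_even {q : ℕ} [NeZero q] {χ : DirichletCharacter ℂ q} (he : χ.Even) : (χ⁻¹).Even := by
  unfold DirichletCharacter.Even at *
  rw [← MulChar.star_eq_inv, MulChar.star_apply, he]; simp

lemma completed_conj {q : ℕ} [NeZero q] {χ : DirichletCharacter ℂ q} (hχ : χ ≠ 1) (he : χ.Even) {s : ℂ} (hs : 0 < s.re) :
    DirichletCharacter.completedLFunction χ⁻¹ ((starRingEnd ℂ) s) =
      (starRingEnd ℂ) (DirichletCharacter.completedLFunction χ s) := by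
  rw [completed_eq he hs, completed_eq (inv_even he) (by simpa using hs), LFunction_conj hχ, Gammaℝ_conj, map_mul]

lemma completed_fe_norm {q : ℕ} [NeZero q] {χ : DirichletCharacter ℂ q} (hχ : χ ≠ 1) (hp : χ.IsPrimitive)
    (he : χ.Even) (t a : ℝ) (ha : -1/2 < a) :
    ‖DirichletCharacter.completedLFunction χ (1/2 - a + t * I)‖ = (q:ℝ) ^ a *
      ‖DirichletCharacter.rootNumber χ‖ * ‖DirichletCharacter.completedLFunction χ (1/2 + a + t * I)‖ := by
  have h := hp.completedLFunction_one_sub ((starRingEnd ℂ) (1/2 + a + t * I))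
  have e1 : (1:ℂ) - (starRingEnd ℂ) (1/2 + a + t * I) = 1/2 - a + t * I := by
    simp only [map_add, map_mul, Complex.conj_ofReal, Complex.conj_I, map_div₀, map_one, map_ofNat]; ring
  rw [e1, completed_conj hχ he (by simp; linarith)] at h
  rw [h, norm_mul, norm_mul, RCLike.norm_conj, Complex.norm_natCast_cpow_of_pos (NeZero.pos q)]
  simp

lemma rootNumber_norm {q : ℕ} [NeZero q] {χ : DirichletCharacter ℂ q} (hχ : χ ≠ 1) (hp : χ.IsPrimitive)
    (he : χ.Even) (hRH : dirichletRH χ) : ‖DirichletCharacter.rootNumber χ‖ = 1 := by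
  by_contra hne
  have h0 : ∀ t : ℝ, DirichletCharacter.completedLFunction χ (1/2 + t * I) = 0 := by
    intro t
    have := completed_fe_norm hχ hp he t 0 (by norm_num)
    simp only [ofReal_zero, sub_zero, add_zero, Real.rpow_zero, one_mul] at this
    by_contra hz
    have hz' := norm_ne_zero_iff.2 hz
    apply hne
    exact mul_right_cancel₀ hz' (by rw [one_mul]; exact this.symm)
  have hd := DirichletCharacter.differentiable_completedLFunction hχ
  have hz : DirichletCharacter.completedLFunction χ 2 = 0 := by
    have := AnalyticOnNhd.eqOn_zero_of_preconnected_of_frequently_eq_zero (f := DirichletCharacter.completedLFunction χ)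
      (U := Set.univ) (z₀ := 1/2) (𝕜 := ℂ) (fun z _ => hd.analyticAt z) isPreconnected_univ (Set.mem_univ _) ?_
    · exact this (Set.mem_univ _)
    · have ht : Filter.Tendsto (fun n : ℕ => (1/2 : ℂ) + ((1 / ((n:ℝ) + 1) : ℝ) : ℂ) * I) Filter.atTop (nhdsWithin (1/2) {1/2}ᶜ) := by
        apply tendsto_nhdsWithin_iff.2 ⟨?_, ?_⟩
        · have h1 := (Complex.continuous_ofReal.tendsto 0).comp (tendsto_one_div_add_atTop_nhds_zero_nat (𝕜 := ℝ))
          have h2 := ((h1.mul_const I).const_add (1/2 : ℂ))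
          simpa [Function.comp_def] using h2
        · filter_upwards with n
          simp only [Set.mem_compl_iff, Set.mem_singleton_iff, add_eq_left, mul_eq_zero, I_ne_zero, or_false, ofReal_eq_zero]
          positivity
      exact ht.frequently (Filter.Frequently.of_forall fun n => h0 _)
  rw [completed_eq he (by simp)] at hz
  rcases mul_eq_zero.1 hz with h | h
  · exact Complex.Gammaℝ_ne_zero_of_re_pos (by simp) h
  · exact L_ne_zero hχ hRH (by simp; norm_num) h

/-- `log Gammaℝ` -/
lemma exists_logGammaR : ∃ lg : ℂ → ℂ, DifferentiableOn ℂ lg {s | 0 < s.re} ∧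
      (∀ s : ℂ, 0 < s.re → Complex.exp (lg s) = Complex.Gammaℝ s) ∧
      ∃ C : ℝ, 0 < C ∧ ∀ s : ℂ, 1/2 ≤ s.re → ‖deriv (deriv lg) s‖ ≤ C * Real.log (2 + ‖s‖) := by
  have hdG : DifferentiableOn ℂ (fun s => Complex.Gamma s) {s | 0 < s.re} := by
    intro s hs
    exact (Complex.differentiableAt_Gamma s (fun m h => by
      have hs : 0 < s.re := hs
      rw [h] at hs; simp at hs
      linarith [(Nat.cast_nonneg m : (0:ℝ) ≤ m)])).differentiableWithinAt
  obtain ⟨h, hd, he⟩ := exists_log_of_convex (half_open 0) (convex_halfSpace_re_gt 0) ⟨1, by simp⟩ hdG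
    (fun z hz => Complex.Gamma_ne_zero_of_re_pos hz)
  obtain ⟨C, hC, hb⟩ := Gamma_deriv2
  have hmap : ∀ s : ℂ, 0 < s.re → 0 < (s/2).re := fun s hs => by
    simpa using hs
  have hder : ∀ z : ℂ, 0 < z.re → deriv h z = logDeriv Complex.Gamma z := by
    intro z hz
    have h1 : HasDerivAt h (deriv h z) z := ((hd z hz).differentiableAt ((half_open 0).mem_nhds hz)).hasDerivAt
    have h2 := h1.cexp
    have h3 : (fun x => Complex.exp (h x)) =ᶠ[nhds z] Complex.Gamma := by
      filter_upwards [(half_open 0).mem_nhds hz] with w hw using he w hw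
    have h4 := h3.deriv_eq
    rw [h2.deriv] at h4
    rw [logDeriv_apply, ← h4, he z hz]
    field_simp [Complex.Gamma_ne_zero_of_re_pos hz]
  refine ⟨fun s => -s/2 * Complex.log π + h (s/2), ?_, ?_, C/4, by positivity, ?_⟩
  · apply DifferentiableOn.add
    · fun_prop
    · exact hd.comp (by fun_prop) (fun s hs => hmap s hs)
  · intro s hs
    simp only
    rw [Complex.exp_add, he _ (hmap s hs), Complex.Gammaℝ_def, Complex.cpow_def_of_ne_zero (by exact_mod_cast Real.pi_pos.ne'), mul_comm (Complex.log _)]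
  · intro s hs
    have hs0 : 0 < s.re := by linarith
    have hd1 : ∀ z : ℂ, 0 < z.re → deriv (fun s => -s/2 * Complex.log π + h (s/2)) z = -1/2 * Complex.log π + logDeriv Complex.Gamma (z/2) * (1/2) := by
      intro z hz
      have h1 : HasDerivAt h (deriv h (z/2)) (z/2) :=
        ((hd (z/2) (hmap z hz)).differentiableAt ((half_open 0).mem_nhds (hmap z hz))).hasDerivAt
      have h2 : HasDerivAt (fun s : ℂ => s/2) (1/2) z := (hasDerivAt_id z).div_const 2
      have h3 := h1.comp z h2
      have h4 : HasDerivAt (fun s : ℂ => -s/2 * Complex.log π) (-1/2 * Complex.log π) z :=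
        (((hasDerivAt_id z).neg).div_const 2).mul_const _
      rw [← hder _ (hmap z hz)]
      exact (h4.add h3).deriv
    have hev : deriv (fun s => -s/2 * Complex.log π + h (s/2)) =ᶠ[nhds s] fun z => -1/2 * Complex.log π + logDeriv Complex.Gamma (z/2) * (1/2) := by
      filter_upwards [(half_open 0).mem_nhds hs0] with w hw using hd1 w hw
    rw [hev.deriv_eq]
    have hlD : DifferentiableAt ℂ (logDeriv Complex.Gamma) (s/2) := by
      have : DifferentiableOn ℂ (deriv h) {s | 0 < s.re} := hd.deriv (half_open 0)
      have h5 := (this (s/2) (hmap s hs0)).differentiableAt ((half_open 0).mem_nhds (hmap s hs0))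
      refine h5.congr_of_eventuallyEq ?_
      filter_upwards [(half_open 0).mem_nhds (hmap s hs0)] with w hw using (hder w hw).symm
    have h2 : HasDerivAt (fun s : ℂ => s/2) (1/2) s := (hasDerivAt_id s).div_const 2
    have h3 := ((hlD.hasDerivAt.comp s h2).mul_const (1/2 : ℂ)).const_add (-1/2 * Complex.log π)
    rw [show (fun z => -1/2 * Complex.log π + logDeriv Complex.Gamma (z/2) * (1/2)) = (fun z => -1/2 * Complex.log π + (logDeriv Complex.Gamma ∘ fun s => s/2) z * (1/2)) from rfl, h3.deriv]
    have h6 := hb (s/2) (by simp; linarith)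
    have h7 : ‖s/2‖ ≤ ‖s‖ := by rw [norm_div]; simp
    have h8 : Real.log (2 + ‖s/2‖) ≤ Real.log (2 + ‖s‖) := Real.log_le_log (by positivity) (by linarith)
    rw [norm_mul, norm_mul]
    norm_num
    nlinarith



lemma logL_bdd {q : ℕ} [NeZero q] {χ : DirichletCharacter ℂ q} {l : ℂ → ℂ}
    (hs1 : ∀ s : ℂ, 1 < s.re → l s = ∑' pe, lterm χ s pe) :
    ∃ K : ℝ, ∀ s : ℂ, 2 ≤ s.re → ‖l s‖ ≤ K := by
  refine ⟨∑' pe : Nat.Primes × ℕ, (((pe.1 : ℕ) ^ (pe.2 + 1) : ℕ) : ℝ) ^ (-(2:ℝ)), fun s hs => ?_⟩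
  rw [hs1 s (by linarith)]
  exact tsum_of_norm_bounded (summable_primes_pow (by norm_num : (1:ℝ) < 2)).hasSum (fun pe => lterm_norm_le χ s pe hs)

lemma GammaR_ratio {a : ℝ} (ha : 0 < a) (ha4 : a ≤ 1/4) : ∃ C : ℝ, 0 < C ∧ ∀ s : ℂ, 1/2 ≤ s.re →
    ‖Complex.Gammaℝ (s - a)‖ ≤ C * ‖Complex.Gammaℝ (s + a)‖ := by
  obtain ⟨C, hC, h⟩ := Gamma_ratio_small ha
  refine ⟨π ^ a * C, by positivity, fun s hs => ?_⟩
  rw [Complex.Gammaℝ_def, Complex.Gammaℝ_def, norm_mul, norm_mul,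
    Complex.norm_cpow_eq_rpow_re_of_pos Real.pi_pos, Complex.norm_cpow_eq_rpow_re_of_pos Real.pi_pos]
  have h1 := h ((s - a)/2) (by simp; linarith)
  rw [show (s - a)/2 + a = (s + a)/2 by ring] at h1
  have h2 : π ^ (-(s - (a:ℂ)) / 2).re = π ^ a * π ^ (-(s + (a:ℂ)) / 2).re := by
    rw [← Real.rpow_add Real.pi_pos]; congr 1; simp; ring
  rw [h2]
  calc _ ≤ π ^ a * π ^ (-(s + (a:ℂ)) / 2).re * (C * ‖Complex.Gamma ((s + a)/2)‖) := by gcongr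
    _ = _ := by ring

lemma Lambda_mono {q : ℕ} [NeZero q] {χ : DirichletCharacter ℂ q} (hχ : χ ≠ 1) (hp : χ.IsPrimitive)
    (he : χ.Even) (hRH : dirichletRH χ) {a : ℝ} (ha : 0 < a) (ha4 : a ≤ 1/4) {s : ℂ} (hs : 1/2 ≤ s.re) :
    (q:ℝ) ^ (-a) * ‖DirichletCharacter.completedLFunction χ (s - a)‖ ≤ ‖DirichletCharacter.completedLFunction χ (s + a)‖ := by
  have hq : (0:ℝ) < q := by exact_mod_cast NeZero.pos q
  obtain ⟨l, hld, hle, hls⟩ := exists_logL hχ hRH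
  obtain ⟨C1, hC1, hG⟩ := logL_growth hχ hld hle hls ha (by linarith)
  obtain ⟨K, hK⟩ := logL_bdd hls
  obtain ⟨C, hC, hR⟩ := GammaR_ratio ha ha4
  have hne : ∀ z : ℂ, 1/2 < z.re → DirichletCharacter.completedLFunction χ z ≠ 0 := by
    intro z hz
    rw [completed_eq he (by linarith)]
    exact mul_ne_zero (Complex.Gammaℝ_ne_zero_of_re_pos (by linarith)) (L_ne_zero hχ hRH hz)
  set f : ℂ → ℂ := fun z => ((q:ℝ) ^ (-a) : ℝ) * (DirichletCharacter.completedLFunction χ (z + 1/2 - a) /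
    DirichletCharacter.completedLFunction χ (z + 1/2 + a)) with hf
  have hcd := DirichletCharacter.differentiable_completedLFunction hχ
  have hbase : ∀ z : ℂ, 0 ≤ z.re → ‖f z‖ ≤ (q:ℝ) ^ (-a) * (C * (‖DirichletCharacter.LFunction χ (z + 1/2 - a)‖ *
      Real.exp ‖l (z + 1/2 + a)‖)) := by
    intro z hz
    have hr1 : (z + 1/2 + a).re = z.re + 1/2 + a := by simp
    have hr2 : (z + 1/2 - a).re = z.re + 1/2 - a := by simp
    have h1 : 1/2 < (z + 1/2 + a).re := by rw [hr1]; linarith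
    simp only [hf]
    rw [norm_mul, Complex.norm_real, Real.norm_of_nonneg (by positivity), completed_eq he (by linarith),
      completed_eq he (by linarith), ← hle _ h1, norm_div, norm_mul, norm_mul]
    have hg := hR (z + 1/2) (by simp; linarith)
    have hgpos : 0 < ‖Complex.Gammaℝ (z + 1/2 + a)‖ := norm_pos_iff.2 (Complex.Gammaℝ_ne_zero_of_re_pos (by linarith))
    have he' : Real.exp (-‖l (z + 1/2 + a)‖) ≤ ‖Complex.exp (l (z + 1/2 + a))‖ := by
      rw [Complex.norm_exp]; gcongr
      exact (abs_le.1 (Complex.abs_re_le_norm _)).1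
    gcongr
    rw [div_le_iff₀ (mul_pos hgpos (norm_pos_iff.2 (Complex.exp_ne_zero _)))]
    calc ‖Complex.Gammaℝ (z + 1/2 - a)‖ * ‖DirichletCharacter.LFunction χ (z + 1/2 - a)‖
      ≤ (C * ‖Complex.Gammaℝ (z + 1/2 + a)‖) * ‖DirichletCharacter.LFunction χ (z + 1/2 - a)‖ := by gcongr
      _ = C * (‖DirichletCharacter.LFunction χ (z + 1/2 - a)‖ * Real.exp ‖l (z + 1/2 + a)‖) *
        (‖Complex.Gammaℝ (z + 1/2 + a)‖ * Real.exp (-‖l (z + 1/2 + a)‖)) := by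
          rw [Real.exp_neg]; field_simp
      _ ≤ _ := by gcongr
  have hnorm : ∀ z : ℂ, ‖z + 1/2 + a‖ ≤ ‖z‖ + 1 ∧ ‖z + 1/2 - a‖ ≤ ‖z‖ + 1 := by
    intro z
    have h2 : ‖(1/2 : ℂ)‖ = 1/2 := by norm_num
    have h3 : ‖(a:ℂ)‖ = a := by rw [Complex.norm_real, Real.norm_of_nonneg ha.le]
    constructor
    · have := norm_add_le (z + 1/2) (a:ℂ)
      have := norm_add_le z (1/2 : ℂ)
      linarith
    · have := norm_sub_le (z + 1/2) (a:ℂ)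
      have := norm_add_le z (1/2 : ℂ)
      linarith
  have key : ‖f (s - 1/2)‖ ≤ 1 := by
    refine PhragmenLindelof.right_half_plane_of_bounded_on_real (f := f) (C := 1) ?_ ?_ ?_ ?_ (by simpa using hs)
    · apply DifferentiableOn.diffContOnCl
      intro z hz
      have hz' : 0 ≤ z.re := by
        have : closure {z : ℂ | 0 < z.re} ⊆ {z : ℂ | 0 ≤ z.re} := closure_lt_subset_le continuous_const Complex.continuous_re
        exact this hz
      apply DifferentiableAt.differentiableWithinAt
      have h1 := hne (z + 1/2 + a) (by simp; linarith)
      have d1 : DifferentiableAt ℂ (fun z : ℂ => DirichletCharacter.completedLFunction χ (z + 1/2 - a)) z :=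
        hcd.differentiableAt.comp z (by fun_prop)
      have d2 : DifferentiableAt ℂ (fun z : ℂ => DirichletCharacter.completedLFunction χ (z + 1/2 + a)) z :=
        hcd.differentiableAt.comp z (by fun_prop)
      exact (d1.div d2 h1).const_mul _
    · refine ⟨1, by norm_num, C1 + 1, Asymptotics.IsBigO.of_bound ((q:ℝ) ^ (-a) * (C * (32 * q * Real.exp (2 * C1)))) ?_⟩
      rw [Filter.eventually_inf_principal]
      filter_upwards with z hz
      have hz : 0 < z.re := hz
      have hb := hbase z hz.le
      rw [Real.norm_of_nonneg (Real.exp_pos _).le, Real.rpow_one]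
      refine hb.trans ?_
      have h1 := L_growth hχ (s := z + 1/2 - a) (by simp; linarith)
      have h2 := hG (z + 1/2 + a) (by simp; linarith)
      obtain ⟨n1, n2⟩ := hnorm z
      have h3 : ‖z‖ + 1 ≤ Real.exp ‖z‖ := Real.add_one_le_exp _
      rw [mul_assoc _ (C * _), mul_assoc C]
      refine mul_le_mul_of_nonneg_left (mul_le_mul_of_nonneg_left ?_ hC.le) (by positivity)
      calc ‖DirichletCharacter.LFunction χ (z + 1/2 - a)‖ * Real.exp ‖l (z + 1/2 + a)‖
        ≤ (32 * q * Real.exp ‖z‖) * Real.exp (2 * C1 + C1 * ‖z‖) := by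
              refine mul_le_mul ?_ (Real.exp_le_exp.2 ?_) (Real.exp_pos _).le (by positivity)
              · refine h1.trans ?_
                have h5 : ‖z + 1/2 - a‖ ≤ Real.exp ‖z‖ := n2.trans h3
                gcongr
              · refine h2.trans ?_
                nlinarith
        _ = (32 * q * Real.exp (2 * C1)) * Real.exp ((C1 + 1) * ‖z‖) := by
          rw [Real.exp_add, show (C1 + 1) * ‖z‖ = C1 * ‖z‖ + ‖z‖ by ring, Real.exp_add]; ring
    · refine Filter.isBoundedUnder_of_eventually_le (a := (q:ℝ) ^ (-a) * (C * (Real.exp K * Real.exp K))) ?_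
      filter_upwards [Filter.eventually_ge_atTop 2] with x hx
      refine (hbase x (by simp; linarith)).trans ?_
      have hr2 : ((x:ℂ) + 1/2 - a).re = x + 1/2 - a := by simp
      rw [← hle _ (by rw [hr2]; linarith), Complex.norm_exp]
      gcongr
      · exact (Complex.re_le_norm _).trans (hK _ (by rw [hr2]; linarith))
      · exact hK _ (by simp; linarith)
    · intro x
      simp only [hf]
      have hfe := completed_fe_norm hχ hp he x a (by linarith)
      rw [rootNumber_norm hχ hp he hRH, mul_one] at hfe
      rw [norm_mul, Complex.norm_real, Real.norm_of_nonneg (by positivity), norm_div,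
        show (x:ℂ) * I + 1/2 - a = 1/2 - a + x * I by ring, show (x:ℂ) * I + 1/2 + a = 1/2 + a + x * I by ring, hfe]
      have hn : ‖DirichletCharacter.completedLFunction χ (1/2 + a + x * I)‖ ≠ 0 :=
        norm_ne_zero_iff.2 (hne _ (by simp; linarith))
      rw [mul_div_assoc, div_self hn, mul_one, ← Real.rpow_add hq]; simp
  simp only [hf] at key
  rw [norm_mul, Complex.norm_real, Real.norm_of_nonneg (by positivity), norm_div, ← mul_div_assoc, sub_add_cancel,
    div_le_one (norm_pos_iff.2 (hne _ (by simp; linarith)))] at key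
  exact key

/-- the package of facts about `log L` and `log Λ` under RH. -/
lemma exists_logs : ∃ C : ℝ, 0 < C ∧ ∀ (q : ℕ) [NeZero q] (χ : DirichletCharacter ℂ q), χ ≠ 1 → χ.IsPrimitive →
    χ.Even → dirichletRH χ → ∃ l lam : ℂ → ℂ, DifferentiableOn ℂ l {s | 1/2 < s.re} ∧
      (∀ s : ℂ, 1/2 < s.re → Complex.exp (l s) = DirichletCharacter.LFunction χ s) ∧
      (∀ s : ℂ, 1 < s.re → l s = ∑' pe, lterm χ s pe) ∧
      DifferentiableOn ℂ lam {s | 1/2 < s.re} ∧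
      (∀ s : ℂ, 1/2 < s.re → Complex.exp (lam s) = (q:ℂ) ^ (s/2) * DirichletCharacter.completedLFunction χ s) ∧
      (∀ s : ℂ, 1/2 < s.re → 0 ≤ (deriv lam s).re) ∧
      ∀ s : ℂ, 1/2 < s.re → ‖deriv (deriv l) s‖ ≤ ‖deriv (deriv lam) s‖ + C * Real.log (2 + ‖s‖) := by
  obtain ⟨lg, hgd, hge, C, hC, hgC⟩ := exists_logGammaR
  refine ⟨C, hC, ?_⟩
  intro q _ χ hχ hp he hRH
  have hq : (0:ℝ) < q := by exact_mod_cast NeZero.pos q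
  have hq0 : (q:ℂ) ≠ 0 := by exact_mod_cast NeZero.ne q
  obtain ⟨l, hld, hle, hls⟩ := exists_logL hχ hRH
  have hgd' : DifferentiableOn ℂ lg {s | 1/2 < s.re} := hgd.mono (fun s hs => by
    have hs : 1/2 < s.re := hs
    show 0 < s.re
    linarith)
  have hlamd : DifferentiableOn ℂ (fun s => Complex.log q / 2 * s + lg s + l s) {s | 1/2 < s.re} :=
    (DifferentiableOn.add (by fun_prop) hgd').add hld
  have hlame : ∀ s : ℂ, 1/2 < s.re → Complex.exp (Complex.log q / 2 * s + lg s + l s) =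
      (q:ℂ) ^ (s/2) * DirichletCharacter.completedLFunction χ s := by
    intro s hs
    rw [Complex.exp_add, Complex.exp_add, hle s hs, hge s (by linarith), completed_eq he (by linarith),
      Complex.cpow_def_of_ne_zero hq0, mul_assoc]
    congr 2; ring
  refine ⟨l, _, hld, hle, hls, hlamd, hlame, ?_, ?_⟩
  · intro s hs
    obtain ⟨lam, hlam⟩ : ∃ lam : ℂ → ℂ, lam = fun s => Complex.log q / 2 * s + lg s + l s := ⟨_, rfl⟩
    rw [← hlam] at hlamd ⊢
    have hlame' : ∀ s : ℂ, 1/2 < s.re → Complex.exp (lam s) =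
      (q:ℂ) ^ (s/2) * DirichletCharacter.completedLFunction χ s := by rw [hlam]; exact hlame
    have h1 : HasDerivAt lam (deriv lam s) s := ((hlamd s hs).differentiableAt ((half_open _).mem_nhds hs)).hasDerivAt
    have h2 : HasDerivAt (fun x : ℝ => s + x) (1:ℂ) 0 := by
      have := (Complex.ofRealCLM.hasDerivAt (x := 0)).const_add s
      simpa using this
    have h3 : HasDerivAt (fun x : ℝ => lam (s + x)) (deriv lam s) 0 := by
      have := HasDerivAt.scomp (𝕜 := ℝ) (𝕜' := ℂ) (h := fun x : ℝ => s + (x:ℂ)) (h' := 1) (g₁ := lam) (g₁' := deriv lam s) 0 (by simpa using h1) h2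
      simpa [Function.comp_def] using this
    have h4 : HasDerivAt (fun x : ℝ => (lam (s + x)).re) (deriv lam s).re 0 := by
      have := (Complex.reCLM.hasFDerivAt (x := lam (s + (0:ℝ)))).comp_hasDerivAt (0:ℝ) h3
      simpa [Function.comp_def] using this
    have h5 := h4.tendsto_slope_zero_right
    refine ge_of_tendsto h5 ?_
    filter_upwards [Ioo_mem_nhdsGT (show (0:ℝ) < 1/2 by norm_num)] with x hx
    simp only [zero_add, smul_eq_mul, ofReal_zero, add_zero]
    refine mul_nonneg (inv_nonneg.2 hx.1.le) (sub_nonneg.2 ?_)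
    rw [← Real.exp_le_exp, ← Complex.norm_exp, ← Complex.norm_exp, hlame' s hs, hlame' _ (by simp; linarith [hx.1]), norm_mul, norm_mul,
      Complex.norm_natCast_cpow_of_pos (NeZero.pos q), Complex.norm_natCast_cpow_of_pos (NeZero.pos q)]
    have h6 := Lambda_mono hχ hp he hRH (a := x/2) (by linarith [hx.1]) (by linarith [hx.2]) (s := s + (x/2 : ℝ)) (by simp; linarith [hx.1])
    rw [show s + ((x/2:ℝ):ℂ) - ((x/2:ℝ):ℂ) = s by ring, show s + ((x/2:ℝ):ℂ) + ((x/2:ℝ):ℂ) = s + x by push_cast; ring] at h6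
    have h7 : (q:ℝ) ^ (s/2).re = (q:ℝ) ^ ((s + x)/2).re * (q:ℝ) ^ (-(x/2)) := by
      rw [← Real.rpow_add hq]; congr 1; simp; ring
    rw [h7, mul_assoc]
    gcongr
  · intro s hs
    have hlD := hld.deriv (half_open _)
    have hgD := hgd'.deriv (half_open (1/2))
    have hev : deriv (fun s => Complex.log q / 2 * s + lg s + l s) =ᶠ[nhds s] fun z => Complex.log q / 2 + deriv lg z + deriv l z := by
      filter_upwards [(half_open (1/2)).mem_nhds hs] with w hw
      have a1 := ((hld w hw).differentiableAt ((half_open _).mem_nhds hw)).hasDerivAt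
      have a2 := ((hgd' w hw).differentiableAt ((half_open _).mem_nhds hw)).hasDerivAt
      have a3 : HasDerivAt (fun s : ℂ => Complex.log q / 2 * s) (Complex.log q / 2) w := by
        simpa using (hasDerivAt_id w).const_mul (Complex.log q / 2)
      exact ((a3.add a2).add a1).deriv
    rw [hev.deriv_eq]
    have a1 := ((hlD s hs).differentiableAt ((half_open _).mem_nhds hs)).hasDerivAt
    have a2 := ((hgD s hs).differentiableAt ((half_open _).mem_nhds hs)).hasDerivAt
    have a4 : deriv (fun z => Complex.log q / 2 + deriv lg z + deriv l z) s = deriv (deriv lg) s + deriv (deriv l) s :=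
      ((a2.const_add (Complex.log q / 2)).add a1).deriv
    rw [a4]
    have h8 := hgC s hs.le
    have h9 := norm_sub_le (deriv (deriv lg) s + deriv (deriv l) s) (deriv (deriv lg) s)
    rw [add_sub_cancel_left] at h9
    linarith



lemma re_line_hasDerivAt {G : ℂ → ℂ} {U : Set ℂ} (hU : IsOpen U) (hG : DifferentiableOn ℂ G U) (w c : ℂ) (x : ℝ)
    (hx : w + x * c ∈ U) : HasDerivAt (fun x : ℝ => (G (w + x * c)).re) (deriv G (w + x * c) * c).re x := by
  have h1 : HasDerivAt G (deriv G (w + x * c)) (w + x * c) := ((hG _ hx).differentiableAt (hU.mem_nhds hx)).hasDerivAt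
  have h2 : HasDerivAt (fun x : ℝ => w + x * c) c x := by
    have := ((Complex.ofRealCLM.hasDerivAt (x := x)).mul_const c).const_add w
    simpa using this
  have h3 := HasDerivAt.scomp (𝕜 := ℝ) (𝕜' := ℂ) (h := fun x : ℝ => w + (x:ℂ) * c) (h' := c) (g₁ := G) (g₁' := deriv G (w + x * c)) x h1 h2
  have h4 := (Complex.reCLM.hasFDerivAt (x := G (w + x * c))).comp_hasDerivAt x h3
  simpa [Function.comp_def, mul_comm] using h4


lemma harn_deriv {lam : ℂ → ℂ} (hlam : DifferentiableOn ℂ lam {s | 1/2 < s.re})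
    (hpos : ∀ s : ℂ, 1/2 < s.re → 0 ≤ (deriv lam s).re) (s : ℂ) (hs : 1/2 < s.re) :
    ‖deriv (deriv lam) s‖ ≤ 4 * (deriv lam s).re / (s.re - 1/2) := by
  have hsub : ∀ z ∈ Metric.ball s (s.re - 1/2), 1/2 < z.re := by
    intro z hz
    have h1 : |(z - s).re| < s.re - 1/2 := (Complex.abs_re_le_norm _).trans_lt (by simpa [dist_eq_norm] using hz)
    have h2 := (abs_lt.1 h1).1
    simp at h2
    linarith
  exact deriv_bound_re_nonneg (by linarith) ((hlam.deriv (half_open _)).mono hsub) (fun z hz => hpos z (hsub z hz))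

lemma harn_vert {lam : ℂ → ℂ} (hlam : DifferentiableOn ℂ lam {s | 1/2 < s.re})
    (hpos : ∀ s : ℂ, 1/2 < s.re → 0 ≤ (deriv lam s).re) (t : ℝ) {τ d : ℝ} (hτ : 0 < τ) (hd : τ ≤ d) :
    (deriv lam (1/2 + t * I + d * 1)).re / d ^ 4 ≤ (deriv lam (1/2 + t * I + τ * 1)).re / τ ^ 4 ∧
    (deriv lam (1/2 + t * I + τ * 1)).re * τ ^ 4 ≤ (deriv lam (1/2 + t * I + d * 1)).re * d ^ 4 := by
  have hF := hlam.deriv (half_open (1/2))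
  have hmem : ∀ x : ℝ, 0 < x → 1/2 < ((1/2 + t * I + x * 1 : ℂ)).re := by
    intro x hx; simp; linarith
  have hder : ∀ x : ℝ, 0 < x → HasDerivAt (fun x : ℝ => (deriv lam (1/2 + t * I + x * 1)).re)
      (deriv (deriv lam) (1/2 + t * I + x * 1) * 1).re x := fun x hx =>
    re_line_hasDerivAt (half_open (1/2)) hF _ 1 x (hmem x hx)
  have hb : ∀ x : ℝ, 0 < x → |(deriv (deriv lam) (1/2 + t * I + x * 1) * 1).re| ≤ 4 * (deriv lam (1/2 + t * I + x * 1)).re / x := by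
    intro x hx
    have := harn_deriv hlam hpos _ (hmem x hx)
    have e : ((1/2 + t * I + x * 1 : ℂ)).re - 1/2 = x := by simp
    rw [e] at this
    rw [mul_one]
    exact (Complex.abs_re_le_norm _).trans this
  constructor
  · have : AntitoneOn (fun x : ℝ => (deriv lam (1/2 + t * I + x * 1)).re / x ^ 4) (Set.Ioi 0) := by
      have hd' : ∀ x : ℝ, 0 < x → HasDerivAt (fun x : ℝ => (deriv lam (1/2 + t * I + x * 1)).re / x ^ 4) _ x :=
        fun x hx => (hder x hx).div (hasDerivAt_pow 4 x) (by positivity)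
      refine antitoneOn_of_deriv_nonpos (convex_Ioi 0) (fun x hx => (hd' x hx).continuousAt.continuousWithinAt) ?_ ?_
      · rw [interior_Ioi]; exact fun x hx => (hd' x hx).differentiableAt.differentiableWithinAt
      · rw [interior_Ioi]; intro x hx
        have hx : 0 < x := hx
        rw [(hd' x hx).deriv]
        apply div_nonpos_of_nonpos_of_nonneg _ (by positivity)
        have h1 := (abs_le.1 (hb x hx)).2
        rw [le_div_iff₀ hx] at h1
        have h2 : 0 < x ^ 3 := by positivity
        have := mul_le_mul_of_nonneg_right h1 h2.le
        norm_num at this ⊢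
        nlinarith
    exact this hτ (hτ.trans_le hd) hd
  · have : MonotoneOn (fun x : ℝ => (deriv lam (1/2 + t * I + x * 1)).re * x ^ 4) (Set.Ioi 0) := by
      have hd' : ∀ x : ℝ, 0 < x → HasDerivAt (fun x : ℝ => (deriv lam (1/2 + t * I + x * 1)).re * x ^ 4) _ x :=
        fun x hx => (hder x hx).mul (hasDerivAt_pow 4 x)
      refine monotoneOn_of_deriv_nonneg (convex_Ioi 0) (fun x hx => (hd' x hx).continuousAt.continuousWithinAt) ?_ ?_
      · rw [interior_Ioi]; exact fun x hx => (hd' x hx).differentiableAt.differentiableWithinAt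
      · rw [interior_Ioi]; intro x hx
        have hx : 0 < x := hx
        rw [(hd' x hx).deriv]
        have h1 := (abs_le.1 (hb x hx)).1
        rw [neg_le, le_div_iff₀ hx] at h1
        have h2 : 0 < x ^ 3 := by positivity
        have := mul_le_mul_of_nonneg_right h1 h2.le
        norm_num at this ⊢
        nlinarith
    exact this hτ (hτ.trans_le hd) hd

lemma harn_horiz {lam : ℂ → ℂ} (hlam : DifferentiableOn ℂ lam {s | 1/2 < s.re})
    (hpos : ∀ s : ℂ, 1/2 < s.re → 0 ≤ (deriv lam s).re) (s : ℂ) (hs : 1/2 < s.re) {c : ℂ} (hc : c.re = 0) (hc1 : ‖c‖ = 1)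
    {v : ℝ} (hv : 0 ≤ v) :
    (deriv lam (s + v * c)).re ≤ Real.exp (4 * v / (s.re - 1/2)) * (deriv lam s).re := by
  have hF := hlam.deriv (half_open (1/2))
  have hre : ∀ x : ℝ, (s + x * c).re = s.re := by intro x; simp [hc]
  have hmem : ∀ x : ℝ, 1/2 < (s + x * c).re := by
    intro x; rw [hre]; exact hs
  have hder := fun x : ℝ => re_line_hasDerivAt (half_open (1/2)) hF s c x (hmem x)
  set d := s.re - 1/2 with hd
  have hd0 : 0 < d := by linarith
  have hanti : Antitone (fun x : ℝ => (deriv lam (s + x * c)).re * Real.exp (-(4 * x / d))) := by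
    have hd' : ∀ x : ℝ, HasDerivAt (fun x : ℝ => (deriv lam (s + x * c)).re * Real.exp (-(4 * x / d))) _ x :=
      fun x => (hder x).mul (((((hasDerivAt_id x).const_mul 4).div_const d).neg).exp)
    refine antitone_of_deriv_nonpos (fun x => (hd' x).differentiableAt) ?_
    intro x
    rw [(hd' x).deriv]
    have h1 := harn_deriv hlam hpos _ (hmem x)
    rw [hre] at h1
    have h2 : (deriv (deriv lam) (s + x * c) * c).re ≤ 4 * (deriv lam (s + x * c)).re / d := by
      refine (Complex.re_le_norm _).trans ?_
      rw [norm_mul, hc1, mul_one]; exact h1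
    have h3 := Real.exp_pos (-(4 * x / d))
    have := mul_le_mul_of_nonneg_right h2 h3.le
    simp only [id, mul_one, Pi.neg_apply]
    have e : (deriv lam (s + x * c)).re * (Real.exp (-(4 * x / d)) * -(4 / d)) = - (4 * (deriv lam (s + x * c)).re / d * Real.exp (-(4 * x / d))) := by ring
    rw [e]; linarith
  have := hanti hv
  simp only [ofReal_zero, zero_mul, add_zero, mul_zero, zero_div, neg_zero, Real.exp_zero, mul_one] at this
  rw [Real.exp_neg] at this
  rw [← div_eq_mul_inv, div_le_iff₀ (Real.exp_pos _)] at this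
  linarith

lemma harn_all {lam : ℂ → ℂ} (hlam : DifferentiableOn ℂ lam {s | 1/2 < s.re})
    (hpos : ∀ s : ℂ, 1/2 < s.re → 0 ≤ (deriv lam s).re) (t v : ℝ) {d : ℝ} (hd : 0 < d) :
    (deriv lam (1/2 + d + (t + v : ℝ) * I)).re ≤ Real.exp 4 * (1 + |v| / d) ^ 8 * (deriv lam (1/2 + d + t * I)).re := by
  set D := d + |v| with hD
  have hdD : d ≤ D := by have := abs_nonneg v; linarith
  have hD0 : 0 < D := by linarith
  have h1 := (harn_vert hlam hpos (t + v) hd hdD).2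
  have h2 := (harn_vert hlam hpos t hd hdD).1
  have h3 : (deriv lam (1/2 + (t + v : ℝ) * I + D * 1)).re ≤ Real.exp 4 * (deriv lam (1/2 + t * I + D * 1)).re := by
    have hs : 1/2 < (1/2 + t * I + D * 1 : ℂ).re := by simpa using hD0
    have e0 : (1/2 + t * I + D * 1 : ℂ).re - 1/2 = D := by simp
    have hle : Real.exp (4 * |v| / D) ≤ Real.exp 4 := by
      rw [Real.exp_le_exp, div_le_iff₀ hD0]; linarith
    have hg := hpos _ hs
    rcases le_total 0 v with hv | hv
    · have := harn_horiz hlam hpos (1/2 + t * I + D * 1) hs (c := I) (by simp) (by simp) (v := v) hv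
      rw [e0] at this
      rw [abs_of_nonneg hv] at hle
      rw [show (1/2 + (t + v : ℝ) * I + D * 1 : ℂ) = 1/2 + t * I + D * 1 + v * I by push_cast; ring]
      exact this.trans (by gcongr)
    · have := harn_horiz hlam hpos (1/2 + t * I + D * 1) hs (c := -I) (by simp) (by simp) (v := -v) (by linarith)
      rw [e0] at this
      rw [abs_of_nonpos hv] at hle
      rw [show (1/2 + (t + v : ℝ) * I + D * 1 : ℂ) = 1/2 + t * I + D * 1 + (-v : ℝ) * -I by push_cast; ring]
      exact this.trans (by gcongr)
  have e1 : (1/2 + d + (t + v : ℝ) * I : ℂ) = 1/2 + (t + v : ℝ) * I + d * 1 := by ring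
  have e2 : (1/2 + d + t * I : ℂ) = 1/2 + t * I + d * 1 := by ring
  rw [e1, e2]
  have e3 : 1 + |v| / d = D / d := by rw [hD]; field_simp
  rw [e3]
  push_cast at *
  obtain ⟨a, ha⟩ : ∃ a, a = (deriv lam (1/2 + (t + v) * I + d * 1)).re := ⟨_, rfl⟩
  obtain ⟨b, hb⟩ : ∃ b, b = (deriv lam (1/2 + (t + v) * I + D * 1)).re := ⟨_, rfl⟩
  obtain ⟨c, hc⟩ : ∃ c, c = (deriv lam (1/2 + t * I + D * 1)).re := ⟨_, rfl⟩
  obtain ⟨e, hee⟩ : ∃ e, e = (deriv lam (1/2 + t * I + d * 1)).re := ⟨_, rfl⟩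
  rw [← ha, ← hb] at h1; rw [← hc, ← hee] at h2; rw [← hb, ← hc] at h3; rw [← ha, ← hee]
  rw [div_le_div_iff₀ (by positivity) (by positivity)] at h2
  have hd4 : 0 < d ^ 4 := by positivity
  have hD4 : 0 < D ^ 4 := by positivity
  have hE := Real.exp_pos 4
  have h5 : a * d ^ 8 ≤ Real.exp 4 * D ^ 8 * e := by
    have i1 : a * d ^ 4 * d ^ 4 ≤ b * D ^ 4 * d ^ 4 := by gcongr
    have i2 : b * D ^ 4 * d ^ 4 ≤ Real.exp 4 * c * D ^ 4 * d ^ 4 := by gcongr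
    have i3 : (c * d ^ 4) * (Real.exp 4 * D ^ 4) ≤ (e * D ^ 4) * (Real.exp 4 * D ^ 4) := by gcongr
    calc a * d ^ 8 = a * d ^ 4 * d ^ 4 := by ring
      _ ≤ Real.exp 4 * c * D ^ 4 * d ^ 4 := i1.trans i2
      _ = (c * d ^ 4) * (Real.exp 4 * D ^ 4) := by ring
      _ ≤ _ := i3
      _ = _ := by ring
  rw [div_pow]
  calc a = a * d ^ 8 / d ^ 8 := by field_simp
    _ ≤ Real.exp 4 * D ^ 8 * e / d ^ 8 := by gcongr
    _ = _ := by ring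

lemma harn_gain {lam Lam : ℂ → ℂ} (hlam : DifferentiableOn ℂ lam {s | 1/2 < s.re})
    (hpos : ∀ s : ℂ, 1/2 < s.re → 0 ≤ (deriv lam s).re)
    (hL : ∀ s : ℂ, 1/2 < s.re → Complex.exp (lam s) = Lam s) (hLc : Continuous Lam) (t : ℝ) {d : ℝ} (hd : 0 < d) :
    ‖Lam (1/2 + t * I)‖ ≤ ‖Lam (1/2 + d + t * I)‖ * Real.exp (-((deriv lam (1/2 + d + t * I)).re * d / 5)) := by
  have hmem : ∀ x : ℝ, 0 < x → 1/2 < ((1/2 + t * I + x * 1 : ℂ)).re := by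
    intro x hx; simp; linarith
  have hder := fun (x : ℝ) (hx : 0 < x) => re_line_hasDerivAt (half_open (1/2)) hlam (1/2 + t * I) 1 x (hmem x hx)
  set G := (deriv lam (1/2 + d + t * I)).re with hG
  have hmono : MonotoneOn (fun x : ℝ => (lam (1/2 + t * I + x * 1)).re - G / d ^ 4 * (x ^ 5 / 5)) (Set.Ioc 0 d) := by
    have hd' : ∀ x : ℝ, 0 < x → HasDerivAt (fun x : ℝ => (lam (1/2 + t * I + x * 1)).re - G / d ^ 4 * (x ^ 5 / 5)) _ x :=
      fun x hx => (hder x hx).sub (((hasDerivAt_pow 5 x).div_const 5).const_mul (G / d ^ 4))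
    refine monotoneOn_of_deriv_nonneg (convex_Ioc 0 d) (fun x hx => (hd' x hx.1).continuousAt.continuousWithinAt) ?_ ?_
    · rw [interior_Ioc]; exact fun x hx => (hd' x hx.1).differentiableAt.differentiableWithinAt
    · rw [interior_Ioc]; intro x hx
      rw [(hd' x hx.1).deriv, mul_one]
      have h1 := (harn_vert hlam hpos t hx.1 hx.2.le).1
      rw [show (1/2 + t * I + d * 1 : ℂ) = 1/2 + d + t * I by ring, ← hG, le_div_iff₀ (by have := hx.1; positivity)] at h1
      norm_num
      simpa using h1
  have hle : ∀ x ∈ Set.Ioc 0 d, ‖Lam (1/2 + t * I + x * 1)‖ ≤ ‖Lam (1/2 + d + t * I)‖ * Real.exp (-(G * d / 5) + G / d ^ 4 * (x ^ 5 / 5)) := by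
    intro x hx
    have h1 := hmono hx ⟨hd, le_rfl⟩ hx.2
    simp only at h1
    rw [← hL _ (hmem x hx.1), ← hL _ (by simp; linarith), Complex.norm_exp, Complex.norm_exp, ← Real.exp_add, Real.exp_le_exp]
    rw [show (1/2 + t * I + d * 1 : ℂ) = 1/2 + d + t * I by ring] at h1
    have e : G / d ^ 4 * (d ^ 5 / 5) = G * d / 5 := by field_simp
    rw [e] at h1
    linarith
  have t1 : Filter.Tendsto (fun x : ℝ => ‖Lam (1/2 + t * I + x * 1)‖) (nhdsWithin 0 (Set.Ioi 0)) (nhds ‖Lam (1/2 + t * I + (0:ℝ) * 1)‖) := by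
    apply Filter.Tendsto.mono_left _ nhdsWithin_le_nhds
    exact (Continuous.tendsto (by fun_prop) 0)
  have t2 : Filter.Tendsto (fun x : ℝ => ‖Lam (1/2 + d + t * I)‖ * Real.exp (-(G * d / 5) + G / d ^ 4 * (x ^ 5 / 5)))
      (nhdsWithin 0 (Set.Ioi 0)) (nhds (‖Lam (1/2 + d + t * I)‖ * Real.exp (-(G * d / 5) + G / d ^ 4 * ((0:ℝ) ^ 5 / 5)))) := by
    apply Filter.Tendsto.mono_left _ nhdsWithin_le_nhds
    exact (Continuous.tendsto (by fun_prop) 0)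
  have := le_of_tendsto_of_tendsto t1 t2 (by filter_upwards [Ioc_mem_nhdsGT hd] with x hx using hle x hx)
  simpa using this


open FourierTransform MeasureTheory in
lemma exists_kernel : ∃ (W : ℝ → ℝ) (K : ℝ → ℂ), (∀ y, 0 ≤ W y ∧ W y ≤ 1) ∧ W 0 = 1 ∧
    (∀ y, 1 ≤ |y| → W y = 0) ∧ (∀ v, K (-v) = K v) ∧ Continuous K ∧
    (∀ n : ℕ, Integrable (fun v : ℝ => (1 + |v|) ^ n * ‖K v‖)) ∧
    ∀ y : ℝ, ∫ v : ℝ, Complex.exp (-2 * π * v * y * I) * K v = W y := by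
  let b : ContDiffBump (0:ℝ) := ⟨1/2, 1, by norm_num, by norm_num⟩
  have hcs : HasCompactSupport (fun x : ℝ => ((b x : ℝ) : ℂ)) := b.hasCompactSupport.comp_left (g := fun x : ℝ => (x:ℂ)) (by simp)
  have hcd : ContDiff ℝ (⊤ : ℕ∞) (fun x : ℝ => ((b x : ℝ) : ℂ)) := Complex.ofRealCLM.contDiff.comp b.contDiff
  set f : SchwartzMap ℝ ℂ := hcs.toSchwartzMap hcd with hf
  have hfx : ∀ x, f x = ((b x : ℝ) : ℂ) := fun x => rfl
  set k : SchwartzMap ℝ ℂ := 𝓕⁻ f with hk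
  refine ⟨b, k, fun y => ⟨b.nonneg, b.le_one⟩, b.one_of_mem_closedBall (by simp [b]), ?_, ?_, k.continuous, ?_, ?_⟩
  · intro y hy
    exact b.zero_of_le_dist (by simpa [b] using hy)
  · intro v
    rw [hk, SchwartzMap.fourierInv_coe, Real.fourierInv_eq', Real.fourierInv_eq']
    rw [← integral_neg_eq_self]
    congr 1; ext y
    simp [hfx, b.neg]
  · intro n
    have h1 : ∀ v : ℝ, (1 + |v|) ^ n * ‖k v‖ = ∑ i ∈ range (n+1), (n.choose i : ℝ) * (‖v‖ ^ (n - i) * ‖k v‖) := by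
      intro v
      rw [add_pow, Finset.sum_mul]
      refine Finset.sum_congr rfl fun i _ => ?_
      rw [Real.norm_eq_abs]; ring
    simp_rw [h1]
    exact integrable_finsetSum _ (fun i _ => (k.integrable_pow_mul volume _).const_mul _)
  · intro y
    have h : 𝓕 k = f := FourierTransform.fourier_fourierInv_eq f
    have h2 : (𝓕 k) y = f y := by rw [h]
    rw [SchwartzMap.fourier_coe, Real.fourier_real_eq_integral_exp_smul, hfx] at h2
    rw [← h2]
    congr 1; ext v
    rw [smul_eq_mul]; congr 2; push_cast; ring

open MeasureTheory in
lemma integral_holo {l : ℂ → ℂ} (hd : DifferentiableOn ℂ l {s | 1/2 < s.re})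
    (hg : ∀ δ : ℝ, 0 < δ → δ ≤ 1 → ∃ C : ℝ, 0 < C ∧ ∀ s : ℂ, 1/2 + δ ≤ s.re → ‖l s‖ ≤ C * (1 + ‖s‖))
    {K : ℝ → ℂ} (hKc : Continuous K) (hKi : ∀ n : ℕ, Integrable (fun v : ℝ => (1 + |v|) ^ n * ‖K v‖))
    (c : ℝ) : (∀ s : ℂ, 1/2 < s.re → Integrable (fun v : ℝ => l (s + v * c * I) * K v)) ∧
      DifferentiableOn ℂ (fun s => ∫ v : ℝ, l (s + v * c * I) * K v) {s | 1/2 < s.re} := by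
  have hcont : ∀ s : ℂ, 1/2 < s.re → Continuous (fun v : ℝ => l (s + v * c * I)) := by
    intro s hs
    refine hd.continuousOn.comp_continuous (by fun_prop) (fun v => ?_)
    show 1/2 < (s + v * c * I).re
    simpa using hs
  have hIntg : ∀ s : ℂ, 1/2 < s.re → Integrable (fun v : ℝ => l (s + v * c * I) * K v) := by
    intro s hs
    obtain ⟨C, hC, h⟩ := hg (min (s.re - 1/2) 1) (by simp; linarith) (by simp)
    refine ((hKi 1).const_mul (C * (1 + ‖s‖ + |c|))).mono' ((hcont s hs).mul hKc).aestronglyMeasurable ?_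
    filter_upwards with v
    rw [norm_mul, ← mul_assoc]
    gcongr
    refine (h _ ?_).trans ?_
    · have e : (s + v * c * I).re = s.re := by simp
      rw [e]; linarith [min_le_left (s.re - 1/2) 1]
    · have : ‖s + v * c * I‖ ≤ ‖s‖ + |v| * |c| := by
        refine (norm_add_le _ _).trans ?_
        simp
      rw [mul_assoc C, pow_one]
      refine mul_le_mul_of_nonneg_left ?_ hC.le
      nlinarith [abs_nonneg v, abs_nonneg c, norm_nonneg s]
  refine ⟨hIntg, fun s hs => DifferentiableAt.differentiableWithinAt ?_⟩
  have hs : 1/2 < s.re := hs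
  obtain ⟨δ, hδ0, hδ1, hδ2⟩ : ∃ δ : ℝ, 0 < δ ∧ δ ≤ 1 ∧ 3 * δ ≤ s.re - 1/2 :=
    ⟨min ((s.re - 1/2)/3) 1, by simp; linarith, by simp, by linarith [min_le_left ((s.re - 1/2)/3) 1]⟩
  obtain ⟨C, hC, h⟩ := hg δ hδ0 hδ1
  have hball : ∀ z ∈ Metric.ball s δ, 1/2 + 2 * δ ≤ z.re ∧ ‖z‖ ≤ ‖s‖ + 1 := by
    intro z hz
    have hz' : ‖z - s‖ < δ := by simpa [dist_eq_norm] using hz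
    have h1 : |(z - s).re| < δ := (Complex.abs_re_le_norm _).trans_lt hz'
    have h2 := (abs_lt.1 h1).1
    simp at h2
    refine ⟨by linarith, ?_⟩
    have := norm_add_le (z - s) s
    rw [sub_add_cancel] at this
    linarith
  have hder : ∀ z : ℂ, 1/2 + 2 * δ ≤ z.re → ‖deriv l z‖ ≤ C * (2 + ‖z‖) / δ := by
    intro z hz
    refine Complex.norm_deriv_le_of_forall_mem_sphere_norm_le hδ0 ?_ ?_
    · refine DifferentiableOn.diffContOnCl (hd.mono ?_)
      refine (Metric.closure_ball_subset_closedBall).trans ?_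
      intro w hw
      have hw' : ‖w - z‖ ≤ δ := by simpa [dist_eq_norm] using hw
      have h1 : |(w - z).re| ≤ δ := (Complex.abs_re_le_norm _).trans hw'
      have h2 := (abs_le.1 h1).1
      simp at h2
      show 1/2 < w.re
      linarith
    · intro w hw
      have hw' : ‖w - z‖ ≤ δ := by
        have : ‖w - z‖ = δ := by simpa [dist_eq_norm] using hw
        exact this.le
      have h1 : |(w - z).re| ≤ δ := (Complex.abs_re_le_norm _).trans hw'
      have h2 := (abs_le.1 h1).1
      simp at h2
      refine (h w (by linarith)).trans ?_
      have := norm_add_le (w - z) z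
      rw [sub_add_cancel] at this
      exact mul_le_mul_of_nonneg_left (by linarith) hC.le
  have main := hasDerivAt_integral_of_dominated_loc_of_deriv_le (𝕜 := ℂ) (μ := volume) (x₀ := s) (s := Metric.ball s δ)
    (F := fun s (v:ℝ) => l (s + v * c * I) * K v) (F' := fun s (v:ℝ) => deriv l (s + v * c * I) * K v)
    (bound := fun v => (C / δ * (3 + ‖s‖ + |c|)) * ((1 + |v|) ^ 1 * ‖K v‖)) (Metric.ball_mem_nhds s hδ0) ?_ (hIntg s hs) ?_ ?_ ?_ ?_
  · exact main.2.differentiableAt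
  · filter_upwards [Metric.ball_mem_nhds s hδ0] with z hz
    exact (hIntg z (by linarith [(hball z hz).1])).aestronglyMeasurable
  · have : Continuous (fun v : ℝ => deriv l (s + v * c * I)) := by
      refine (hd.deriv (half_open _)).continuousOn.comp_continuous (by fun_prop) (fun v => ?_)
      show 1/2 < (s + v * c * I).re
      simpa using hs
    exact (this.mul hKc).aestronglyMeasurable
  · filter_upwards with v z hz
    obtain ⟨h1, h2⟩ := hball z hz
    rw [norm_mul, ← mul_assoc]
    gcongr
    refine (hder _ (by simpa using h1)).trans ?_
    have : ‖z + v * c * I‖ ≤ ‖z‖ + |v| * |c| := by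
      refine (norm_add_le _ _).trans ?_
      simp
    rw [mul_div_right_comm, mul_assoc (C / δ), pow_one]
    refine mul_le_mul_of_nonneg_left (a := C / δ) ?_ (by positivity)
    nlinarith [abs_nonneg v, abs_nonneg c, norm_nonneg s]
  · exact (hKi 1).const_mul _
  · filter_upwards with v z hz
    obtain ⟨h1, h2⟩ := hball z hz
    have hz2 : 1/2 < (z + v * c * I).re := by simp; linarith
    have d1 : HasDerivAt l (deriv l (z + v * c * I)) (z + v * c * I) :=
      ((hd _ hz2).differentiableAt ((half_open _).mem_nhds hz2)).hasDerivAt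
    have d2 := d1.comp z ((hasDerivAt_id z).add_const (v * c * I))
    simpa [Function.comp_def] using d2.mul_const (K v)


lemma lterm_shift {q : ℕ} (χ : DirichletCharacter ℂ q) (s : ℂ) (u : ℝ) (pe : Nat.Primes × ℕ) :
    lterm χ (s + u * I) pe = lterm χ s pe * Complex.exp (-(u * ((pe.2 + 1 : ℕ) * Real.log (pe.1 : ℕ) : ℝ)) * I) := by
  have hp : ((pe.1 : ℕ) : ℂ) ≠ 0 := by exact_mod_cast pe.1.2.ne_zero
  unfold lterm
  rw [neg_add, Complex.cpow_add _ _ hp, ← mul_assoc, mul_pow, mul_div_right_comm]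
  congr 1
  rw [Complex.cpow_def_of_ne_zero hp, ← Complex.exp_nat_mul, ← Complex.natCast_log]
  congr 1; push_cast; ring

open MeasureTheory in
lemma smoothing {q : ℕ} [NeZero q] {χ : DirichletCharacter ℂ q} {l : ℂ → ℂ} (hd : DifferentiableOn ℂ l {s | 1/2 < s.re})
    (hg : ∀ δ : ℝ, 0 < δ → δ ≤ 1 → ∃ C : ℝ, 0 < C ∧ ∀ s : ℂ, 1/2 + δ ≤ s.re → ‖l s‖ ≤ C * (1 + ‖s‖))
    (hs1 : ∀ s : ℂ, 1 < s.re → l s = ∑' pe, lterm χ s pe)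
    {W : ℝ → ℝ} {K : ℝ → ℂ} (hW0 : ∀ y, 1 ≤ |y| → W y = 0)
    (hKc : Continuous K) (hKi : ∀ n : ℕ, Integrable (fun v : ℝ => (1 + |v|) ^ n * ‖K v‖))
    (hKW : ∀ y : ℝ, ∫ v : ℝ, Complex.exp (-2 * π * v * y * I) * K v = W y) {X : ℝ} (hX : 0 < X)
    (S : Finset (Nat.Primes × ℕ)) (hS : ∀ pe : Nat.Primes × ℕ, ((pe.1:ℕ):ℝ) ^ (pe.2 + 1) < Real.exp X → pe ∈ S) {s : ℂ}
    (hs : 1/2 < s.re) :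
    ∫ v : ℝ, l (s + v * (2 * π / X : ℝ) * I) * K v =
      ∑ pe ∈ S, lterm χ s pe * W ((pe.2 + 1 : ℕ) * Real.log (pe.1 : ℕ) / X) := by
  obtain ⟨hi, hdiff⟩ := integral_holo hd hg hKc hKi (2 * π / X)
  have hdS : DifferentiableOn ℂ (fun s => ∑ pe ∈ S, lterm χ s pe * W ((pe.2 + 1 : ℕ) * Real.log (pe.1 : ℕ) / X)) {s | 1/2 < s.re} := by
    apply Differentiable.differentiableOn
    exact Differentiable.fun_sum (fun pe _ => (lterm_differentiable χ pe).mul_const _)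
  have hKint : Integrable K := by
    have := hKi 0
    simp only [pow_zero, one_mul] at this
    exact (integrable_norm_iff hKc.aestronglyMeasurable).1 this
  have key : ∀ s : ℂ, 1 < s.re → ∫ v : ℝ, l (s + v * (2 * π / X : ℝ) * I) * K v =
      ∑ pe ∈ S, lterm χ s pe * W ((pe.2 + 1 : ℕ) * Real.log (pe.1 : ℕ) / X) := by
    intro s hs
    have e1 : ∀ v : ℝ, l (s + v * (2 * π / X : ℝ) * I) * K v = ∑' pe, lterm χ (s + (v * (2 * π / X) : ℝ) * I) pe * K v := by
      intro v
      rw [tsum_mul_right, hs1 _ (by simpa using hs)]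
      push_cast; rfl
    simp_rw [e1]
    have hnorm : ∀ (pe : Nat.Primes × ℕ) (v : ℝ), ‖lterm χ (s + (v * (2 * π / X) : ℝ) * I) pe * K v‖ = ‖lterm χ s pe‖ * ‖K v‖ := by
      intro pe v
      rw [lterm_shift, norm_mul, norm_mul, ← Complex.ofReal_mul, ← Complex.ofReal_neg, Complex.norm_exp_ofReal_mul_I, mul_one]
    have hcont : ∀ pe, Continuous (fun v : ℝ => lterm χ (s + (v * (2 * π / X) : ℝ) * I) pe * K v) := by
      intro pe
      refine Continuous.mul ((lterm_differentiable χ pe).continuous.comp (by fun_prop)) hKc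
    rw [← integral_tsum_of_summable_integral_norm]
    · have e2 : ∀ pe, ∫ v : ℝ, lterm χ (s + (v * (2 * π / X) : ℝ) * I) pe * K v =
          lterm χ s pe * W ((pe.2 + 1 : ℕ) * Real.log (pe.1 : ℕ) / X) := by
        intro pe
        rw [← hKW, ← integral_const_mul]
        congr 1; ext v
        rw [lterm_shift, mul_assoc]
        congr 3
        push_cast; field_simp
      simp_rw [e2]
      refine tsum_eq_sum fun pe hpe => ?_
      rw [hW0, ofReal_zero, mul_zero]
      have h1 : Real.exp X ≤ ((pe.1:ℕ):ℝ) ^ (pe.2 + 1) := by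
        by_contra hcon
        exact hpe (hS pe (not_le.1 hcon))
      have h2 := Real.log_le_log (Real.exp_pos X) h1
      rw [Real.log_exp, Real.log_pow] at h2
      refine le_trans ?_ (le_abs_self _)
      rw [le_div_iff₀ hX]; simpa using h2
    · intro pe
      refine Integrable.mono' (hKint.norm.const_mul ‖lterm χ s pe‖) (hcont pe).aestronglyMeasurable ?_
      filter_upwards with v using (hnorm pe v).le
    · simp_rw [hnorm, integral_const_mul]
      exact ((lterm_summable χ hs).norm).mul_right _
  have := AnalyticOnNhd.eqOn_of_preconnected_of_eventuallyEq (hdiff.analyticOnNhd (half_open _)) (hdS.analyticOnNhd (half_open _))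
    (convex_halfSpace_re_gt (1/2)).isPreconnected (z₀ := 2) (by show 1/2 < (2:ℂ).re; norm_num)
    (by filter_upwards [(half_open 1).mem_nhds (show (2:ℂ) ∈ {z : ℂ | 1 < z.re} by simp)] with z hz using key z hz)
  exact this hs

/-- second difference bound -/
lemma second_diff {l : ℂ → ℂ} (hd : DifferentiableOn ℂ l {s | 1/2 < s.re}) {s : ℂ} (hs : 1/2 < s.re) (u M : ℝ)
    (hM : ∀ y : ℝ, |y| ≤ |u| → ‖deriv (deriv l) (s + y * I)‖ ≤ M) :
    ‖l (s + u * I) + l (s - u * I) - 2 * l s‖ ≤ 2 * u ^ 2 * M := by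
  have hM0 : 0 ≤ M := (norm_nonneg _).trans (hM 0 (by simp))
  have hmem : ∀ y : ℝ, 1/2 < (s + y * I).re := by intro y; simpa using hs
  have hF := hd.deriv (half_open (1/2))
  have hline : ∀ (G : ℂ → ℂ), DifferentiableOn ℂ G {s | 1/2 < s.re} → ∀ y : ℝ,
      HasDerivAt (fun y : ℝ => G (s + y * I)) (I * deriv G (s + y * I)) y := by
    intro G hG y
    have h1 : HasDerivAt G (deriv G (s + y * I)) (s + y * I) := ((hG _ (hmem y)).differentiableAt ((half_open _).mem_nhds (hmem y))).hasDerivAt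
    have h2 : HasDerivAt (fun x : ℝ => s + x * I) I y := by
      have := ((Complex.ofRealCLM.hasDerivAt (x := y)).mul_const I).const_add s
      simpa using this
    have h3 := HasDerivAt.scomp (𝕜 := ℝ) (𝕜' := ℂ) (h := fun x : ℝ => s + (x:ℂ) * I) (h' := I) (g₁ := G) (g₁' := deriv G (s + y * I)) y h1 h2
    simpa [Function.comp_def] using h3
  -- difference of derivatives
  have hd1 : ∀ y : ℝ, |y| ≤ |u| → ‖deriv l (s + y * I) - deriv l (s - y * I)‖ ≤ 2 * |u| * M := by
    intro y hy
    have := (convex_uIcc (-|u|) |u|).norm_image_sub_le_of_norm_hasDerivWithin_le (f := fun y : ℝ => deriv l (s + y * I))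
      (f' := fun y => I * deriv (deriv l) (s + y * I)) (C := M) (x := -y) (y := y)
      (fun x hx => (hline _ hF x).hasDerivWithinAt) ?_ ?_ ?_
    · rw [ofReal_neg, neg_mul, ← sub_eq_add_neg] at this
      refine this.trans ?_
      have : ‖y - -y‖ ≤ 2 * |u| := by
        rw [Real.norm_eq_abs, sub_neg_eq_add, ← two_mul, abs_mul]; simpa using hy
      nlinarith
    · intro x hx
      rw [norm_mul, Complex.norm_I, one_mul]
      rw [Set.uIcc_of_le (by linarith [abs_nonneg u])] at hx
      exact hM x (abs_le.2 hx)
    · rw [Set.uIcc_of_le (by linarith [abs_nonneg u])]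
      have := abs_le.1 hy
      exact ⟨by linarith, by linarith⟩
    · rw [Set.uIcc_of_le (by linarith [abs_nonneg u])]
      exact abs_le.1 hy
  have := (convex_uIcc (-|u|) |u|).norm_image_sub_le_of_norm_hasDerivWithin_le (f := fun y : ℝ => l (s + y * I) + l (s - y * I))
      (f' := fun y => I * (deriv l (s + y * I) - deriv l (s - y * I))) (C := 2 * |u| * M) (x := 0) (y := u) ?_ ?_ ?_ ?_
  · simp only [ofReal_zero, zero_mul, add_zero, sub_zero, Real.norm_eq_abs] at this
    rw [← two_mul] at this
    refine this.trans (le_of_eq ?_)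
    rw [← sq_abs u]; ring
  · intro x hx
    have h1 := hline l hd x
    have h2 := HasDerivAt.scomp x (hline l hd (-x)) (hasDerivAt_neg x)
    have h3 := h1.add h2
    refine HasDerivAt.hasDerivWithinAt ?_
    convert h3 using 1
    · ext y; simp [Function.comp_def, sub_eq_add_neg]
    · simp [sub_eq_add_neg]; ring
  · intro x hx
    rw [norm_mul, Complex.norm_I, one_mul]
    rw [Set.uIcc_of_le (by linarith [abs_nonneg u])] at hx
    exact hd1 x (abs_le.2 hx)
  · rw [Set.uIcc_of_le (by linarith [abs_nonneg u])]
    exact ⟨by linarith [abs_nonneg u], abs_nonneg u⟩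
  · rw [Set.uIcc_of_le (by linarith [abs_nonneg u])]
    exact abs_le.1 le_rfl


open MeasureTheory in
lemma smooth_diff {l lam : ℂ → ℂ} (hd : DifferentiableOn ℂ l {s | 1/2 < s.re})
    (hg : ∀ δ : ℝ, 0 < δ → δ ≤ 1 → ∃ C : ℝ, 0 < C ∧ ∀ s : ℂ, 1/2 + δ ≤ s.re → ‖l s‖ ≤ C * (1 + ‖s‖))
    (hlam : DifferentiableOn ℂ lam {s | 1/2 < s.re})
    (hpos : ∀ s : ℂ, 1/2 < s.re → 0 ≤ (deriv lam s).re) {C : ℝ} (hC : 0 < C)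
    (hll : ∀ s : ℂ, 1/2 < s.re → ‖deriv (deriv l) s‖ ≤ ‖deriv (deriv lam) s‖ + C * Real.log (2 + ‖s‖))
    {W : ℝ → ℝ} {K : ℝ → ℂ} (hW1 : W 0 = 1) (hKe : ∀ v, K (-v) = K v)
    (hKc : Continuous K) (hKi : ∀ n : ℕ, Integrable (fun v : ℝ => (1 + |v|) ^ n * ‖K v‖))
    (hKW : ∀ y : ℝ, ∫ v : ℝ, Complex.exp (-2 * π * v * y * I) * K v = W y) {X A : ℝ} (hA : 1 ≤ A) (hX : 1 ≤ X) (t : ℝ) :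
    ‖(∫ v : ℝ, l ((1/2 + (A/X : ℝ) + t * I) + v * (2 * π / X : ℝ) * I) * K v) - l (1/2 + (A/X : ℝ) + t * I)‖ ≤
      (∫ v : ℝ, (1 + |v|) ^ 10 * ‖K v‖) * (392 * Real.exp 4 * 7 ^ 8) * ((deriv lam (1/2 + (A/X : ℝ) + t * I)).re / (A * X)) +
      (∫ v : ℝ, (1 + |v|) ^ 10 * ‖K v‖) * (1078 * C) * Real.log (2 + ‖(1/2 + (A/X : ℝ) + t * I : ℂ)‖) := by
  have hX0 : 0 < X := by linarith
  have hd0 : 0 < A / X := by positivity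
  obtain ⟨d, hdd⟩ : ∃ d, d = A / X := ⟨_, rfl⟩
  rw [← hdd] at hd0 ⊢
  obtain ⟨s, hs⟩ : ∃ s : ℂ, s = 1/2 + d + t * I := ⟨_, rfl⟩
  have hsre : 1/2 < s.re := by rw [hs]; simpa using hd0
  obtain ⟨g, hgd⟩ : ∃ g, g = (deriv lam s).re := ⟨_, rfl⟩
  have hg0 : 0 ≤ g := by rw [hgd]; exact hpos s hsre
  rw [← hs, ← hgd]
  obtain ⟨hi, -⟩ := integral_holo hd hg hKc hKi (2 * π / X)
  have hi := hi s hsre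
  have hKint : Integrable K := by
    have := hKi 0
    simp only [pow_zero, one_mul] at this
    exact (integrable_norm_iff hKc.aestronglyMeasurable).1 this
  have hK1 : ∫ v : ℝ, K v = 1 := by
    have := hKW 0
    simpa [hW1] using this
  set c : ℝ := 2 * π / X with hc
  have hi' : Integrable (fun v : ℝ => l (s - v * c * I) * K v) := by
    have := hi.comp_neg
    refine this.congr (Filter.Eventually.of_forall fun v => ?_)
    simp only [hKe]; congr 2; push_cast; ring
  have hsymm : ∫ v : ℝ, l (s - v * c * I) * K v = ∫ v : ℝ, l (s + v * c * I) * K v := by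
    rw [← integral_neg_eq_self (fun v : ℝ => l (s + v * c * I) * K v)]
    congr 1; ext v
    simp only [hKe]; congr 2; push_cast; ring
  have heq : (∫ v : ℝ, l (s + v * c * I) * K v) - l s =
      ∫ v : ℝ, (1/2 : ℂ) * ((l (s + v * c * I) + l (s - v * c * I) - 2 * l s) * K v) := by
    have : ∀ v : ℝ, (1/2 : ℂ) * ((l (s + v * c * I) + l (s - v * c * I) - 2 * l s) * K v) =
        (1/2 : ℂ) * (l (s + v * c * I) * K v) + (1/2 : ℂ) * (l (s - v * c * I) * K v) - l s * K v := by
      intro v; ring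
    simp_rw [this]
    have a1 : Integrable (fun v : ℝ => (1/2 : ℂ) * (l (s + v * c * I) * K v) + (1/2 : ℂ) * (l (s - v * c * I) * K v)) :=
      (hi.const_mul _).add (hi'.const_mul _)
    rw [integral_sub a1 (hKint.const_mul _), integral_add (hi.const_mul _) (hi'.const_mul _)]
    simp_rw [integral_const_mul]
    rw [hsymm, hK1]; ring
  rw [heq]
  have hlog0 : 0 < Real.log (2 + ‖s‖) := Real.log_pos (by linarith [norm_nonneg s])
  have hlog2 : 0.69 ≤ Real.log (2 + ‖s‖) := by
    have h1 := Real.log_le_log (by norm_num) (show (2:ℝ) ≤ 2 + ‖s‖ by linarith [norm_nonneg s])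
    have := Real.log_two_gt_d9
    linarith
  have hc7 : c ≤ 7 / X := by
    rw [hc]; gcongr; have := Real.pi_lt_d2; linarith
  have hc0 : 0 < c := by rw [hc]; positivity
  have hc71 : c ≤ 7 := hc7.trans (div_le_self (by norm_num) hX)
  have hcd : c / d ≤ 7 := by
    rw [hdd, div_le_iff₀ (by positivity)]
    refine hc7.trans ?_
    rw [← mul_div_assoc]; gcongr; linarith
  have hM : ∀ v : ℝ, ∀ y : ℝ, |y| ≤ |v * c| → ‖deriv (deriv l) (s + y * I)‖ ≤
      4 * Real.exp 4 * 7 ^ 8 * (1 + |v|) ^ 8 * (g / d) + C * (11 * (1 + |v|) * Real.log (2 + ‖s‖)) := by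
    intro v y hy
    have hvc : |v * c| = |v| * c := by rw [abs_mul, abs_of_pos hc0]
    rw [hvc] at hy
    have hmem : 1/2 < (s + y * I).re := by simpa using hsre
    refine (hll _ hmem).trans (add_le_add ?_ (mul_le_mul_of_nonneg_left ?_ hC.le))
    · refine (harn_deriv hlam hpos _ hmem).trans ?_
      have h1 := harn_all hlam hpos t y hd0
      rw [show (1/2 + (d:ℂ) + ((t + y : ℝ):ℂ) * I) = s + y * I by rw [hs]; push_cast; ring, ← hs, ← hgd] at h1
      have h2 : (s + y * I).re - 1/2 = d := by rw [hs]; simp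
      rw [h2]
      have h3 : 1 + |y| / d ≤ 7 * (1 + |v|) := by
        have : |y| / d ≤ |v| * (c / d) := by rw [← mul_div_assoc]; gcongr
        have : |v| * (c / d) ≤ |v| * 7 := by gcongr
        linarith
      have h4 : (1 + |y| / d) ^ 8 ≤ 7 ^ 8 * (1 + |v|) ^ 8 := by
        rw [← mul_pow]; gcongr
      calc 4 * (deriv lam (s + y * I)).re / d ≤ 4 * (Real.exp 4 * (7 ^ 8 * (1 + |v|) ^ 8) * g) / d := by
            gcongr
            exact h1.trans (by gcongr)
        _ = _ := by ring
    · have h1 : ‖s + y * I‖ ≤ ‖s‖ + 7 * |v| := by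
        refine (norm_add_le _ _).trans ?_
        simp only [norm_mul, Complex.norm_real, Real.norm_eq_abs, Complex.norm_I, mul_one]
        have : |v| * c ≤ |v| * 7 := by gcongr
        linarith
      have h2 : 2 + ‖s + y * I‖ ≤ (2 + ‖s‖) * (1 + 7 * |v|) := by nlinarith [norm_nonneg s, abs_nonneg v, mul_nonneg (norm_nonneg s) (abs_nonneg v)]
      have h3 := Real.log_le_log (by positivity) h2
      rw [Real.log_mul (by positivity) (by positivity)] at h3
      have h4 := Real.log_le_sub_one_of_pos (show 0 < 1 + 7 * |v| by positivity)
      nlinarith [abs_nonneg v]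
  have hbd : ∀ v : ℝ, ‖(1/2 : ℂ) * ((l (s + v * c * I) + l (s - v * c * I) - 2 * l s) * K v)‖ ≤
      ((392 * Real.exp 4 * 7 ^ 8) * (g / (A * X)) + (1078 * C) * Real.log (2 + ‖s‖)) * ((1 + |v|) ^ 10 * ‖K v‖) := by
    intro v
    have h1 := second_diff hd hsre (v * c) _ (hM v)
    push_cast at h1
    rw [norm_mul, norm_mul]
    have h2 : (v * c) ^ 2 ≤ (1 + |v|) ^ 2 * (49 / X ^ 2) := by
      rw [mul_pow, ← sq_abs v, show (49:ℝ) / X ^ 2 = (7 / X) ^ 2 by ring]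
      gcongr
      linarith
    have h3 : (49 / X ^ 2) * (g / d) = 49 * (g / (A * X)) := by
      rw [hdd]; field_simp
    have h4 : (49 / X ^ 2) ≤ 49 := div_le_self (by norm_num) (one_le_pow₀ hX)
    have h5 : (1 + |v|) ^ 3 ≤ (1 + |v|) ^ 10 := pow_le_pow_right₀ (by linarith [abs_nonneg v]) (by norm_num)
    have h6 : 2 * (v * c) ^ 2 * (4 * Real.exp 4 * 7 ^ 8 * (1 + |v|) ^ 8 * (g / d) + C * (11 * (1 + |v|) * Real.log (2 + ‖s‖))) ≤
        ((392 * Real.exp 4 * 7 ^ 8) * (g / (A * X)) + (1078 * C) * Real.log (2 + ‖s‖)) * (1 + |v|) ^ 10 := by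
      calc _ ≤ 2 * ((1 + |v|) ^ 2 * (49 / X ^ 2)) * (4 * Real.exp 4 * 7 ^ 8 * (1 + |v|) ^ 8 * (g / d) + C * (11 * (1 + |v|) * Real.log (2 + ‖s‖))) := by
            gcongr
        _ = 8 * Real.exp 4 * 7 ^ 8 * (1 + |v|) ^ 10 * ((49 / X ^ 2) * (g / d)) + (49 / X ^ 2) * (22 * C * Real.log (2 + ‖s‖) * (1 + |v|) ^ 3) := by ring
        _ ≤ 8 * Real.exp 4 * 7 ^ 8 * (1 + |v|) ^ 10 * (49 * (g / (A * X))) + 49 * (22 * C * Real.log (2 + ‖s‖) * (1 + |v|) ^ 10) := by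
            rw [h3]; gcongr
        _ = _ := by ring
    have h7 := h1.trans h6
    have h8 : ‖(1/2:ℂ)‖ ≤ 1 := by norm_num
    calc _ ≤ 1 * ((((392 * Real.exp 4 * 7 ^ 8) * (g / (A * X)) + (1078 * C) * Real.log (2 + ‖s‖)) * (1 + |v|) ^ 10) * ‖K v‖) := by
          gcongr
      _ = _ := by ring
  refine (norm_integral_le_of_norm_le ((hKi 10).const_mul _) (Filter.Eventually.of_forall hbd)).trans (le_of_eq ?_)
  rw [integral_const_mul]; ring


open MeasureTheory in
lemma key_ineq : ∃ (A B C : ℝ) (W : ℝ → ℝ), 1 ≤ A ∧ 0 ≤ B ∧ 0 < C ∧ (∀ y, 0 ≤ W y ∧ W y ≤ 1) ∧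
    ∀ (q : ℕ) [NeZero q] (χ : DirichletCharacter ℂ q), χ ≠ 1 → χ.IsPrimitive → χ.Even → dirichletRH χ →
    ∀ X : ℝ, 4 * A ≤ X → ∀ (t : ℝ) (S : Finset (Nat.Primes × ℕ)),
    (∀ pe : Nat.Primes × ℕ, ((pe.1:ℕ):ℝ) ^ (pe.2 + 1) < Real.exp X → pe ∈ S) →
    ‖DirichletCharacter.LFunction χ (1/2 + t * I)‖ ≤ C * (3 + |t|) ^ B * Real.exp (A / 2 * Real.log q / X) *
      Real.exp (∑ pe ∈ S, lterm χ (1/2 + (A/X : ℝ) + t * I) pe * W ((pe.2 + 1 : ℕ) * Real.log (pe.1 : ℕ) / X)).re := by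
  obtain ⟨C, hC, hlogs⟩ := exists_logs
  obtain ⟨W, K, hW, hW1, hW0, hKe, hKc, hKi, hKW⟩ := exists_kernel
  obtain ⟨CG, hCG, hG⟩ := Gamma_shift_bound
  obtain ⟨J, hJ⟩ : ∃ J, J = ∫ v : ℝ, (1 + |v|) ^ 10 * ‖K v‖ := ⟨_, rfl⟩
  have hJ0 : 0 ≤ J := by rw [hJ]; exact integral_nonneg fun v => by positivity
  obtain ⟨C3, hC3⟩ : ∃ C3, C3 = J * (392 * Real.exp 4 * 7 ^ 8) := ⟨_, rfl⟩
  obtain ⟨C4, hC4⟩ : ∃ C4, C4 = J * (1078 * C) := ⟨_, rfl⟩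
  have hC30 : 0 ≤ C3 := by rw [hC3]; positivity
  have hC40 : 0 ≤ C4 := by rw [hC4]; positivity
  obtain ⟨A, hA⟩ : ∃ A, A = √(5 * C3) + 1 := ⟨_, rfl⟩
  have hA1 : 1 ≤ A := by rw [hA]; linarith [Real.sqrt_nonneg (5 * C3)]
  have hA2 : 5 * C3 ≤ A ^ 2 := by
    rw [hA]; nlinarith [Real.sqrt_nonneg (5 * C3), Real.sq_sqrt (show 0 ≤ 5 * C3 by positivity)]
  refine ⟨A, C4 + 1, CG, W, hA1, by positivity, by linarith, hW, ?_⟩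
  intro q _ χ hχ hprim heven hRH X hX t S hS
  have hq : (0:ℝ) < q := by exact_mod_cast NeZero.pos q
  have hq0 : (q:ℂ) ≠ 0 := by exact_mod_cast NeZero.ne q
  obtain ⟨l, lam, hld, hle, hls, hlamd, hlame, hpos, hll⟩ := hlogs q χ hχ hprim heven hRH
  have hX1 : 1 ≤ X := by linarith
  have hX0 : 0 < X := by linarith
  have hg := fun (δ : ℝ) (h : 0 < δ) (h1 : δ ≤ 1) => logL_growth hχ hld hle hls h h1
  have key := smooth_diff hld hg hlamd hpos hC hll hW1 hKe hKc hKi hKW hA1 hX1 t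
  rw [← hJ, ← hC3, ← hC4] at key
  obtain ⟨d, hdd⟩ : ∃ d, d = A / X := ⟨_, rfl⟩
  have hd0 : 0 < d := by rw [hdd]; positivity
  have hd4 : d ≤ 1/4 := by rw [hdd, div_le_iff₀ hX0]; linarith
  rw [← hdd] at key ⊢
  have hsre : 1/2 < (1/2 + d + t * I : ℂ).re := by simpa using hd0
  rw [smoothing hld hg hls hW0 hKc hKi hKW hX0 S hS hsre] at key
  set D := ∑ pe ∈ S, lterm χ (1/2 + d + t * I) pe * W ((pe.2 + 1 : ℕ) * Real.log (pe.1 : ℕ) / X) with hD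
  have gain := harn_gain (Lam := fun s => (q:ℂ) ^ (s/2) * DirichletCharacter.completedLFunction χ s) hlamd hpos hlame
    (by
      refine Continuous.mul ?_ (DirichletCharacter.differentiable_completedLFunction hχ).continuous
      exact Continuous.const_cpow (by fun_prop) (Or.inl hq0)) t hd0
  obtain ⟨g, hgdef⟩ : ∃ g, g = (deriv lam (1/2 + d + t * I)).re := ⟨_, rfl⟩
  have hg0 : 0 ≤ g := by rw [hgdef]; exact hpos _ hsre
  rw [← hgdef] at gain key
  simp only [norm_mul] at gain
  have hhalf : (0:ℝ) < (1/2 + t * I : ℂ).re := by simp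
  rw [completed_eq heven hhalf, completed_eq heven (by linarith : 0 < (1/2 + d + t * I : ℂ).re), ← hle _ hsre, norm_mul, norm_mul,
    Complex.norm_natCast_cpow_of_pos (NeZero.pos q), Complex.norm_natCast_cpow_of_pos (NeZero.pos q), Complex.norm_exp] at gain
  have e1 : ((1/2 + t * I : ℂ)/2).re = 1/4 := by simp; norm_num
  have e2 : ((1/2 + d + t * I : ℂ)/2).re = 1/4 + d/2 := by simp; ring
  rw [e1, e2, Real.rpow_add hq] at gain
  -- Gamma comparison
  have hGam : ‖Complex.Gammaℝ (1/2 + d + t * I)‖ ≤ CG * (1 + |t|) * ‖Complex.Gammaℝ (1/2 + t * I)‖ := by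
    rw [Complex.Gammaℝ_def, Complex.Gammaℝ_def, norm_mul, norm_mul]
    have h1 := hG ((1/2 + t * I)/2) (d/2 : ℝ) (by rw [e1]) (by
      rw [Complex.norm_real, Real.norm_eq_abs, abs_of_pos (by positivity)]; linarith)
    rw [show (1/2 + t * I : ℂ)/2 + ((d/2:ℝ):ℂ) = (1/2 + d + t * I)/2 by push_cast; ring] at h1
    have h2 : ‖(1/2 + t * I : ℂ)/2‖ ≤ 1 + |t| := by
      rw [norm_div]
      have : ‖(1/2 + t * I : ℂ)‖ ≤ 1/2 + |t| := by
        refine (norm_add_le _ _).trans ?_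
        simp
      have h3 : ‖(2:ℂ)‖ = 2 := by norm_num
      rw [h3, div_le_iff₀ (by norm_num)]; linarith [abs_nonneg t]
    have h4 : ‖(π:ℂ) ^ (-(1/2 + d + t * I : ℂ)/2)‖ ≤ ‖(π:ℂ) ^ (-(1/2 + t * I : ℂ)/2)‖ := by
      rw [Complex.norm_cpow_eq_rpow_re_of_pos Real.pi_pos, Complex.norm_cpow_eq_rpow_re_of_pos Real.pi_pos]
      refine Real.rpow_le_rpow_of_exponent_le (by linarith [Real.pi_gt_three]) ?_
      simp; linarith
    calc _ ≤ ‖(π:ℂ) ^ (-(1/2 + t * I : ℂ)/2)‖ * (CG * (1 + |t|) * ‖Complex.Gamma ((1/2 + t * I)/2)‖) := by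
          refine mul_le_mul h4 (h1.trans ?_) (norm_nonneg _) (norm_nonneg _)
          gcongr
      _ = _ := by ring
  have hGpos : 0 < ‖Complex.Gammaℝ (1/2 + t * I)‖ := norm_pos_iff.2 (Complex.Gammaℝ_ne_zero_of_re_pos hhalf)
  -- real part of l
  have hre : (l (1/2 + d + t * I)).re ≤ D.re + C3 * (g / (A * X)) + C4 * Real.log (2 + ‖(1/2 + d + t * I : ℂ)‖) := by
    have := (Complex.abs_re_le_norm _).trans key
    have := (abs_le.1 this).1
    rw [Complex.sub_re] at this
    linarith
  have hgg : C3 * (g / (A * X)) ≤ g * d / 5 := by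
    rw [hdd]
    rw [← mul_div_assoc, div_le_div_iff₀ (by positivity) (by norm_num), show g * (A / X) * (A * X) = g * A ^ 2 by field_simp]
    nlinarith
  have hnorm : 2 + ‖(1/2 + d + t * I : ℂ)‖ ≤ 3 + |t| := by
    have : ‖(1/2 + d + t * I : ℂ)‖ ≤ 1/2 + d + |t| := by
      refine (norm_add₃_le).trans ?_
      simp [abs_of_pos hd0]
    linarith
  have hlog := Real.log_le_log (by positivity) hnorm
  have h3t : 0 < 3 + |t| := by positivity
  have hexp : Real.exp (l (1/2 + d + t * I)).re * Real.exp (-(g * d / 5)) ≤ Real.exp D.re * (3 + |t|) ^ C4 := by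
    rw [Real.rpow_def_of_pos h3t, ← Real.exp_add, ← Real.exp_add]
    refine Real.exp_le_exp.2 ?_
    have := mul_le_mul_of_nonneg_left hlog hC40
    linarith
  have hqd : (q:ℝ) ^ (d/2) = Real.exp (A / 2 * Real.log q / X) := by
    rw [Real.rpow_def_of_pos hq, hdd]; congr 1; ring
  have hq4 : 0 < (q:ℝ) ^ (1/4 : ℝ) := by positivity
  have hP : 0 < (q:ℝ) ^ (1/4 : ℝ) * ‖Complex.Gammaℝ (1/2 + t * I)‖ := by positivity
  refine le_of_mul_le_mul_left ?_ hP
  calc (q:ℝ) ^ (1/4 : ℝ) * ‖Complex.Gammaℝ (1/2 + t * I)‖ * ‖DirichletCharacter.LFunction χ (1/2 + t * I)‖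
      ≤ (q:ℝ) ^ (1/4 : ℝ) * (q:ℝ) ^ (d/2) * ‖Complex.Gammaℝ (1/2 + d + t * I)‖ * (Real.exp (l (1/2 + d + t * I)).re * Real.exp (-(g * d / 5))) := by
        refine le_trans (le_of_eq (by ring)) (gain.trans (le_of_eq (by ring)))
    _ ≤ (q:ℝ) ^ (1/4 : ℝ) * (q:ℝ) ^ (d/2) * (CG * (1 + |t|) * ‖Complex.Gammaℝ (1/2 + t * I)‖) * (Real.exp D.re * (3 + |t|) ^ C4) := by
        gcongr
    _ ≤ (q:ℝ) ^ (1/4 : ℝ) * (q:ℝ) ^ (d/2) * (CG * (3 + |t|) * ‖Complex.Gammaℝ (1/2 + t * I)‖) * (Real.exp D.re * (3 + |t|) ^ C4) := by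
        gcongr; norm_num
    _ = _ := by rw [hqd, Real.rpow_add h3t, Real.rpow_one]; ring


/-- primes up to `x` -/
noncomputable def primesUpTo (x : ℝ) : Finset ℕ := (Finset.range (⌊x⌋₊ + 1)).filter Nat.Prime

lemma mem_primesUpTo {x : ℝ} {p : ℕ} (hx : 0 ≤ x) : p ∈ primesUpTo x ↔ p.Prime ∧ (p:ℝ) ≤ x := by
  unfold primesUpTo
  rw [Finset.mem_filter, Finset.mem_range, Nat.lt_succ_iff, Nat.le_floor_iff hx, and_comm]

lemma key_ineq2 : ∃ (A B C : ℝ) (w1 w2 : ℝ → ℕ → ℝ), 1 ≤ A ∧ 0 ≤ B ∧ 0 < C ∧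
    (∀ X : ℝ, 0 < X → ∀ p : ℕ, p.Prime → (0 ≤ w1 X p ∧ w1 X p ≤ (p:ℝ) ^ (-(1/2 : ℝ)) ∧ 0 ≤ w2 X p ∧ w2 X p ≤ (p:ℝ)⁻¹)) ∧
    ∀ (q : ℕ) [NeZero q] (χ : DirichletCharacter ℂ q), χ ≠ 1 → χ.IsPrimitive → χ.Even → dirichletRH χ →
    ∀ X : ℝ, 4 * A ≤ X → ∀ (t : ℝ),
    ‖DirichletCharacter.LFunction χ (1/2 + t * I)‖ ≤ C * (3 + |t|) ^ B * Real.exp (A / 2 * Real.log q / X) *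
      Real.exp (∑ p ∈ primesUpTo (Real.exp X), (χ p * (p:ℂ) ^ (-(t * I)) * w1 X p + (χ p * (p:ℂ) ^ (-(t * I))) ^ 2 * w2 X p)).re := by
  obtain ⟨A, B, C, W, hA, hB, hC, hW, h⟩ := key_ineq
  obtain ⟨Z, hZ⟩ : ∃ Z, Z = ∑' n : ℕ, ((n:ℝ) ^ (-(3/2 : ℝ))) := ⟨_, rfl⟩
  have hZs : Summable (fun n : ℕ => ((n:ℝ) ^ (-(3/2 : ℝ)))) := Real.summable_nat_rpow.2 (by norm_num)
  have hZ0 : 0 ≤ Z := by rw [hZ]; exact tsum_nonneg fun n => by positivity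
  refine ⟨A, B, C * Real.exp (4 * Z), fun X p => (p:ℝ) ^ (-(1/2 + A/X)) * W (Real.log p / X),
    fun X p => (p:ℝ) ^ (-(2 * (1/2 + A/X))) * W (2 * Real.log p / X) / 2, hA, hB, by positivity, ?_, ?_⟩
  · intro X hX p hp
    have hp1 : (1:ℝ) ≤ p := by exact_mod_cast hp.one_le
    have hp0 : (0:ℝ) < p := by linarith
    have hAX : 0 < A / X := by positivity
    refine ⟨mul_nonneg (by positivity) (hW _).1, ?_, div_nonneg (mul_nonneg (by positivity) (hW _).1) (by norm_num), ?_⟩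
    · refine (mul_le_of_le_one_right (by positivity) (hW _).2).trans ?_
      exact Real.rpow_le_rpow_of_exponent_le hp1 (by linarith)
    · have h1 : (p:ℝ) ^ (-(2 * (1/2 + A/X))) * W (2 * Real.log p / X) ≤ (p:ℝ)⁻¹ := by
        refine (mul_le_of_le_one_right (by positivity) (hW _).2).trans ?_
        rw [← Real.rpow_neg_one]
        exact Real.rpow_le_rpow_of_exponent_le hp1 (by linarith)
      have h2 : 0 ≤ (p:ℝ) ^ (-(2 * (1/2 + A/X))) * W (2 * Real.log p / X) := mul_nonneg (by positivity) (hW _).1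
      linarith
  intro q _ χ hχ hprim heven hRH X hX t
  have hX0 : 0 < X := by linarith
  set N := ⌊Real.exp X⌋₊ with hN
  have hAX : 0 < A / X := by positivity
  obtain ⟨PS, hPS, hPSC, hPSR⟩ : ∃ PS : Finset Nat.Primes, (∀ p, p ∈ PS ↔ (p:ℕ) < N + 1) ∧
      (∀ f : ℕ → ℂ, ∑ p ∈ PS, f p = ∑ p ∈ primesUpTo (Real.exp X), f p) ∧
      (∀ f : ℕ → ℝ, ∑ p ∈ PS, f p = ∑ p ∈ primesUpTo (Real.exp X), f p) := by
    refine ⟨Finset.subtype Nat.Prime (Finset.range (N + 1)), fun p => ?_, fun f => ?_, fun f => ?_⟩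
    · exact (Finset.mem_subtype).trans Finset.mem_range
    · exact Finset.sum_subtype_eq_sum_filter _
    · exact Finset.sum_subtype_eq_sum_filter _
  have h0 := h q χ hχ hprim heven hRH X hX t (PS ×ˢ Finset.range (N + 2)) (by
    intro pe hpe
    rw [Finset.mem_product, hPS, Finset.mem_range]
    have h1 : (pe.1:ℕ) ^ (pe.2 + 1) ≤ N := Nat.le_floor (by push_cast; exact hpe.le)
    have h2 : (pe.1:ℕ) ≤ (pe.1:ℕ) ^ (pe.2 + 1) := Nat.le_self_pow (by omega) _
    have h3 := Nat.lt_pow_self (n := pe.2 + 1) pe.1.2.one_lt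
    constructor
    · omega
    · omega)
  refine h0.trans ?_
  rw [Finset.sum_product]
  have hf : ∀ (f : ℕ → ℂ), ∑ e ∈ Finset.range (N + 2), f e = (f 0 + f 1) + ∑ e ∈ Finset.range N, f (e + 2) := by
    intro f
    rw [Finset.sum_range_succ', Finset.sum_range_succ']; ring
  simp_rw [hf]
  rw [Finset.sum_add_distrib, Complex.add_re, Real.exp_add]
  have hrest : (∑ p ∈ PS, ∑ e ∈ Finset.range N,
      lterm χ (1/2 + (A/X : ℝ) + t * I) (p, e + 2) * W ((e + 2 + 1 : ℕ) * Real.log (p : ℕ) / X)).re ≤ 4 * Z := by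
    refine (Complex.re_le_norm _).trans ((norm_sum_le _ _).trans ?_)
    calc ∑ p ∈ PS, ‖∑ e ∈ Finset.range N, lterm χ (1/2 + (A/X : ℝ) + t * I) (p, e + 2) * W ((e + 2 + 1 : ℕ) * Real.log (p : ℕ) / X)‖
        ≤ ∑ p ∈ PS, ((p:ℕ):ℝ) ^ (-(3/2:ℝ)) * 4 := by
          refine Finset.sum_le_sum fun p _ => (norm_sum_le _ _).trans ?_
          have hp2 : (2:ℝ) ≤ ((p:ℕ):ℝ) := by exact_mod_cast p.2.two_le
          calc _ ≤ ∑ e ∈ Finset.range N, ((p:ℕ):ℝ) ^ (-(3/2:ℝ)) * (3/4:ℝ) ^ e := by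
                refine Finset.sum_le_sum fun e _ => ?_
                rw [norm_mul, Complex.norm_real, Real.norm_eq_abs, abs_of_nonneg (hW _).1]
                refine (mul_le_of_le_one_right (norm_nonneg _) (hW _).2).trans ?_
                refine (lterm_norm_le χ _ (p, e + 2) (σ := 1/2) (by simp; positivity)).trans ?_
                simp only
                push_cast
                rw [← Real.rpow_natCast, ← Real.rpow_mul (by positivity)]
                have : (3/4:ℝ) ^ e = ((3/4:ℝ) ^ (2:ℝ)) ^ ((e:ℝ)/2) := by
                  rw [← Real.rpow_mul (by norm_num), ← Real.rpow_natCast]; congr 1; ring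
                rw [this, show ((e + 2 + 1 : ℕ):ℝ) * -(1/2) = -(3/2) + -((e:ℝ)/2) by push_cast; ring, Real.rpow_add (by positivity), Real.rpow_neg (by positivity) ((e:ℝ)/2),
                  ← Real.inv_rpow (by positivity)]
                gcongr
                refine (inv_anti₀ (by norm_num) hp2).trans ?_
                norm_num
            _ ≤ _ := by
                rw [← Finset.mul_sum]
                gcongr
                have := geom_sum_eq (show (3/4:ℝ) ≠ 1 by norm_num) N
                rw [this, div_le_iff_of_neg (by norm_num)]
                have : (0:ℝ) ≤ (3/4) ^ N := by positivity
                linarith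
      _ = (∑ p ∈ primesUpTo (Real.exp X), (p:ℝ) ^ (-(3/2:ℝ))) * 4 := by
          rw [← Finset.sum_mul, hPSR (fun p => (p:ℝ) ^ (-(3/2:ℝ)))]
      _ ≤ 4 * Z := by
          rw [hZ, mul_comm]
          gcongr
          exact hZs.sum_le_tsum _ (fun _ _ => by positivity)
  have hmain : ∑ p ∈ PS, (lterm χ (1/2 + (A/X : ℝ) + t * I) (p, 0) * W ((0 + 1 : ℕ) * Real.log (p : ℕ) / X)
     + lterm χ (1/2 + (A/X : ℝ) + t * I) (p, 1) * W ((1 + 1 : ℕ) * Real.log (p : ℕ) / X)) =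
      ∑ p ∈ primesUpTo (Real.exp X), (χ p * (p:ℂ) ^ (-(t * I)) * (((p:ℝ) ^ (-(1/2 + A/X)) * W (Real.log p / X) : ℝ):ℂ) +
        (χ p * (p:ℂ) ^ (-(t * I))) ^ 2 * (((p:ℝ) ^ (-(2 * (1/2 + A/X))) * W (2 * Real.log p / X) / 2 : ℝ):ℂ)) := by
    rw [← hPSC]
    refine Finset.sum_congr rfl fun p _ => ?_
    have hp0 : ((p:ℕ):ℂ) ≠ 0 := by exact_mod_cast p.2.ne_zero
    have e1 : ((p:ℕ):ℂ) ^ (-(1/2 + (A/X : ℝ) + t * I : ℂ)) = ((p:ℕ):ℂ) ^ (-(t * I)) * ((((p:ℕ):ℝ) ^ (-(1/2 + A/X)) : ℝ):ℂ) := by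
      rw [Complex.ofReal_cpow (by positivity), ← Complex.ofReal_natCast, ← Complex.cpow_add _ _ (by exact_mod_cast hp0)]
      congr 1; push_cast; ring
    have e2 : ((p:ℕ):ℝ) ^ (-(2 * (1/2 + A/X))) = (((p:ℕ):ℝ) ^ (-(1/2 + A/X))) ^ 2 := by
      rw [← Real.rpow_natCast, ← Real.rpow_mul (by positivity)]; congr 1; push_cast; ring
    unfold lterm
    simp only [e1]
    rw [e2]
    push_cast
    simp only [one_add_one_eq_two, zero_add, one_mul]
    ring
  have hmain' := congrArg (fun z => Real.exp z.re) hmain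
  have := Real.exp_le_exp.2 hrest
  have hP : 0 ≤ C * (3 + |t|) ^ B * Real.exp (A / 2 * Real.log q / X) := by positivity
  refine (mul_le_mul_of_nonneg_left (mul_le_mul hmain'.le this (Real.exp_pos _).le (Real.exp_pos _).le) hP).trans (le_of_eq ?_)
  ring


lemma theta_eq {q : ℕ} {χ : DirichletCharacter ℂ q} (he : χ.Even) (x : ℝ) :
    dirichletTheta χ x = ∑' n : ℕ, χ n * (Real.exp (-(π * n ^ 2 / q) * x) : ℂ) := by
  unfold dirichletTheta
  have : χ (-1) = 1 := he
  simp only [this, if_true, pow_zero, mul_one]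
  congr 1; ext n; congr 1
  push_cast; congr 1; ring

lemma abel_bound (a : ℕ → ℝ) (ha : Antitone a) (ha0 : ∀ n, 0 ≤ a n) (g : ℕ → ℂ) {B : ℝ}
    (hB : ∀ n, ‖∑ i ∈ range n, g i‖ ≤ B) (n : ℕ) : ‖∑ i ∈ range n, g i * a i‖ ≤ B * a 0 := by
  have hB0 : 0 ≤ B := (norm_nonneg _).trans (hB 0)
  have h := Finset.sum_range_by_parts (fun i => (a i : ℂ)) g n
  simp only [smul_eq_mul] at h
  simp_rw [mul_comm (g _)]
  rw [h]
  refine (norm_sub_le _ _).trans ?_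
  have h1 : ‖∑ i ∈ range (n-1), ((a (i+1) : ℂ) - a i) * ∑ i ∈ range (i+1), g i‖ ≤ B * (a 0 - a (n-1)) := by
    refine (norm_sum_le _ _).trans ?_
    have : ∀ i ∈ range (n-1), ‖((a (i+1) : ℂ) - a i) * ∑ i ∈ range (i+1), g i‖ ≤ (a i - a (i+1)) * B := by
      intro i _
      rw [norm_mul, ← Complex.ofReal_sub, Complex.norm_real, Real.norm_eq_abs, abs_of_nonpos (sub_nonpos.2 (ha (Nat.le_succ i))), neg_sub]
      exact mul_le_mul_of_nonneg_left (hB _) (sub_nonneg.2 (ha (Nat.le_succ i)))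
    refine (Finset.sum_le_sum this).trans (le_of_eq ?_)
    rw [← Finset.sum_mul, Finset.sum_range_sub']; ring
  have h2 : ‖(a (n-1) : ℂ) * ∑ i ∈ range n, g i‖ ≤ a (n-1) * B := by
    rw [norm_mul, Complex.norm_real, Real.norm_eq_abs, abs_of_nonneg (ha0 _)]
    exact mul_le_mul_of_nonneg_left (hB _) (ha0 _)
  linarith

lemma theta_term_summable {q : ℕ} [NeZero q] (χ : DirichletCharacter ℂ q) {x : ℝ} (hx : 0 < x) :
    Summable (fun n : ℕ => Real.exp (-(π * n ^ 2 / q) * x)) := by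
  have hq : (0:ℝ) < q := by exact_mod_cast NeZero.pos q
  have hr : Real.exp (-(π / q * x)) < 1 := Real.exp_lt_one_iff.2 (by have := Real.pi_pos; simp; positivity)
  refine Summable.of_nonneg_of_le (fun n => (Real.exp_pos _).le) (fun n => ?_) (summable_geometric_of_lt_one (Real.exp_pos _).le hr)
  rw [← Real.exp_nat_mul]
  refine Real.exp_le_exp.2 ?_
  have h1 : (n:ℝ) ≤ (n:ℝ) ^ 2 := by exact_mod_cast Nat.le_self_pow (by norm_num) n
  have h2 : 0 ≤ π / q * x := by positivity
  have := mul_le_mul_of_nonneg_right h1 h2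
  calc -(π * (n:ℝ) ^ 2 / q) * x = -((n:ℝ) ^ 2 * (π / q * x)) := by ring
    _ ≤ -(n * (π / q * x)) := by linarith
    _ = _ := by ring

lemma theta_hasSum {q : ℕ} [NeZero q] {χ : DirichletCharacter ℂ q} (he : χ.Even) {x : ℝ} (hx : 0 < x) :
    HasSum (fun n : ℕ => χ n * (Real.exp (-(π * n ^ 2 / q) * x) : ℂ)) (dirichletTheta χ x) := by
  rw [theta_eq he]
  refine Summable.hasSum (Summable.of_norm_bounded (theta_term_summable χ hx) fun n => ?_)
  rw [norm_mul, Complex.norm_real, Real.norm_eq_abs, abs_of_pos (Real.exp_pos _)]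
  exact mul_le_of_le_one_left (Real.exp_pos _).le (χ.norm_le_one _)

lemma theta_bound {q : ℕ} [NeZero q] (hq1 : 1 < q) {χ : DirichletCharacter ℂ q} (hχ : χ ≠ 1) (he : χ.Even) {x : ℝ} (hx : 0 < x) :
    ‖dirichletTheta χ x‖ ≤ 2 * q * Real.exp (-(π / q) * x) := by
  have hq : (0:ℝ) < q := by exact_mod_cast NeZero.pos q
  haveI : Fact (1 < q) := ⟨hq1⟩
  have hs := theta_hasSum he hx
  have hs' := (hasSum_nat_add_iff' 1).2 hs
  have h0 : χ ((0:ℕ) : ZMod q) = 0 := by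
    rw [Nat.cast_zero]; exact χ.map_nonunit (by simp)
  simp only [Finset.sum_range_one, h0, zero_mul, sub_zero] at hs'
  refine le_of_tendsto (hs'.tendsto_sum_nat.norm) (Filter.Eventually.of_forall fun n => ?_)
  have := abel_bound (fun i : ℕ => Real.exp (-(π * ((i + 1 : ℕ):ℝ) ^ 2 / q) * x)) ?_ (fun n => (Real.exp_pos _).le)
    (fun i : ℕ => χ ((i + 1 : ℕ) : ZMod q)) (B := 2 * q) ?_ n
  · refine this.trans (le_of_eq ?_)
    simp
  · intro i j hij
    simp only
    have : ((i+1:ℕ):ℝ) ≤ ((j+1:ℕ):ℝ) := by exact_mod_cast Nat.succ_le_succ hij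
    gcongr
  · intro n
    have := char_sum_Icc_bound hχ n
    rw [Finset.range_eq_Ico, Finset.sum_Ico_add' (fun i : ℕ => χ (i : ZMod q)) 0 n 1]
    exact this

lemma theta_continuousAt {q : ℕ} [NeZero q] {χ : DirichletCharacter ℂ q} (he : χ.Even) {x : ℝ} (hx : 0 < x) :
    ContinuousAt (dirichletTheta χ) x := by
  have hq : (0:ℝ) < q := by exact_mod_cast NeZero.pos q
  have h1 : ContinuousOn (fun x : ℝ => ∑' n : ℕ, χ n * (Real.exp (-(π * n ^ 2 / q) * x) : ℂ)) (Set.Ici (x/2)) := by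
    refine continuousOn_tsum (fun n => by fun_prop) (theta_term_summable χ (half_pos hx)) ?_
    intro n y hy
    rw [norm_mul, Complex.norm_real, Real.norm_eq_abs, abs_of_pos (Real.exp_pos _)]
    refine (mul_le_of_le_one_left (Real.exp_pos _).le (χ.norm_le_one _)).trans ?_
    refine Real.exp_le_exp.2 ?_
    have hy : x/2 ≤ y := hy
    have : 0 ≤ π * (n:ℝ) ^ 2 / q := by positivity
    nlinarith
  have h2 : dirichletTheta χ = (fun x : ℝ => ∑' n : ℕ, χ n * (Real.exp (-(π * n ^ 2 / q) * x) : ℂ)) := by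
    ext x; exact theta_eq he x
  rw [h2]
  exact h1.continuousAt (Ici_mem_nhds (by linarith))


lemma theta_mellin {q : ℕ} [NeZero q] (hq1 : 1 < q) {χ : DirichletCharacter ℂ q} (hχ : χ ≠ 1) (he : χ.Even) :
    (∀ s : ℂ, 0 < s.re → MellinConvergent (dirichletTheta χ) s) ∧
    ∀ s : ℂ, 0 < s.re → mellin (dirichletTheta χ) s =
      Complex.Gamma s * ((q / π : ℝ) : ℂ) ^ s * DirichletCharacter.LFunction χ (2 * s) := by
  have hq : (0:ℝ) < q := by exact_mod_cast NeZero.pos q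
  have hqpi : 0 < (q / π : ℝ) := by positivity
  have hli : MeasureTheory.LocallyIntegrableOn (dirichletTheta χ) (Set.Ioi 0) := by
    refine ContinuousOn.locallyIntegrableOn (fun x hx => (theta_continuousAt he hx).continuousWithinAt) measurableSet_Ioi
  have htop : (dirichletTheta χ) =O[Filter.atTop] fun t => Real.exp (-(π / q) * t) := by
    refine Asymptotics.IsBigO.of_bound (2 * q) ?_
    filter_upwards [Filter.eventually_gt_atTop 0] with x hx
    rw [Real.norm_eq_abs, abs_of_pos (Real.exp_pos _)]
    exact theta_bound hq1 hχ he hx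
  have hbot : (dirichletTheta χ) =O[nhdsWithin 0 (Set.Ioi 0)] (fun x : ℝ => x ^ (-(0:ℝ))) := by
    refine Asymptotics.IsBigO.of_bound (2 * q) ?_
    filter_upwards [self_mem_nhdsWithin] with x hx
    have hx : 0 < x := hx
    simp only [neg_zero, Real.rpow_zero, norm_one, mul_one]
    refine (theta_bound hq1 hχ he hx).trans (mul_le_of_le_one_right (by positivity) (Real.exp_le_one_iff.2 ?_))
    have : 0 ≤ π / q := by positivity
    nlinarith
  refine ⟨fun s hs => mellinConvergent_of_isBigO_rpow_exp (by positivity) hli htop hbot hs, ?_⟩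
  have hd1 : DifferentiableOn ℂ (mellin (dirichletTheta χ)) {s | 0 < s.re} := fun s hs =>
    (mellin_differentiableAt_of_isBigO_rpow_exp (by positivity) hli htop hbot hs).differentiableWithinAt
  have hd2 : DifferentiableOn ℂ (fun s => Complex.Gamma s * ((q / π : ℝ) : ℂ) ^ s * DirichletCharacter.LFunction χ (2 * s)) {s | 0 < s.re} := by
    intro s hs
    have hs : 0 < s.re := hs
    refine DifferentiableAt.differentiableWithinAt ?_
    refine DifferentiableAt.mul (DifferentiableAt.mul (Complex.differentiableAt_Gamma s fun m hm => ?_) ?_) ?_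
    · rw [hm] at hs; simp at hs; have : (0:ℝ) ≤ m := by positivity
      linarith
    · exact DifferentiableAt.const_cpow differentiableAt_id (Or.inl (by exact_mod_cast hqpi.ne'))
    · exact ((DirichletCharacter.differentiable_LFunction hχ).comp (differentiable_id.const_mul 2)) s
  have key : ∀ s : ℂ, 1 < s.re → mellin (dirichletTheta χ) s =
      Complex.Gamma s * ((q / π : ℝ) : ℂ) ^ s * DirichletCharacter.LFunction χ (2 * s) := by
    intro s hs
    haveI : Fact (1 < q) := ⟨hq1⟩
    have h := hasSum_mellin (a := fun n : ℕ => χ n) (p := fun n : ℕ => π * n ^ 2 / q) (F := dirichletTheta χ) (s := s) ?_ (by linarith)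
      (fun t ht => theta_hasSum he ht) ?_
    · refine h.unique ?_
      rw [DirichletCharacter.LFunction_eq_LSeries χ (by simp; linarith)]
      have hL := (DirichletCharacter.LSeriesSummable_of_one_lt_re χ (s := 2 * s) (by simp; linarith)).hasSum
      have := hL.mul_left (Complex.Gamma s * ((q / π : ℝ) : ℂ) ^ s)
      change HasSum _ (Complex.Gamma s * ((q / π : ℝ) : ℂ) ^ s * ∑' (b : ℕ), LSeries.term (fun n => χ n) (2 * s) b)
      refine HasSum.congr_fun this fun n => ?_
      rcases Nat.eq_zero_or_pos n with h | h
      · subst h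
        have h0 : χ ((0:ℕ) : ZMod q) = 0 := by
          rw [Nat.cast_zero]; exact χ.map_nonunit (by simp)
        rw [h0]; simp
      · rw [LSeries.term_of_ne_zero h.ne']
        have e1 : ((π * n ^ 2 / q : ℝ) : ℂ) = (((q / π : ℝ)⁻¹ : ℝ) : ℂ) * (((n:ℝ) ^ 2 : ℝ) : ℂ) := by
          rw [← Complex.ofReal_mul]; congr 1; field_simp
        have e2 : (((n:ℝ) ^ 2 : ℝ) : ℂ) ^ s = (n:ℂ) ^ (2 * s) := by
          have hn0 : (n:ℂ) ≠ 0 := by exact_mod_cast h.ne'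
          push_cast
          rw [← Nat.cast_ofNat (R := ℂ), Complex.cpow_nat_mul']
          · rw [Complex.natCast_arg]; simp [Real.pi_pos]
          · rw [Complex.natCast_arg]; simp [Real.pi_pos.le]
        rw [e1, Complex.mul_cpow_ofReal_nonneg (by positivity) (by positivity), e2, Complex.ofReal_inv, Complex.inv_cpow]
        · field_simp
        · rw [Complex.arg_ofReal_of_nonneg hqpi.le]; exact Real.pi_pos.ne
    · intro n
      rcases Nat.eq_zero_or_pos n with h | h
      · left; rw [h, Nat.cast_zero]; exact χ.map_nonunit (by simp)
      · right; positivity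
    · have hsum : Summable (fun n : ℕ => (q / π : ℝ) ^ s.re * (1 / (n:ℝ) ^ (2 * s.re))) :=
        (Real.summable_one_div_nat_rpow.2 (by linarith)).mul_left _
      refine Summable.of_nonneg_of_le (fun n => by positivity) (fun n => ?_) hsum
      have e1 : (π * n ^ 2 / q : ℝ) ^ s.re = ((q / π : ℝ) ^ s.re)⁻¹ * (n:ℝ) ^ (2 * s.re) := by
        rw [← Real.inv_rpow hqpi.le, Real.rpow_mul (by positivity), ← Real.mul_rpow (by positivity) (by positivity)]
        congr 1
        rw [Real.rpow_two]; field_simp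
      rw [e1]
      calc ‖χ n‖ / (((q / π : ℝ) ^ s.re)⁻¹ * (n:ℝ) ^ (2 * s.re)) ≤ 1 / (((q / π : ℝ) ^ s.re)⁻¹ * (n:ℝ) ^ (2 * s.re)) := by
            gcongr; exact χ.norm_le_one _
        _ = _ := by
            rw [one_div, mul_inv, inv_inv, one_div]
  have := AnalyticOnNhd.eqOn_of_preconnected_of_eventuallyEq (hd1.analyticOnNhd (half_open _)) (hd2.analyticOnNhd (half_open _))
    (convex_halfSpace_re_gt 0).isPreconnected (z₀ := 2) (by show 0 < (2:ℂ).re; norm_num)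
    (by filter_upwards [(half_open 1).mem_nhds (show (2:ℂ) ∈ {z : ℂ | 1 < z.re} by simp)] with z hz using key z hz)
  exact fun s hs => this hs

open MeasureTheory in
lemma theta_le_integral (N : ℕ) (hN : 3 ≤ N) : ∃ C : ℝ, 0 < C ∧ ∀ (q : ℕ) [NeZero q], 1 < q → ∀ χ : DirichletCharacter ℂ q, χ ≠ 1 →
    χ.Even → Integrable (fun t : ℝ => ‖DirichletCharacter.LFunction χ (1/2 + t * I)‖ * ((1 + |t|) ^ N)⁻¹) ∧
    ‖dirichletTheta χ 1‖ ≤ C * (q:ℝ) ^ (1/4 : ℝ) * ∫ t : ℝ, ‖DirichletCharacter.LFunction χ (1/2 + t * I)‖ * ((1 + |t|) ^ N)⁻¹ := by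
  obtain ⟨C, hC, hG⟩ := Gamma_quarter_decay N
  refine ⟨C * 2 ^ N, by positivity, ?_⟩
  intro q _ hq1 χ hχ he
  have hq : (0:ℝ) < q := by exact_mod_cast NeZero.pos q
  have hqpi : 0 < (q / π : ℝ) := by positivity
  have hLc : Continuous (fun t : ℝ => DirichletCharacter.LFunction χ (1/2 + t * I)) :=
    (DirichletCharacter.differentiable_LFunction hχ).continuous.comp (by fun_prop)
  have hcont : Continuous (fun t : ℝ => ‖DirichletCharacter.LFunction χ (1/2 + t * I)‖ * ((1 + |t|) ^ N)⁻¹) := by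
    refine hLc.norm.mul (Continuous.inv₀ (by fun_prop) fun t => by positivity)
  have hIntg : Integrable (fun t : ℝ => ‖DirichletCharacter.LFunction χ (1/2 + t * I)‖ * ((1 + |t|) ^ N)⁻¹) := by
    have hb : Integrable (fun t : ℝ => 32 * q * (1 + ‖t‖) ^ (-(2:ℝ))) := (integrable_one_add_norm (by simp)).const_mul _
    refine Integrable.mono' hb hcont.aestronglyMeasurable (Filter.Eventually.of_forall fun t => ?_)
    rw [Real.norm_eq_abs, abs_of_nonneg (by positivity)]
    have h1 := L_growth hχ (s := 1/2 + t * I) (by simp; norm_num)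
    have h2 : ‖(1/2 + t * I : ℂ)‖ ≤ 1 + |t| := by
      refine (norm_add_le _ _).trans ?_
      simp; norm_num
    have h3 : (1 + |t|) ^ 3 ≤ (1 + |t|) ^ N := pow_le_pow_right₀ (by linarith [abs_nonneg t]) hN
    calc _ ≤ (32 * q * (1 + |t|)) * ((1 + |t|) ^ 3)⁻¹ := by
          gcongr
          exact h1.trans (by gcongr)
      _ = _ := by
          rw [Real.rpow_neg (by positivity), Real.norm_eq_abs, Real.rpow_two]
          have : 0 < 1 + |t| := by positivity
          field_simp
  refine ⟨hIntg, ?_⟩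
  obtain ⟨hconv, hmel⟩ := theta_mellin hq1 hχ he
  set h : ℝ → ℝ := fun t => ‖DirichletCharacter.LFunction χ (1/2 + t * I)‖ * ((1 + |t|) ^ N)⁻¹ with hh
  have hm : ∀ y : ℝ, mellin (dirichletTheta χ) ((1/4 : ℝ) + y * I) = Complex.Gamma (1/4 + y * I) *
      ((q / π : ℝ) : ℂ) ^ (1/4 + y * I : ℂ) * DirichletCharacter.LFunction χ (1/2 + (2 * y : ℝ) * I) := by
    intro y
    rw [hmel _ (by simp)]
    congr 2
    · push_cast; rfl
    · push_cast; rfl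
    · push_cast; ring
  have hbd : ∀ y : ℝ, ‖mellin (dirichletTheta χ) ((1/4 : ℝ) + y * I)‖ ≤ C * (q:ℝ) ^ (1/4 : ℝ) * 2 ^ N * h (2 * y) := by
    intro y
    rw [hm, norm_mul, norm_mul, Complex.norm_cpow_eq_rpow_re_of_pos hqpi]
    have e1 : (1/4 + y * I : ℂ).re = 1/4 := by simp
    rw [e1]
    have h1 : (q / π : ℝ) ^ (1/4 : ℝ) ≤ (q:ℝ) ^ (1/4 : ℝ) := by
      refine Real.rpow_le_rpow hqpi.le (div_le_self hq.le (by linarith [Real.pi_gt_three])) (by norm_num)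
    have h2 : (1 + |y|) ^ (-(N:ℝ)) ≤ 2 ^ N * ((1 + |2 * y|) ^ N)⁻¹ := by
      rw [Real.rpow_neg (by positivity), Real.rpow_natCast, ← div_eq_mul_inv, le_div_iff₀ (by positivity), inv_mul_le_iff₀ (by positivity), ← mul_pow]
      gcongr
      rw [abs_mul]; simp; linarith [abs_nonneg y]
    calc _ ≤ (C * (2 ^ N * ((1 + |2 * y|) ^ N)⁻¹)) * (q:ℝ) ^ (1/4 : ℝ) * ‖DirichletCharacter.LFunction χ (1/2 + (2 * y : ℝ) * I)‖ := by
          gcongr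
          exact (hG y).trans (by gcongr)
      _ = _ := by rw [hh]; ring
  have hIntg2 : Integrable (fun y : ℝ => h (2 * y)) := hIntg.comp_mul_left' (by norm_num)
  have hvert : VerticalIntegrable (mellin (dirichletTheta χ)) (1/4 : ℝ) := by
    refine Integrable.mono' (hIntg2.const_mul (C * (q:ℝ) ^ (1/4 : ℝ) * 2 ^ N)) ?_ (Filter.Eventually.of_forall hbd)
    refine Continuous.aestronglyMeasurable ?_
    simp_rw [hm]
    refine Continuous.mul (Continuous.mul ?_ ?_) (hLc.comp (continuous_const.mul continuous_id))
    · refine continuous_iff_continuousAt.2 fun y => ?_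
      refine ContinuousAt.comp (f := fun y : ℝ => (1/4 + y * I : ℂ)) (g := Complex.Gamma) ?_ (by fun_prop)
      refine (Complex.differentiableAt_Gamma _ fun m hm => ?_).continuousAt
      have := congrArg Complex.re hm
      simp at this
      have : (0:ℝ) ≤ m := by positivity
      linarith
    · exact Continuous.const_cpow (by fun_prop) (Or.inl (by exact_mod_cast hqpi.ne'))
  have hinv := mellinInv_mellin_eq (1/4 : ℝ) (dirichletTheta χ) one_pos (hconv _ (by simp)) hvert (theta_continuousAt he one_pos)
  rw [← hinv, mellinInv, norm_smul]
  have h1 : ‖(1 / (2 * π) : ℝ)‖ ≤ 1 := by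
    rw [Real.norm_eq_abs, abs_of_pos (by positivity)]
    rw [div_le_one (by positivity)]; linarith [Real.pi_gt_three]
  have h2 : ‖∫ y : ℝ, ((1:ℝ) : ℂ) ^ (-(((1/4 : ℝ) : ℂ) + y * I)) • mellin (dirichletTheta χ) ((1/4 : ℝ) + y * I)‖ ≤
      ∫ y : ℝ, C * (q:ℝ) ^ (1/4 : ℝ) * 2 ^ N * h (2 * y) := by
    refine norm_integral_le_of_norm_le (hIntg2.const_mul _) (Filter.Eventually.of_forall fun y => ?_)
    rw [Complex.ofReal_one, Complex.one_cpow, one_smul]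
    exact hbd y
  rw [integral_const_mul, Measure.integral_comp_mul_left h 2] at h2
  have h3 : 0 ≤ ∫ t, h t := integral_nonneg fun t => by rw [hh]; positivity
  refine (mul_le_of_le_one_left (norm_nonneg _) h1).trans (h2.trans ?_)
  simp only [smul_eq_mul]
  rw [show |(2:ℝ)⁻¹| = 1/2 by rw [abs_of_pos (by norm_num)]; norm_num]
  have : 0 ≤ C * (q:ℝ) ^ (1/4 : ℝ) * 2 ^ N * ∫ t, h t := by positivity
  linarith


open ArithmeticFunction.vonMangoldt in
lemma prime_log_sum : ∃ C : ℝ, 0 < C ∧ ∀ σ : ℝ, 1 < σ → σ ≤ 2 →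
    Summable (fun p : Nat.Primes => Real.log (p:ℕ) * ((p:ℕ):ℝ) ^ (-σ)) ∧
    ∑' p : Nat.Primes, Real.log (p:ℕ) * ((p:ℕ):ℝ) ^ (-σ) ≤ C / (σ - 1) := by
  have ha : IsUnit (1 : ZMod 1) := isUnit_one
  have hsm {x : ℝ} (hx : 1 < x) : Summable (fun n : ℕ => residueClass (1 : ZMod 1) n / (n : ℝ) ^ x) := by
    have h1 : LSeriesSummable (fun n => ((residueClass (1 : ZMod 1) n : ℝ) : ℂ)) (x:ℂ) :=
      LSeriesSummable_of_abscissaOfAbsConv_lt_re <|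
      (abscissaOfAbsConv_residueClass_le_one (1 : ZMod 1)).trans_lt <| by norm_cast
    refine h1.norm.congr fun n => ?_
    rcases eq_or_ne n 0 with rfl | hn
    · simp [residueClass_apply_zero]
    · rw [LSeries.term_of_ne_zero hn, norm_div, Complex.norm_real, Real.norm_eq_abs,
        abs_of_nonneg (residueClass_nonneg _ _), ← Complex.ofReal_natCast n, ← Complex.ofReal_cpow n.cast_nonneg, Complex.norm_real, Real.norm_eq_abs, abs_of_nonneg (by positivity)]
  have H {x : ℝ} (hx : 1 < x) :
      ∑' n : ℕ, residueClass (1 : ZMod 1) n / (n : ℝ) ^ x =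
        (LFunctionResidueClassAux (1 : ZMod 1) x).re + (Nat.totient 1 : ℝ)⁻¹ / (x - 1) := by
    refine Complex.ofReal_injective ?_
    simp only [Complex.ofReal_tsum, Complex.ofReal_div, Complex.ofReal_cpow (Nat.cast_nonneg _), Complex.ofReal_natCast,
      Complex.ofReal_add, Complex.ofReal_inv, Complex.ofReal_sub, Complex.ofReal_one]
    simp_rw [← LFunctionResidueClassAux_real ha hx,
      eqOn_LFunctionResidueClassAux ha <| Set.mem_ofPred.mpr (Complex.ofReal_re x ▸ hx), sub_add_cancel,
      LSeries, LSeries.term]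
    refine tsum_congr fun n ↦ ?_
    split_ifs with hn
    · simp only [hn, residueClass_apply_zero, Complex.ofReal_zero, zero_div]
    · rfl
  have hcont : ContinuousOn (fun x : ℝ ↦ (LFunctionResidueClassAux (1 : ZMod 1) x).re) (Set.Icc 1 2) :=
    Complex.continuous_re.continuousOn.comp (t := Set.univ) (continuousOn_LFunctionResidueClassAux (1 : ZMod 1))
      (fun ⦃x⦄ a ↦ trivial) |>.comp Complex.continuous_ofReal.continuousOn fun x hx ↦ by
        simpa only [Set.mem_ofPred_eq, Complex.ofReal_re] using hx.1
  obtain ⟨C, hC⟩ := bddAbove_def.mp <| IsCompact.bddAbove_image isCompact_Icc hcont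
  refine ⟨|C| + 1, by positivity, fun σ h1 h2 => ?_⟩
  have hinj : Function.Injective (fun p : Nat.Primes => (p:ℕ)) := fun a b h => Subtype.ext h
  have hf : (fun p : Nat.Primes => Real.log (p:ℕ) * ((p:ℕ):ℝ) ^ (-σ)) =
      (fun n : ℕ => residueClass (1 : ZMod 1) n / (n : ℝ) ^ σ) ∘ (fun p : Nat.Primes => (p:ℕ)) := by
    funext p
    simp only [Function.comp, residueClass]
    rw [Set.indicator_of_mem (by simp only [Set.mem_ofPred_eq]; exact Subsingleton.elim _ _), ArithmeticFunction.vonMangoldt_apply_prime p.2,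
      Real.rpow_neg (by positivity)]
    rfl
  have hs := hsm h1
  rw [hf]
  refine ⟨hs.comp_injective hinj, ?_⟩
  have h3 : ∑' p : Nat.Primes, ((fun n : ℕ => residueClass (1 : ZMod 1) n / (n : ℝ) ^ σ) ∘ (fun p : Nat.Primes => (p:ℕ))) p
      ≤ ∑' n : ℕ, residueClass (1 : ZMod 1) n / (n : ℝ) ^ σ := by
    refine _root_.tsum_comp_le_tsum_of_inj hs (fun n => div_nonneg (residueClass_nonneg _ _) (by positivity)) hinj
  refine h3.trans ?_
  rw [H h1, le_div_iff₀ (by linarith), add_mul]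
  have h4 : (LFunctionResidueClassAux (1 : ZMod 1) σ).re ≤ C :=
    hC _ (Set.mem_image_of_mem (fun x : ℝ ↦ (LFunctionResidueClassAux (1 : ZMod 1) x).re) ⟨h1.le, h2⟩)
  have h5 : (LFunctionResidueClassAux (1 : ZMod 1) σ).re * (σ - 1) ≤ |C| := by
    calc _ ≤ |C| * (σ - 1) := mul_le_mul_of_nonneg_right (h4.trans (le_abs_self C)) (by linarith)
      _ ≤ |C| * 1 := mul_le_mul_of_nonneg_left (by linarith) (abs_nonneg _)
      _ = _ := mul_one _
  have h6 : (Nat.totient 1 : ℝ)⁻¹ / (σ - 1) * (σ - 1) = 1 := by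
    have : σ - 1 ≠ 0 := by linarith
    simp; field_simp
  linarith

lemma zeta_box : ∃ M : ℝ, 0 < M ∧ ∀ σ u : ℝ, 1 < σ → σ ≤ 2 → |u| ≤ 1 →
    ‖riemannZeta (σ + u * I)‖ ≤ M / ‖(σ + u * I : ℂ) - 1‖ := by
  let G : ℂ → ℂ := Function.update (fun s => (s - 1) * riemannZeta s) 1 1
  have hG : Continuous G := by
    rw [continuous_iff_continuousAt]
    intro s
    by_cases hs : s = 1
    · subst hs
      simpa only [G, continuousAt_update_same] using riemannZeta_residue_one
    · rw [continuousAt_update_of_ne hs]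
      exact (continuousAt_id.sub continuousAt_const).mul (differentiableAt_riemannZeta hs).continuousAt
  have hc : IsCompact ((fun z : ℝ × ℝ => (z.1 + z.2 * I : ℂ)) '' (Set.Icc 1 2 ×ˢ Set.Icc (-1) 1)) :=
    (isCompact_Icc.prod isCompact_Icc).image (by fun_prop)
  obtain ⟨M, hM⟩ := hc.exists_bound_of_continuousOn hG.continuousOn
  refine ⟨|M| + 1, by positivity, fun σ u h1 h2 h3 => ?_⟩
  have hne : (σ + u * I : ℂ) ≠ 1 := by
    intro h
    have := congrArg Complex.re h
    simp at this; linarith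
  have h := hM (σ + u * I) ⟨(σ, u), ⟨⟨h1.le, h2⟩, abs_le.1 h3⟩, rfl⟩
  simp only [G, Function.update_of_ne hne, norm_mul] at h
  rw [le_div_iff₀ (norm_pos_iff.2 (sub_ne_zero.2 hne)), mul_comm]
  linarith [le_abs_self M]

lemma prime_cpow_re (p : ℕ) (hp : p.Prime) (σ u : ℝ) :
    ((p:ℂ) ^ (-(σ + u * I : ℂ))).re = (p:ℝ) ^ (-σ) * Real.cos (u * Real.log p) := by
  have hp0 : (0:ℝ) < p := by exact_mod_cast hp.pos
  have hlr : (Complex.log (p:ℂ)).re = Real.log p := by rw [← Complex.natCast_log, Complex.ofReal_re]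
  have hli : (Complex.log (p:ℂ)).im = 0 := by rw [← Complex.natCast_log, Complex.ofReal_im]
  rw [Complex.cpow_def_of_ne_zero (by exact_mod_cast hp.ne_zero), Complex.exp_re,
    Real.rpow_def_of_pos hp0]
  congr 1
  · simp [hlr, hli]
  · rw [← Real.cos_neg]; simp [hlr, hli]; ring_nf

lemma prime_cos_sum : ∃ C : ℝ, 0 < C ∧ ∀ x u : ℝ, 3 ≤ x → |u| ≤ 1 →
    ∑ p ∈ primesUpTo x, Real.cos (u * Real.log p) / p ≤
      Real.log (Real.log x) - Real.log (1 + |u| * Real.log x) + C := by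
  obtain ⟨C₀, hC₀, h0⟩ := prime_log_sum
  obtain ⟨M, hM, hz⟩ := zeta_box
  have hZs : Summable (fun p : Nat.Primes => ((p:ℕ):ℝ) ^ (-2:ℝ)) := Nat.Primes.summable_rpow.2 (by norm_num)
  obtain ⟨Z, hZ⟩ : ∃ Z, Z = ∑' p : Nat.Primes, ((p:ℕ):ℝ) ^ (-2:ℝ) := ⟨_, rfl⟩
  refine ⟨|Real.log (2 * M)| + |Z| + 2 * C₀, by positivity, fun x u hx hu => ?_⟩
  have hlx : 1 ≤ Real.log x := by
    rw [Real.le_log_iff_exp_le (by linarith)]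
    linarith [Real.exp_one_lt_d9]
  obtain ⟨l, hl⟩ : ∃ l, l = Real.log x := ⟨_, rfl⟩
  rw [← hl] at hlx ⊢
  obtain ⟨σ, hσ⟩ : ∃ σ : ℝ, σ = 1 + 1 / l := ⟨_, rfl⟩
  have hl0 : 0 < 1 / l := by positivity
  have hl1 : 1 / l ≤ 1 := by rw [div_le_one (by linarith)]; exact hlx
  have hσ1 : 1 < σ := by linarith
  have hσ2 : σ ≤ 2 := by linarith
  obtain ⟨hls, hlb⟩ := h0 σ hσ1 hσ2
  have hlb' : 1 / l * ∑' p : Nat.Primes, Real.log (p:ℕ) * ((p:ℕ):ℝ) ^ (-σ) ≤ C₀ := by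
    rw [hσ] at hlb ⊢
    calc _ ≤ 1 / l * (C₀ / (1 + 1 / l - 1)) := mul_le_mul_of_nonneg_left hlb hl0.le
      _ = C₀ := by field_simp; ring
  obtain ⟨s, hs⟩ : ∃ s : ℂ, s = σ + u * I := ⟨_, rfl⟩
  have hsre : s.re = σ := by simp [hs]
  have hznorm (p : Nat.Primes) : ‖((p:ℕ):ℂ) ^ (-s)‖ = ((p:ℕ):ℝ) ^ (-σ) := by
    rw [Complex.norm_natCast_cpow_of_pos p.2.pos]; simp [hsre]
  have hps : Summable (fun p : Nat.Primes => ((p:ℕ):ℝ) ^ (-σ)) := Nat.Primes.summable_rpow.2 (by linarith)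
  have hzs : Summable (fun p : Nat.Primes => ((p:ℕ):ℂ) ^ (-s)) := by
    refine Summable.of_norm ?_
    simpa only [hznorm] using hps
  have hlogs : Summable (fun p : Nat.Primes => -Complex.log (1 - ((p:ℕ):ℂ) ^ (-s))) := by
    have := Complex.summable_log_one_add_of_summable hzs.neg
    simpa [sub_eq_add_neg] using this.neg
  have hpoint (p : Nat.Primes) : (((p:ℕ):ℂ) ^ (-s)).re ≤ (-Complex.log (1 - ((p:ℕ):ℂ) ^ (-s))).re + ((p:ℕ):ℝ) ^ (-2:ℝ) := by
    have hp2 : (2:ℝ) ≤ ((p:ℕ):ℝ) := by exact_mod_cast p.2.two_le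
    have hle : ((p:ℕ):ℝ) ^ (-σ) ≤ ((p:ℕ):ℝ)⁻¹ := by
      rw [← Real.rpow_neg_one]
      exact Real.rpow_le_rpow_of_exponent_le (by linarith) (by linarith)
    have hhalf : ((p:ℕ):ℝ)⁻¹ ≤ 1/2 := by
      rw [inv_le_comm₀ (by linarith) (by norm_num)]; linarith
    have hn : ‖-((p:ℕ):ℂ) ^ (-s)‖ ≤ 1/2 := by rw [norm_neg, hznorm]; linarith
    have h1 := Complex.norm_log_one_add_sub_self_le (z := -((p:ℕ):ℂ) ^ (-s)) (by linarith)
    have h2 : ‖-((p:ℕ):ℂ) ^ (-s)‖ ^ 2 * (1 - ‖-((p:ℕ):ℂ) ^ (-s)‖)⁻¹ / 2 ≤ ((p:ℕ):ℝ) ^ (-2:ℝ) := by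
      have h3 : (1 - ‖-((p:ℕ):ℂ) ^ (-s)‖)⁻¹ ≤ 2 := by
        rw [inv_le_comm₀ (by linarith) (by norm_num)]; linarith
      have h4 : ‖-((p:ℕ):ℂ) ^ (-s)‖ ^ 2 ≤ ((p:ℕ):ℝ) ^ (-2:ℝ) := by
        rw [norm_neg, hznorm, Real.rpow_neg (by positivity) 2, Real.rpow_two, ← inv_pow]
        exact pow_le_pow_left₀ (by positivity) hle 2
      have h5 := mul_le_mul h4 h3 (inv_nonneg.2 (by linarith)) (by positivity)
      linarith
    have h5 := (Complex.abs_re_le_norm _).trans (h1.trans h2)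
    have h6 := (abs_le.1 h5).2
    simp only [Complex.sub_re, Complex.neg_re, ← sub_eq_add_neg] at h6 ⊢
    linarith
  have hre : ∑' p : Nat.Primes, (((p:ℕ):ℂ) ^ (-s)).re ≤ Real.log ‖riemannZeta s‖ + Z := by
    have hsum1 : Summable (fun p : Nat.Primes => (((p:ℕ):ℂ) ^ (-s)).re) := Complex.reCLM.summable hzs
    have hsum2 : Summable (fun p : Nat.Primes => (-Complex.log (1 - ((p:ℕ):ℂ) ^ (-s))).re) := Complex.reCLM.summable hlogs
    have h1 := Summable.tsum_le_tsum hpoint hsum1 (hsum2.add hZs)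
    rw [hsum2.tsum_add hZs, ← hZ] at h1
    have h2 : ∑' p : Nat.Primes, (-Complex.log (1 - ((p:ℕ):ℂ) ^ (-s))).re = Real.log ‖riemannZeta s‖ := by
      rw [← riemannZeta_eulerProduct_exp_log (by rw [hsre]; exact hσ1), Complex.norm_exp, Real.log_exp, Complex.re_tsum hlogs]
    rw [h2] at h1; exact h1
  have hzeta : Real.log ‖riemannZeta s‖ ≤ Real.log l - Real.log (1 + |u| * l) + Real.log (2 * M) := by
    have hne : riemannZeta s ≠ 0 := riemannZeta_ne_zero_of_one_lt_re (by rw [hsre]; exact hσ1)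
    have h1 := hz σ u hσ1 hσ2 hu
    rw [← hs] at h1
    have hu0 : 0 ≤ |u| := abs_nonneg u
    have hd : 0 < 1 + |u| * l := by positivity
    have hnorm : (1 + |u| * l) / (2 * l) ≤ ‖s - 1‖ := by
      have ha := Complex.abs_re_le_norm (s - 1)
      have hb := Complex.abs_im_le_norm (s - 1)
      have ha' : (s - 1).re = 1 / l := by simp [hs, hσ]
      have hb' : (s - 1).im = u := by simp [hs]
      rw [ha', abs_of_pos hl0] at ha
      rw [hb'] at hb
      have : (1 + |u| * l) / (2 * l) = (1 / l + |u|) / 2 := by field_simp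
      rw [this]; linarith
    rw [← Real.log_div (by linarith) hd.ne', ← Real.log_mul (by positivity) (by positivity)]
    refine Real.log_le_log (norm_pos_iff.2 hne) (h1.trans ?_)
    calc M / ‖s - 1‖ ≤ M / ((1 + |u| * l) / (2 * l)) := div_le_div_of_nonneg_left hM.le (by positivity) hnorm
      _ = _ := by field_simp
  -- comparison
  let g : Nat.Primes → ℝ := fun p => (((p:ℕ):ℂ) ^ (-s)).re + 2 * (1 / l * (Real.log (p:ℕ) * ((p:ℕ):ℝ) ^ (-σ)))
  have hg : Summable g := (Complex.reCLM.summable hzs).add ((hls.mul_left (1 / l)).mul_left 2)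
  have hgsum : ∑' p, g p ≤ Real.log ‖riemannZeta s‖ + Z + 2 * C₀ := by
    have h1 : Summable (fun p : Nat.Primes => (((p:ℕ):ℂ) ^ (-s)).re) := Complex.reCLM.summable hzs
    rw [h1.tsum_add ((hls.mul_left (1 / l)).mul_left 2), tsum_mul_left, tsum_mul_left]
    linarith
  have hx0 : 0 ≤ x := by linarith
  have hcosre (p : Nat.Primes) : (((p:ℕ):ℂ) ^ (-s)).re = ((p:ℕ):ℝ) ^ (-σ) * Real.cos (u * Real.log (p:ℕ)) := by
    rw [hs]; exact prime_cpow_re p p.2 σ u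
  obtain ⟨PS, hPS, hPS2⟩ : ∃ PS : Finset Nat.Primes, (∀ p : Nat.Primes, p ∈ PS ↔ ((p:ℕ):ℝ) ≤ x) ∧
      ∑ p ∈ primesUpTo x, Real.cos (u * Real.log p) / p = ∑ p ∈ PS, Real.cos (u * Real.log (p:ℕ)) / ((p:ℕ):ℝ) := by
    refine ⟨(primesUpTo x).subtype Nat.Prime, fun p => ?_, ?_⟩
    · refine Finset.mem_subtype.trans ?_; rw [mem_primesUpTo hx0]; exact ⟨fun h => h.2, fun h => ⟨p.2, h⟩⟩
    · symm
      exact Finset.sum_subtype_of_mem (fun p : ℕ => Real.cos (u * Real.log p) / (p:ℝ)) (fun p hp => ((mem_primesUpTo hx0).1 hp).1)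
  have hmain : ∑ p ∈ PS, Real.cos (u * Real.log (p:ℕ)) / ((p:ℕ):ℝ) ≤ ∑ p ∈ PS, g p := by
    refine Finset.sum_le_sum fun p hp => ?_
    have hpx := (hPS p).1 hp
    have hp2 : (2:ℝ) ≤ ((p:ℕ):ℝ) := by exact_mod_cast p.2.two_le
    have hp0 : (0:ℝ) < ((p:ℕ):ℝ) := by linarith
    have hlp : 0 ≤ Real.log (p:ℕ) := Real.log_nonneg (by linarith)
    have hlpx : Real.log (p:ℕ) ≤ l := by rw [hl]; exact Real.log_le_log hp0 hpx
    have h1 : 1 / ((p:ℕ):ℝ) = ((p:ℕ):ℝ) ^ (-σ) * Real.exp (Real.log (p:ℕ) / l) := by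
      rw [Real.rpow_def_of_pos hp0, ← Real.exp_add, one_div, ← Real.exp_log hp0, ← Real.exp_neg, Real.log_exp, hσ]
      congr 1
      ring
    have h2 : Real.exp (Real.log (p:ℕ) / l) - 1 ≤ 2 * (Real.log (p:ℕ) / l) := by
      have h3 : 0 ≤ Real.log (p:ℕ) / l := by positivity
      have h4 : Real.log (p:ℕ) / l ≤ 1 := by rw [div_le_one (by linarith)]; exact hlpx
      have := Real.abs_exp_sub_one_le (x := Real.log (p:ℕ) / l) (by rw [abs_of_nonneg h3]; exact h4)
      rw [abs_of_nonneg h3] at this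
      exact (le_abs_self _).trans this
    have h5 : 0 ≤ Real.exp (Real.log (p:ℕ) / l) - 1 := by
      have : 0 ≤ Real.log (p:ℕ) / l := by positivity
      linarith [Real.one_le_exp this]
    have hP : 0 < ((p:ℕ):ℝ) ^ (-σ) := by positivity
    simp only [g, hcosre]
    rw [div_eq_mul_one_div, h1]
    have hc := Real.cos_le_one (u * Real.log (p:ℕ))
    have h6 : Real.cos (u * Real.log (p:ℕ)) * (Real.exp (Real.log (p:ℕ) / l) - 1) ≤ 2 * (Real.log (p:ℕ) / l) := by
      nlinarith
    have h7 := mul_le_mul_of_nonneg_left h6 hP.le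
    calc _ = ((p:ℕ):ℝ) ^ (-σ) * Real.cos (u * Real.log (p:ℕ)) + ((p:ℕ):ℝ) ^ (-σ) * (Real.cos (u * Real.log (p:ℕ)) * (Real.exp (Real.log (p:ℕ) / l) - 1)) := by ring
      _ ≤ ((p:ℕ):ℝ) ^ (-σ) * Real.cos (u * Real.log (p:ℕ)) + ((p:ℕ):ℝ) ^ (-σ) * (2 * (Real.log (p:ℕ) / l)) := by linarith
      _ = _ := by ring
  have hmain2 : ∑ p ∈ PS, g p ≤ ∑' p, g p := by
    refine hg.sum_le_tsum PS fun p hp => ?_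
    have hpx : x < ((p:ℕ):ℝ) := by by_contra h; exact hp ((hPS p).2 (not_lt.1 h))
    have hlpx : l ≤ Real.log (p:ℕ) := by rw [hl]; exact Real.log_le_log (by linarith) hpx.le
    have h1 : 1 ≤ Real.log (p:ℕ) / l := by rw [le_div_iff₀ (by linarith)]; linarith
    have hP : 0 < ((p:ℕ):ℝ) ^ (-σ) := by have : (0:ℝ) < ((p:ℕ):ℝ) := by linarith
                                         positivity
    have hc := Real.neg_one_le_cos (u * Real.log (p:ℕ))
    simp only [g, hcosre]
    calc (0:ℝ) ≤ ((p:ℕ):ℝ) ^ (-σ) * (Real.cos (u * Real.log (p:ℕ)) + 2 * (Real.log (p:ℕ) / l)) := mul_nonneg hP.le (by linarith)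
      _ = _ := by ring
  rw [hPS2]
  have := le_abs_self (Real.log (2 * M))
  have := le_abs_self Z
  linarith

/-- `∑_{p ≤ x} log p / p ≤ C log x`. -/
lemma prime_log_div_sum : ∃ C : ℝ, 0 < C ∧ ∀ x : ℝ, 3 ≤ x →
    ∑ p ∈ primesUpTo x, Real.log p / p ≤ C * Real.log x := by
  obtain ⟨C₀, hC₀, h0⟩ := prime_log_sum
  refine ⟨3 * C₀, by positivity, fun x hx => ?_⟩
  have hx0 : 0 ≤ x := by linarith
  have hlx : 1 ≤ Real.log x := by
    rw [Real.le_log_iff_exp_le (by linarith)]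
    linarith [Real.exp_one_lt_d9]
  obtain ⟨l, hl⟩ : ∃ l, l = Real.log x := ⟨_, rfl⟩
  rw [← hl] at hlx ⊢
  have hl0 : 0 < 1 / l := by positivity
  have hl1 : 1 / l ≤ 1 := by rw [div_le_one (by linarith)]; exact hlx
  obtain ⟨hls, hlb⟩ := h0 (1 + 1 / l) (by linarith) (by linarith)
  obtain ⟨PS, hPS, hPS2⟩ : ∃ PS : Finset Nat.Primes, (∀ p : Nat.Primes, p ∈ PS ↔ ((p:ℕ):ℝ) ≤ x) ∧
      ∑ p ∈ primesUpTo x, Real.log p / p = ∑ p ∈ PS, Real.log (p:ℕ) / ((p:ℕ):ℝ) := by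
    refine ⟨(primesUpTo x).subtype Nat.Prime, fun p => ?_, ?_⟩
    · refine Finset.mem_subtype.trans ?_; rw [mem_primesUpTo hx0]; exact ⟨fun h => h.2, fun h => ⟨p.2, h⟩⟩
    · symm
      exact Finset.sum_subtype_of_mem (fun p : ℕ => Real.log p / (p:ℝ)) (fun p hp => ((mem_primesUpTo hx0).1 hp).1)
  rw [hPS2]
  have hnn (p : Nat.Primes) : 0 ≤ Real.log (p:ℕ) * ((p:ℕ):ℝ) ^ (-(1 + 1 / l)) :=
    mul_nonneg (Real.log_natCast_nonneg _) (by positivity)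
  calc _ ≤ ∑ p ∈ PS, 3 * (Real.log (p:ℕ) * ((p:ℕ):ℝ) ^ (-(1 + 1 / l))) := by
        refine Finset.sum_le_sum fun p hp => ?_
        have hpx := (hPS p).1 hp
        have hp0 : (0:ℝ) < ((p:ℕ):ℝ) := by exact_mod_cast p.2.pos
        have hlp : 0 ≤ Real.log (p:ℕ) := Real.log_natCast_nonneg _
        have hlpx : Real.log (p:ℕ) ≤ l := by rw [hl]; exact Real.log_le_log hp0 hpx
        have h1 : 1 / ((p:ℕ):ℝ) = ((p:ℕ):ℝ) ^ (-(1 + 1 / l)) * Real.exp (Real.log (p:ℕ) / l) := by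
          rw [Real.rpow_def_of_pos hp0, ← Real.exp_add, one_div, ← Real.exp_log hp0, ← Real.exp_neg, Real.log_exp]
          congr 1
          ring
        have h2 : Real.exp (Real.log (p:ℕ) / l) ≤ 3 := by
          have h4 : Real.log (p:ℕ) / l ≤ 1 := by rw [div_le_one (by linarith)]; exact hlpx
          have := Real.exp_le_exp.2 h4
          linarith [Real.exp_one_lt_d9]
        rw [div_eq_mul_one_div, h1]
        have h3 := mul_le_mul_of_nonneg_left h2 (hnn p)
        linarith
    _ ≤ 3 * ∑' p : Nat.Primes, Real.log (p:ℕ) * ((p:ℕ):ℝ) ^ (-(1 + 1 / l)) := by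
        rw [← Finset.mul_sum]
        exact mul_le_mul_of_nonneg_left (hls.sum_le_tsum PS fun p _ => hnn p) (by norm_num)
    _ ≤ 3 * (C₀ / (1 + 1 / l - 1)) := mul_le_mul_of_nonneg_left hlb (by norm_num)
    _ = _ := by field_simp; ring


/-- coefficientwise majorization of Dirichlet polynomials -/
def Maj {𝕜 : Type*} [NormedField 𝕜] (A : MonoidAlgebra 𝕜 ℕ) (B : MonoidAlgebra ℝ ℕ) : Prop :=
  ∀ n, ‖A.coeff n‖ ≤ B.coeff n

/-- sum of squares of the coefficients -/
noncomputable def nsq {𝕜 : Type*} [NormedField 𝕜] (A : MonoidAlgebra 𝕜 ℕ) : ℝ :=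
  ∑ n ∈ A.coeff.support, ‖A.coeff n‖ ^ 2

namespace Maj

variable {𝕜 : Type*} [NormedField 𝕜] {A A' : MonoidAlgebra 𝕜 ℕ} {B B' : MonoidAlgebra ℝ ℕ}

lemma nonneg (h : Maj A B) (n : ℕ) : 0 ≤ B.coeff n := (norm_nonneg _).trans (h n)

lemma supp (h : Maj A B) : A.coeff.support ⊆ B.coeff.support := by
  intro n hn
  rw [Finsupp.mem_support_iff] at hn ⊢
  intro h0
  have := h n
  rw [h0] at this
  exact hn (norm_le_zero_iff.1 this)

lemma trans (h : Maj A B) (h' : Maj B B') : Maj A B' := fun n =>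
  (h n).trans ((le_abs_self _).trans (h' n))

lemma refl (h : ∀ n, 0 ≤ B.coeff n) : Maj B B := fun n => by rw [Real.norm_of_nonneg (h n)]

lemma zero : Maj (0 : MonoidAlgebra 𝕜 ℕ) 0 := fun n => by simp

lemma single (n : ℕ) {c : 𝕜} {d : ℝ} (h : ‖c‖ ≤ d) :
    Maj (MonoidAlgebra.single n c) (MonoidAlgebra.single n d) := fun m => by
  classical
  rw [MonoidAlgebra.coeff_single_apply, MonoidAlgebra.coeff_single_apply]
  split_ifs <;> simp [h]

lemma one : Maj (1 : MonoidAlgebra 𝕜 ℕ) 1 := by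
  rw [MonoidAlgebra.one_def, MonoidAlgebra.one_def]
  exact single 1 (by simp)

lemma add (h : Maj A B) (h' : Maj A' B') : Maj (A + A') (B + B') := fun n => by
  simp only [MonoidAlgebra.coeff_add, Finsupp.add_apply]
  exact (norm_add_le _ _).trans (add_le_add (h n) (h' n))

lemma sum {ι : Type*} (s : Finset ι) {f : ι → MonoidAlgebra 𝕜 ℕ} {g : ι → MonoidAlgebra ℝ ℕ}
    (h : ∀ i ∈ s, Maj (f i) (g i)) : Maj (∑ i ∈ s, f i) (∑ i ∈ s, g i) := by
  classical
  induction s using Finset.induction_on with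
  | empty => simpa using zero
  | insert a s ha ih =>
    rw [Finset.sum_insert ha, Finset.sum_insert ha]
    exact (h a (Finset.mem_insert_self _ _)).add (ih fun i hi => h i (Finset.mem_insert_of_mem hi))

lemma mul (h : Maj A B) (h' : Maj A' B') : Maj (A * A') (B * B') := fun n => by
  classical
  rw [MonoidAlgebra.coeff_mul, MonoidAlgebra.coeff_mul]
  rw [Finsupp.sum_of_support_subset _ h.supp _ (by intro i _; simp)]
  have h1 : ∀ a : ℕ, (A'.coeff.sum fun m₂ r₂ => if a * m₂ = n then A.coeff a * r₂ else 0) =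
      ∑ b ∈ B'.coeff.support, if a * b = n then A.coeff a * A'.coeff b else 0 := fun a =>
    Finsupp.sum_of_support_subset _ h'.supp _ (by intro i _; simp)
  simp only [h1]
  simp only [Finsupp.sum]
  refine (norm_sum_le _ _).trans (Finset.sum_le_sum fun a _ => ?_)
  refine (norm_sum_le _ _).trans (Finset.sum_le_sum fun b _ => ?_)
  split_ifs
  · rw [norm_mul]; exact mul_le_mul (h a) (h' b) (norm_nonneg _) (h.nonneg a)
  · simp

lemma pow (h : Maj A B) (k : ℕ) : Maj (A ^ k) (B ^ k) := by
  induction k with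
  | zero => simpa using one
  | succ k ih => rw [pow_succ, pow_succ]; exact ih.mul h

lemma prod {ι : Type*} (s : Finset ι) {f : ι → MonoidAlgebra 𝕜 ℕ} {g : ι → MonoidAlgebra ℝ ℕ}
    (h : ∀ i ∈ s, Maj (f i) (g i)) : Maj (∏ i ∈ s, f i) (∏ i ∈ s, g i) := by
  classical
  induction s using Finset.induction_on with
  | empty => simpa using one
  | insert a s ha ih =>
    rw [Finset.prod_insert ha, Finset.prod_insert ha]
    exact (h a (Finset.mem_insert_self _ _)).mul (ih fun i hi => h i (Finset.mem_insert_of_mem hi))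

lemma smul (h : Maj A B) {c : 𝕜} {d : ℝ} (hc : ‖c‖ ≤ d) : Maj (c • A) (d • B) := fun n => by
  rw [MonoidAlgebra.coeff_smul_apply, MonoidAlgebra.coeff_smul_apply, smul_eq_mul, smul_eq_mul, norm_mul]
  exact mul_le_mul hc (h n) (norm_nonneg _) ((norm_nonneg _).trans hc)

lemma nsq_le (h : Maj A B) : nsq A ≤ nsq B := by
  unfold nsq
  calc _ ≤ ∑ n ∈ A.coeff.support, ‖B.coeff n‖ ^ 2 := by
        refine Finset.sum_le_sum fun n _ => ?_
        exact pow_le_pow_left₀ (norm_nonneg _) ((h n).trans (le_abs_self _)) 2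
    _ ≤ _ := Finset.sum_le_sum_of_subset_of_nonneg h.supp fun _ _ _ => by positivity

end Maj

lemma nsq_eq_of_subset {𝕜 : Type*} [NormedField 𝕜] (A : MonoidAlgebra 𝕜 ℕ) (s : Finset ℕ) (h : A.coeff.support ⊆ s) :
    nsq A = ∑ n ∈ s, ‖A.coeff n‖ ^ 2 := by
  unfold nsq
  refine Finset.sum_subset h fun n _ hn => ?_
  rw [Finsupp.notMem_support_iff] at hn
  simp [hn]

lemma nsq_nonneg {𝕜 : Type*} [NormedField 𝕜] (A : MonoidAlgebra 𝕜 ℕ) : 0 ≤ nsq A :=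
  Finset.sum_nonneg fun _ _ => by positivity

lemma nsq_one : nsq (1 : MonoidAlgebra ℝ ℕ) = 1 := by
  rw [nsq_eq_of_subset _ {1}]
  · simp [MonoidAlgebra.coeff_one_one]
  · rw [MonoidAlgebra.one_def, MonoidAlgebra.coeff_single]
    exact Finsupp.support_single_subset

lemma nsq_smul (c : ℝ) (A : MonoidAlgebra ℝ ℕ) : nsq (c • A) = c ^ 2 * nsq A := by
  rw [nsq_eq_of_subset (c • A) A.coeff.support (by rw [MonoidAlgebra.coeff_smul]; exact Finsupp.support_smul), nsq, Finset.mul_sum]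
  refine Finset.sum_congr rfl fun n _ => ?_
  rw [MonoidAlgebra.coeff_smul_apply, smul_eq_mul, norm_mul, mul_pow, Real.norm_eq_abs, sq_abs]

/-- support of products -/
lemma mem_support_mul' {𝕜 : Type*} [NormedField 𝕜] {A B : MonoidAlgebra 𝕜 ℕ} {n : ℕ} (h : n ∈ (A * B).coeff.support) :
    ∃ a ∈ A.coeff.support, ∃ b ∈ B.coeff.support, a * b = n := by
  classical
  rw [Finsupp.mem_support_iff, MonoidAlgebra.coeff_mul] at h
  obtain ⟨a, ha, h⟩ := Finset.exists_ne_zero_of_sum_ne_zero h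
  obtain ⟨b, hb, h⟩ := Finset.exists_ne_zero_of_sum_ne_zero h
  refine ⟨a, ha, b, hb, ?_⟩
  by_contra hne
  simp [hne] at h

lemma nsq_mul_of_coprime (A B : MonoidAlgebra ℝ ℕ)
    (h : ∀ a ∈ A.coeff.support, ∀ b ∈ B.coeff.support, a.Coprime b) :
    nsq (A * B) = nsq A * nsq B := by
  classical
  have hinj : ∀ a ∈ A.coeff.support, ∀ b ∈ B.coeff.support, ∀ a' ∈ A.coeff.support, ∀ b' ∈ B.coeff.support,
      a * b = a' * b' → a = a' ∧ b = b' := by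
    intro a ha b hb a' ha' b' hb' he
    have h1 : a ∣ a' := (h a ha b' hb').dvd_of_dvd_mul_right (he ▸ dvd_mul_right a b)
    have h2 : a' ∣ a := (h a' ha' b hb).dvd_of_dvd_mul_right (he ▸ dvd_mul_right a' b')
    have h3 : b ∣ b' := (h a' ha' b hb).symm.dvd_of_dvd_mul_left (he ▸ dvd_mul_left b a)
    have h4 : b' ∣ b := (h a ha b' hb').symm.dvd_of_dvd_mul_left (he ▸ dvd_mul_left b' a')
    exact ⟨Nat.dvd_antisymm h1 h2, Nat.dvd_antisymm h3 h4⟩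
  have hsub : (A * B).coeff.support ⊆ (A.coeff.support ×ˢ B.coeff.support).image (fun x => x.1 * x.2) := by
    intro n hn
    obtain ⟨a, ha, b, hb, he⟩ := mem_support_mul' hn
    exact Finset.mem_image.2 ⟨(a, b), Finset.mem_product.2 ⟨ha, hb⟩, he⟩
  rw [nsq_eq_of_subset _ _ hsub, Finset.sum_image]
  · rw [Finset.sum_product]
    unfold nsq
    rw [Finset.sum_mul_sum]
    refine Finset.sum_congr rfl fun a ha => Finset.sum_congr rfl fun b hb => ?_
    rw [← mul_pow, ← norm_mul]
    congr 2
    rw [MonoidAlgebra.coeff_mul]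
    simp only [Finsupp.sum]
    rw [Finset.sum_eq_single a, Finset.sum_eq_single b]
    · simp
    · intro b' hb' hne
      rw [if_neg]
      intro he
      exact hne (hinj a ha b' hb' a ha b hb he).2
    · intro hb'; exact absurd hb hb'
    · intro a' ha' hne
      refine Finset.sum_eq_zero fun b' hb' => ?_
      rw [if_neg]
      intro he
      exact hne (hinj a' ha' b' hb' a ha b hb he).1
    · intro ha'; exact absurd ha ha'
  · rintro ⟨a, b⟩ hx ⟨a', b'⟩ hy he
    simp only [Finset.coe_product, Set.mem_prod, Finset.mem_coe] at hx hy
    obtain ⟨h1, h2⟩ := hinj a hx.1 b hx.2 a' hy.1 b' hy.2 he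
    rw [h1, h2]


/-- evaluation of a Dirichlet polynomial at a character -/
noncomputable def evc {q : ℕ} (χ : DirichletCharacter ℂ q) : MonoidAlgebra ℂ ℕ →ₐ[ℂ] ℂ :=
  MonoidAlgebra.lift ℂ ℂ ℕ (χ.toMonoidHom.comp (Nat.castRingHom (ZMod q)).toMonoidHom)

lemma evc_single {q : ℕ} (χ : DirichletCharacter ℂ q) (n : ℕ) (c : ℂ) :
    evc χ (MonoidAlgebra.single n c) = c * χ n := by
  unfold evc
  rw [MonoidAlgebra.lift_single]; rfl

lemma evc_apply {q : ℕ} (χ : DirichletCharacter ℂ q) (A : MonoidAlgebra ℂ ℕ) :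
    evc χ A = ∑ n ∈ A.coeff.support, A.coeff n * χ n := by
  unfold evc
  rw [MonoidAlgebra.lift_apply]; rfl

lemma mean_value {q : ℕ} [NeZero q] (A : MonoidAlgebra ℂ ℕ)
    (h : ∀ n ∈ A.coeff.support, n < q) :
    ∑ χ : DirichletCharacter ℂ q, ‖evc χ A‖ ^ 2 ≤ Nat.totient q * nsq A := by
  classical
  have key : ∀ m ∈ A.coeff.support, ∀ n ∈ A.coeff.support,
      ∑ χ : DirichletCharacter ℂ q, starRingEnd ℂ (χ m) * χ n =
        if m = n then (if IsUnit (m : ZMod q) then (Nat.totient q : ℂ) else 0) else 0 := by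
    intro m hm n hn
    by_cases hu : IsUnit (m : ZMod q)
    · have h1 : ∀ χ : DirichletCharacter ℂ q, starRingEnd ℂ (χ m) * χ n = χ (m : ZMod q)⁻¹ * χ n := by
        intro χ
        congr 1
        have h2 : starRingEnd ℂ (χ m) = χ⁻¹ m := by
          rw [← MulChar.star_eq_inv, MulChar.star_apply, starRingEnd_apply]
        rw [h2, MulChar.inv_apply]
        obtain ⟨w, hw⟩ := hu
        rw [← hw, Ring.inverse_unit, ZMod.inv_coe_unit]
      simp only [h1]
      rw [DirichletCharacter.sum_char_inv_mul_char_eq ℂ hu]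
      have h3 : ((m : ZMod q) = (n : ZMod q)) ↔ m = n := by
        constructor
        · intro h4
          rw [ZMod.natCast_eq_natCast_iff'] at h4
          rwa [Nat.mod_eq_of_lt (h m hm), Nat.mod_eq_of_lt (h n hn)] at h4
        · rintro rfl; rfl
      simp [h3, hu]
    · have h1 : ∀ χ : DirichletCharacter ℂ q, χ m = 0 := fun χ => χ.map_nonunit hu
      simp [h1, hu]
  have hC : ((∑ χ : DirichletCharacter ℂ q, ‖evc χ A‖ ^ 2 : ℝ) : ℂ) =
      ∑ m ∈ A.coeff.support, (if IsUnit (m : ZMod q) then (Nat.totient q : ℂ) else 0) * ((‖A.coeff m‖ ^ 2 : ℝ) : ℂ) := by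
    push_cast
    have h1 : ∀ χ : DirichletCharacter ℂ q, ((‖evc χ A‖ : ℂ)) ^ 2 =
        ∑ m ∈ A.coeff.support, ∑ n ∈ A.coeff.support, (starRingEnd ℂ (A.coeff m) * A.coeff n) * (starRingEnd ℂ (χ m) * χ n) := by
      intro χ
      rw [← Complex.conj_mul', evc_apply, map_sum, Finset.sum_mul_sum]
      refine Finset.sum_congr rfl fun m _ => Finset.sum_congr rfl fun n _ => ?_
      rw [map_mul]; ring
    simp only [h1]
    rw [Finset.sum_comm]
    refine Finset.sum_congr rfl fun m hm => ?_
    rw [Finset.sum_comm]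
    simp only [← Finset.mul_sum]
    rw [Finset.sum_congr rfl fun n hn => by rw [key m hm n hn]]
    simp only [mul_ite, mul_zero, Finset.sum_ite_eq, if_pos hm, ite_mul, zero_mul]
    rw [Complex.conj_mul', mul_comm]
  have hR : ∑ χ : DirichletCharacter ℂ q, ‖evc χ A‖ ^ 2 =
      ∑ m ∈ A.coeff.support, (if IsUnit (m : ZMod q) then (Nat.totient q : ℝ) else 0) * ‖A.coeff m‖ ^ 2 := by
    apply Complex.ofReal_injective
    rw [hC, Complex.ofReal_sum]
    refine Finset.sum_congr rfl fun m _ => ?_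
    split_ifs <;> simp
  rw [hR, nsq, Finset.mul_sum]
  refine Finset.sum_le_sum fun m _ => ?_
  refine mul_le_mul_of_nonneg_right ?_ (by positivity)
  split_ifs
  · exact le_rfl
  · positivity

/-- truncated exponential -/
noncomputable def tex (𝕜 : Type*) {R : Type*} [Field 𝕜] [CommRing R] [Module 𝕜 R] (n : ℕ) (z : R) : R :=
  ∑ k ∈ Finset.range n, ((k.factorial : 𝕜)⁻¹) • z ^ k

lemma evc_tex {q : ℕ} (χ : DirichletCharacter ℂ q) (n : ℕ) (A : MonoidAlgebra ℂ ℕ) :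
    evc χ (tex ℂ n A) = tex ℂ n (evc χ A) := by
  simp only [tex, map_sum, map_smul, map_pow]

lemma Maj.tex' {A : MonoidAlgebra ℂ ℕ} {B : MonoidAlgebra ℝ ℕ} (h : Maj A B) (n : ℕ) :
    Maj (tex ℂ n A) (tex ℝ n B) :=
  Maj.sum _ fun k _ => (h.pow k).smul (by simp)

lemma Maj.texr {B : MonoidAlgebra ℝ ℕ} (h : Maj B B) (n : ℕ) :
    Maj (tex ℝ n B) (tex ℝ n B) :=
  Maj.sum _ fun k _ => (h.pow k).smul (by simp)

lemma Maj.sum_subset {ι : Type*} {s t : Finset ι} {f : ι → MonoidAlgebra ℝ ℕ} (hst : s ⊆ t)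
    (h : ∀ i ∈ t, Maj (f i) (f i)) : Maj (∑ i ∈ s, f i) (∑ i ∈ t, f i) := by
  classical
  have h1 := Maj.sum s fun i hi => h i (hst hi)
  have h2 := Maj.sum (t \ s) fun i hi => h i (Finset.sdiff_subset hi)
  rw [← Finset.sum_sdiff hst]
  intro n
  have := h1 n
  have := h2.nonneg n
  rw [MonoidAlgebra.coeff_add, Finsupp.add_apply]
  linarith

lemma tex_add {A B : MonoidAlgebra ℝ ℕ} (hA : Maj A A) (hB : Maj B B) (n : ℕ) :
    Maj (tex ℝ n (A + B)) (tex ℝ n A * tex ℝ n B) := by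
  classical
  let f : ℕ × ℕ → MonoidAlgebra ℝ ℕ := fun x => ((x.1.factorial : ℝ)⁻¹ • A ^ x.1) * ((x.2.factorial : ℝ)⁻¹ • B ^ x.2)
  have h1 : tex ℝ n A * tex ℝ n B = ∑ x ∈ Finset.range n ×ˢ Finset.range n, f x := by
    rw [Finset.sum_product]
    simp only [tex, f]
    rw [Finset.sum_mul_sum]
  have h2 : tex ℝ n (A + B) = ∑ x ∈ (Finset.range n ×ˢ Finset.range n).filter (fun x => x.1 + x.2 < n), f x := by
    rw [← Finset.sum_fiberwise_of_maps_to (s := (Finset.range n ×ˢ Finset.range n).filter (fun x => x.1 + x.2 < n)) (t := Finset.range n) (g := fun x => x.1 + x.2)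
      (by intro x hx; rw [Finset.mem_filter] at hx; exact Finset.mem_range.2 hx.2)]
    unfold tex
    refine Finset.sum_congr rfl fun m hm => ?_
    rw [Finset.mem_range] at hm
    have h3 : ((Finset.range n ×ˢ Finset.range n).filter (fun x => x.1 + x.2 < n)).filter (fun x => x.1 + x.2 = m) = Finset.HasAntidiagonal.antidiagonal m := by
      ext ⟨k, l⟩
      simp only [Finset.mem_filter, Finset.mem_product, Finset.mem_range, Finset.HasAntidiagonal.mem_antidiagonal]
      omega
    rw [h3, (Commute.all A B).add_pow', Finset.smul_sum]
    refine Finset.sum_congr rfl fun x hx => ?_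
    rw [Finset.HasAntidiagonal.mem_antidiagonal] at hx
    simp only [f]
    rw [smul_mul_smul_comm, ← Nat.cast_smul_eq_nsmul ℝ, smul_smul]
    congr 1
    have h4 : (m.factorial : ℝ) = (m.choose x.1 : ℝ) * x.1.factorial * x.2.factorial := by
      have := Nat.add_choose_mul_factorial_mul_factorial x.1 x.2
      rw [hx, ← Nat.choose_symm_of_eq_add hx.symm] at this
      exact_mod_cast this.symm
    have h5 : (m.choose x.1 : ℝ) ≠ 0 := by
      have : 0 < m.choose x.1 := Nat.choose_pos (by omega)
      positivity
    rw [h4]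
    field_simp
  rw [h1, h2]
  refine Maj.sum_subset (Finset.filter_subset _ _) fun x _ => ?_
  exact ((hA.pow _).smul (by simp)).mul ((hB.pow _).smul (by simp))

lemma tex_zero {n : ℕ} (hn : 1 ≤ n) : tex ℝ n (0 : MonoidAlgebra ℝ ℕ) = 1 := by
  unfold tex
  rw [Finset.sum_eq_single 0]
  · simp
  · intro b _ hb; simp [hb]
  · intro h; simp at h; omega

lemma tex_sum {n : ℕ} (hn : 1 ≤ n) (S : Finset ℕ) (f : ℕ → MonoidAlgebra ℝ ℕ) (h : ∀ p ∈ S, Maj (f p) (f p)) :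
    Maj (tex ℝ n (∑ p ∈ S, f p)) (∏ p ∈ S, tex ℝ n (f p)) := by
  classical
  induction S using Finset.induction_on with
  | empty => simp only [Finset.sum_empty, Finset.prod_empty, tex_zero hn]; exact Maj.one
  | insert a S ha ih =>
    rw [Finset.sum_insert ha, Finset.prod_insert ha]
    have h1 := h a (Finset.mem_insert_self _ _)
    have h2 : ∀ p ∈ S, Maj (f p) (f p) := fun p hp => h p (Finset.mem_insert_of_mem hp)
    exact (tex_add h1 (Maj.sum S h2) n).trans ((h1.texr n).mul (ih h2))

/-- support conditions -/
def SL {𝕜 : Type*} [NormedField 𝕜] (S : Finset ℕ) (L : ℝ) (B : MonoidAlgebra 𝕜 ℕ) : Prop :=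
  ∀ m ∈ B.coeff.support, m ≠ 0 ∧ m.primeFactors ⊆ S ∧ (m : ℝ) ≤ L

namespace SL
variable {𝕜 : Type*} [NormedField 𝕜] {S S' : Finset ℕ} {L L' : ℝ} {A B : MonoidAlgebra 𝕜 ℕ}

lemma mono (h : SL S L B) (hS : S ⊆ S') (hL : L ≤ L') : SL S' L' B := fun m hm =>
  ⟨(h m hm).1, (h m hm).2.1.trans hS, (h m hm).2.2.trans hL⟩

lemma single {n : ℕ} (c : 𝕜) (h0 : n ≠ 0) (h1 : n.primeFactors ⊆ S) (h2 : (n:ℝ) ≤ L) :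
    SL S L (MonoidAlgebra.single n c) := fun m hm => by
  rw [MonoidAlgebra.coeff_single] at hm
  have := Finsupp.support_single_subset hm
  rw [Finset.mem_singleton] at this
  subst this
  exact ⟨h0, h1, h2⟩

lemma one (hL : 1 ≤ L) : SL S L (1 : MonoidAlgebra 𝕜 ℕ) := by
  rw [MonoidAlgebra.one_def]
  exact single 1 one_ne_zero (by simp) (by simpa using hL)

lemma add (hA : SL S L A) (hB : SL S L B) : SL S L (A + B) := fun m hm => by
  classical
  rw [MonoidAlgebra.coeff_add] at hm
  rcases Finset.mem_union.1 (Finsupp.support_add hm) with h | h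
  · exact hA m h
  · exact hB m h

lemma sum {ι : Type*} (s : Finset ι) {f : ι → MonoidAlgebra 𝕜 ℕ} (h : ∀ i ∈ s, SL S L (f i)) :
    SL S L (∑ i ∈ s, f i) := by
  classical
  induction s using Finset.induction_on with
  | empty => intro m hm; simp at hm
  | insert a s ha ih =>
    rw [Finset.sum_insert ha]
    exact (h a (Finset.mem_insert_self _ _)).add (ih fun i hi => h i (Finset.mem_insert_of_mem hi))

lemma smul (c : 𝕜) (h : SL S L A) : SL S L (c • A) := fun m hm => by
  rw [MonoidAlgebra.coeff_smul] at hm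
  exact h m (Finsupp.support_smul hm)

lemma mul (hA : SL S L A) (hB : SL S' L' B) : SL (S ∪ S') (L * L') (A * B) := fun m hm => by
  obtain ⟨a, ha, b, hb, rfl⟩ := mem_support_mul' hm
  obtain ⟨a0, a1, a2⟩ := hA a ha
  obtain ⟨b0, b1, b2⟩ := hB b hb
  refine ⟨mul_ne_zero a0 b0, ?_, ?_⟩
  · rw [Nat.primeFactors_mul a0 b0]
    exact Finset.union_subset_union a1 b1
  · push_cast
    exact mul_le_mul a2 b2 (by positivity) ((Nat.cast_nonneg _).trans a2)

lemma pow (hA : SL S L A) (k : ℕ) : SL S (L ^ k) (A ^ k) := by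
  induction k with
  | zero => simpa using one le_rfl
  | succ k ih =>
    rw [pow_succ, pow_succ]
    have := ih.mul hA
    rwa [Finset.union_self] at this

lemma tex' (hA : SL S L A) (hL : 1 ≤ L) (n : ℕ) : SL S (L ^ n) (tex 𝕜 n A) :=
  sum _ fun k hk => ((hA.pow k).mono subset_rfl (pow_le_pow_right₀ hL (Finset.mem_range.1 hk).le)).smul _

lemma coprime (hA : SL S L A) (hB : SL S' L' B) (hd : Disjoint S S') :
    ∀ a ∈ A.coeff.support, ∀ b ∈ B.coeff.support, a.Coprime b := by
  intro a ha b hb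
  rw [← Nat.disjoint_primeFactors (hA a ha).1 (hB b hb).1]
  exact Finset.disjoint_of_subset_left (hA a ha).2.1 (Finset.disjoint_of_subset_right (hB b hb).2.1 hd)

end SL


/-- total mass as an algebra hom -/
noncomputable def mass : MonoidAlgebra ℝ ℕ →ₐ[ℝ] ℝ := MonoidAlgebra.lift ℝ ℝ ℕ 1

lemma mass_single (n : ℕ) (c : ℝ) : mass (MonoidAlgebra.single n c) = c := by
  unfold mass; rw [MonoidAlgebra.lift_single]; simp

lemma mass_apply (A : MonoidAlgebra ℝ ℕ) : mass A = ∑ n ∈ A.coeff.support, A.coeff n := by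
  unfold mass; rw [MonoidAlgebra.lift_apply]; simp [Finsupp.sum]

lemma mass_tex (n : ℕ) (A : MonoidAlgebra ℝ ℕ) : mass (tex ℝ n A) = tex ℝ n (mass A) := by
  simp only [tex, map_sum, map_smul, map_pow]

lemma nsq_le_mass {A : MonoidAlgebra ℝ ℕ} (hA : Maj A A) {p : ℕ} (hp : p ≠ 1) :
    nsq A ≤ A.coeff 1 ^ 2 + A.coeff p ^ 2 + (mass A - A.coeff 1 - A.coeff p) ^ 2 := by
  classical
  have hn := fun n => hA.nonneg n
  let T := A.coeff.support ∪ {1, p}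
  have h1 : mass A = ∑ n ∈ T, A.coeff n := by
    rw [mass_apply]
    refine Finset.sum_subset Finset.subset_union_left fun n _ h => Finsupp.notMem_support_iff.1 h
  have hsub : ({1, p} : Finset ℕ) ⊆ T := Finset.subset_union_right
  rw [nsq_eq_of_subset A T Finset.subset_union_left, h1, ← Finset.sum_sdiff hsub, ← Finset.sum_sdiff hsub, Finset.sum_pair hp.symm, Finset.sum_pair hp.symm]
  have h2 : ∑ n ∈ T \ {1, p}, ‖A.coeff n‖ ^ 2 ≤ (∑ n ∈ T \ {1, p}, A.coeff n) ^ 2 := by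
    calc _ = ∑ n ∈ T \ {1, p}, (A.coeff n) ^ 2 := by simp
      _ ≤ _ := Finset.sum_sq_le_sq_sum_of_nonneg fun n _ => hn n
  simp only [Real.norm_eq_abs, sq_abs] at h2 ⊢
  have h3 : ∑ n ∈ T \ {1, p}, A.coeff n + (A.coeff 1 + A.coeff p) - A.coeff 1 - A.coeff p = ∑ n ∈ T \ {1, p}, A.coeff n := by ring
  rw [h3]; linarith

lemma coeff_tex_prime {p : ℕ} (hp : p.Prime) {n : ℕ} (hn : 2 ≤ n) (u v : ℝ) :
    (tex ℝ n (MonoidAlgebra.single p u + MonoidAlgebra.single (p^2) v)).coeff 1 = 1 ∧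
    (tex ℝ n (MonoidAlgebra.single p u + MonoidAlgebra.single (p^2) v)).coeff p = u := by
  classical
  obtain ⟨z, hz⟩ : ∃ z : MonoidAlgebra ℝ ℕ, z = MonoidAlgebra.single p u + MonoidAlgebra.single (p^2) v := ⟨_, rfl⟩
  rw [← hz]
  obtain ⟨w, hw⟩ : ∃ w, z = MonoidAlgebra.single p 1 * w := by
    refine ⟨MonoidAlgebra.single 1 u + MonoidAlgebra.single p v, ?_⟩
    rw [hz, mul_add, MonoidAlgebra.single_mul_single, MonoidAlgebra.single_mul_single]; simp [pow_two]
  obtain ⟨ρ, hρ⟩ : ∃ ρ, tex ℝ n z = 1 + MonoidAlgebra.single p u + MonoidAlgebra.single (p^2) 1 * ρ := by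
    obtain ⟨m, rfl⟩ : ∃ m, n = m + 2 := ⟨n - 2, by omega⟩
    refine ⟨MonoidAlgebra.single 1 v + ∑ k ∈ Finset.range m, (((k+2).factorial : ℝ)⁻¹) • (z ^ k * w ^ 2), ?_⟩
    unfold tex
    rw [Finset.sum_range_succ', Finset.sum_range_succ', mul_add, Finset.mul_sum, MonoidAlgebra.single_mul_single]
    have h1 : ∀ k : ℕ, z ^ (k + 2) = MonoidAlgebra.single (p^2) 1 * (z ^ k * w ^ 2) := by
      intro k
      have : MonoidAlgebra.single (p^2) (1:ℝ) = MonoidAlgebra.single p 1 ^ 2 := by rw [MonoidAlgebra.single_pow]; simp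
      rw [this, pow_add]
      nth_rewrite 2 [hw]
      ring
    have h2 : ∑ k ∈ Finset.range m, (((k + 1 + 1).factorial : ℝ)⁻¹) • z ^ (k + 1 + 1) = ∑ k ∈ Finset.range m, MonoidAlgebra.single (p^2) (1:ℝ) * ((((k+2).factorial : ℝ)⁻¹) • (z ^ k * w ^ 2)) := by
      refine Finset.sum_congr rfl fun k _ => ?_
      rw [show k + 1 + 1 = k + 2 from rfl, h1, mul_smul_comm]
    rw [h2]
    simp [hz]
    ring
  have hp1 : p ≠ 1 := hp.one_lt.ne'
  have h0 : (MonoidAlgebra.single (p^2) (1:ℝ) * ρ).coeff 1 = 0 :=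
    MonoidAlgebra.coeff_single_mul_of_forall_mul_ne _ _ fun d h => by
      have := Nat.eq_one_of_mul_eq_one_right h
      exact hp1 (by nlinarith [hp.two_le])
  have h0' : (MonoidAlgebra.single (p^2) (1:ℝ) * ρ).coeff p = 0 :=
    MonoidAlgebra.coeff_single_mul_of_forall_mul_ne _ _ fun d h => by
      have h3 : p * d = 1 := by
        have : p * (p * d) = p * 1 := by rw [mul_one, ← mul_assoc, ← pow_two]; exact h
        exact Nat.eq_of_mul_eq_mul_left hp.pos this
      exact hp1 (Nat.eq_one_of_mul_eq_one_right h3)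
  rw [hρ]
  simp only [MonoidAlgebra.coeff_add, Finsupp.add_apply, h0, h0', MonoidAlgebra.one_def, MonoidAlgebra.coeff_single, Finsupp.single_apply]
  constructor
  · simp [hp1]
  · simp [hp1.symm]

lemma tex_le_exp (n : ℕ) {x : ℝ} (hx : 0 ≤ x) : tex ℝ n x ≤ Real.exp x := by
  unfold tex
  refine le_trans (le_of_eq ?_) (Real.sum_le_exp_of_nonneg hx n)
  refine Finset.sum_congr rfl fun k _ => ?_
  rw [smul_eq_mul]; ring

lemma exp_quad {x U : ℝ} (h0 : 0 ≤ x) (hU : x ≤ U) : Real.exp x - 1 - x ≤ x ^ 2 * Real.exp U := by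
  have h1 := Real.one_sub_le_exp_neg x
  have h2 : 0 ≤ x ^ 2 := sq_nonneg x
  have h3 : Real.exp x ≤ Real.exp U := Real.exp_le_exp.2 hU
  have h4 : Real.exp x * Real.exp (-x) = 1 := by rw [← Real.exp_add]; simp
  have h5 : 0 < Real.exp x := Real.exp_pos x
  -- exp x - 1 ≤ x exp x
  have h6 : Real.exp x - 1 ≤ x * Real.exp x := by nlinarith
  nlinarith

lemma nsq_tex_prime (U : ℝ) (hU : 0 ≤ U) : ∃ C : ℝ, 0 ≤ C ∧ ∀ p : ℕ, p.Prime → ∀ n, 2 ≤ n → ∀ u v y : ℝ,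
    0 ≤ u → 0 ≤ v → 0 ≤ y → y ≤ 1 → u ≤ U * y → v ≤ U * y ^ 2 →
    nsq (tex ℝ n (MonoidAlgebra.single p u + MonoidAlgebra.single (p^2) v)) ≤ 1 + u ^ 2 + C * y ^ 4 := by
  obtain ⟨D, hD⟩ : ∃ D, D = U + (2 * U) ^ 2 * Real.exp (2 * U) := ⟨_, rfl⟩
  have hD0 : 0 ≤ D := by rw [hD]; positivity
  refine ⟨D ^ 2, by positivity, fun p hp n hn u v y hu hv hy hy1 huy hvy => ?_⟩
  have hz : Maj (MonoidAlgebra.single p u + MonoidAlgebra.single (p^2) v) (MonoidAlgebra.single p u + MonoidAlgebra.single (p^2) v) :=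
    (Maj.single p (by rw [Real.norm_of_nonneg hu])).add (Maj.single (p^2) (by rw [Real.norm_of_nonneg hv]))
  obtain ⟨hc1, hc2⟩ := coeff_tex_prime hp hn u v
  have h1 := nsq_le_mass (hz.texr n) hp.one_lt.ne'
  rw [hc1, hc2, mass_tex, map_add, mass_single, mass_single] at h1
  refine h1.trans ?_
  have h2 := tex_le_exp n (add_nonneg hu hv)
  have hy2 : y ^ 2 ≤ y := by nlinarith
  have hv' : v ≤ U * y := hvy.trans (mul_le_mul_of_nonneg_left hy2 hU)
  have h3 : u + v ≤ 2 * U * y := by linarith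
  have h3' : u + v ≤ 2 * U := h3.trans (by nlinarith)
  have h4 := exp_quad (add_nonneg hu hv) h3'
  have h5 : (u + v) ^ 2 ≤ (2 * U * y) ^ 2 := pow_le_pow_left₀ (add_nonneg hu hv) h3 2
  have h6 : (u + v) ^ 2 * Real.exp (2 * U) ≤ (2 * U * y) ^ 2 * Real.exp (2 * U) := mul_le_mul_of_nonneg_right h5 (Real.exp_pos _).le
  have h7 : tex ℝ n (u + v) - 1 - u ≤ D * y ^ 2 := by
    rw [hD]
    nlinarith
  -- lower bound
  have h8 : 0 ≤ tex ℝ n (u + v) - 1 - u := by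
    obtain ⟨m, rfl⟩ : ∃ m, n = m + 2 := ⟨n - 2, by omega⟩
    unfold tex
    rw [Finset.sum_range_succ', Finset.sum_range_succ']
    have : 0 ≤ ∑ k ∈ Finset.range m, (((k + 1 + 1).factorial : ℝ)⁻¹) • (u + v) ^ (k + 1 + 1) :=
      Finset.sum_nonneg fun k _ => by rw [smul_eq_mul]; positivity
    simp at this ⊢
    linarith
  have h9 := pow_le_pow_left₀ h8 h7 2
  calc _ ≤ 1 ^ 2 + u ^ 2 + (D * y ^ 2) ^ 2 := by linarith
    _ = _ := by ring

noncomputable def blk (S : Finset ℕ) (a b : ℕ → ℝ) : MonoidAlgebra ℝ ℕ :=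
  ∑ p ∈ S, (MonoidAlgebra.single p (a p) + MonoidAlgebra.single (p^2) (b p))

lemma nsq_block (U : ℝ) (hU : 0 ≤ U) : ∃ C : ℝ, 0 ≤ C ∧ ∀ S : Finset ℕ, (∀ p ∈ S, p.Prime) → ∀ n, 2 ≤ n → ∀ a b y : ℕ → ℝ,
    (∀ p ∈ S, 0 ≤ a p ∧ 0 ≤ b p ∧ 0 ≤ y p ∧ y p ≤ 1 ∧ a p ≤ U * y p ∧ b p ≤ U * y p ^ 2) →
    nsq (tex ℝ n (blk S a b)) ≤ Real.exp (∑ p ∈ S, (a p ^ 2 + C * y p ^ 4)) := by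
  classical
  obtain ⟨C, hC, h⟩ := nsq_tex_prime U hU
  refine ⟨C, hC, fun S hS n hn a b y hab => ?_⟩
  have hm : ∀ p ∈ S, Maj (MonoidAlgebra.single p (a p) + MonoidAlgebra.single (p^2) (b p)) (MonoidAlgebra.single p (a p) + MonoidAlgebra.single (p^2) (b p)) := fun p hp =>
    (Maj.single p (by rw [Real.norm_of_nonneg (hab p hp).1])).add (Maj.single (p^2) (by rw [Real.norm_of_nonneg (hab p hp).2.1]))
  have h1 := (tex_sum (by omega : 1 ≤ n) S (fun p => MonoidAlgebra.single p (a p) + MonoidAlgebra.single (p^2) (b p)) hm).nsq_le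
  refine h1.trans ?_
  clear h1
  have hsl : ∀ p ∈ S, ∃ L, SL {p} L (tex ℝ n (MonoidAlgebra.single p (a p) + MonoidAlgebra.single (p^2) (b p))) := fun p hp => by
    have hpp := hS p hp
    have hp1 : (1:ℝ) ≤ p := by exact_mod_cast hpp.one_le
    refine ⟨((p:ℝ)^2) ^ n, SL.tex' (SL.add (SL.single _ hpp.ne_zero (by rw [hpp.primeFactors]) ?_) (SL.single _ (pow_ne_zero 2 hpp.ne_zero) ?_ (by push_cast; exact le_rfl))) (one_le_pow₀ hp1) n⟩
    · nlinarith
    · rw [Nat.primeFactors_pow p two_ne_zero, hpp.primeFactors]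
  have h2 : (∃ L, SL S L (∏ p ∈ S, tex ℝ n (MonoidAlgebra.single p (a p) + MonoidAlgebra.single (p^2) (b p)))) ∧
      nsq (∏ p ∈ S, tex ℝ n (MonoidAlgebra.single p (a p) + MonoidAlgebra.single (p^2) (b p))) = ∏ p ∈ S, nsq (tex ℝ n (MonoidAlgebra.single p (a p) + MonoidAlgebra.single (p^2) (b p))) := by
    clear hab hm hS
    induction S using Finset.induction_on with
    | empty => simp only [Finset.prod_empty, nsq_one, and_true]; exact ⟨1, SL.one le_rfl⟩
    | insert r S hr ih =>
      obtain ⟨⟨L, hL⟩, ih2⟩ := ih fun p hp => hsl p (Finset.mem_insert_of_mem hp)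
      obtain ⟨L', hL'⟩ := hsl r (Finset.mem_insert_self _ _)
      rw [Finset.prod_insert hr, Finset.prod_insert hr]
      refine ⟨⟨L' * L, by have := hL'.mul hL; rwa [← Finset.insert_eq] at this⟩, ?_⟩
      rw [nsq_mul_of_coprime _ _ (hL'.coprime hL (by simpa using hr)), ih2]
  rw [h2.2, Real.exp_sum]
  refine Finset.prod_le_prod (fun p _ => nsq_nonneg _) fun p hp => ?_
  obtain ⟨b1, b2, b3, b4, b5, b6⟩ := hab p hp
  refine (h p (hS p hp) n hn (a p) (b p) (y p) b1 b2 b3 b4 b5 b6).trans ?_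
  have := Real.add_one_le_exp (a p ^ 2 + C * y p ^ 4)
  linarith


lemma blk_maj_self {S : Finset ℕ} {a b : ℕ → ℝ} (h : ∀ p ∈ S, 0 ≤ a p ∧ 0 ≤ b p) : Maj (blk S a b) (blk S a b) :=
  Maj.sum _ fun p hp => (Maj.single p (by rw [Real.norm_of_nonneg (h p hp).1])).add (Maj.single (p^2) (by rw [Real.norm_of_nonneg (h p hp).2]))

lemma smul_blk (T : ℝ) (S : Finset ℕ) (a b : ℕ → ℝ) : T • blk S a b = blk S (fun p => T * a p) (fun p => T * b p) := by
  unfold blk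
  rw [Finset.smul_sum]
  refine Finset.sum_congr rfl fun p _ => ?_
  rw [smul_add, MonoidAlgebra.smul_single, MonoidAlgebra.smul_single, smul_eq_mul, smul_eq_mul]

lemma pow_maj {B : MonoidAlgebra ℝ ℕ} (hB : Maj B B) (s : ℕ) {T : ℝ} (hT : 0 < T) :
    Maj (B ^ s) (((s.factorial : ℝ) * (T ^ s)⁻¹) • tex ℝ (s + 1) (T • B)) := by
  have h1 : Maj (((s.factorial : ℝ)⁻¹) • (T • B) ^ s) (tex ℝ (s + 1) (T • B)) := by
    unfold tex
    have := Maj.sum_subset (s := {s}) (t := Finset.range (s + 1)) (f := fun k => ((k.factorial : ℝ)⁻¹) • (T • B) ^ k) (by simp)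
      (fun k _ => ((hB.smul (c := T) (d := T) (by rw [Real.norm_of_nonneg hT.le])).pow k).smul (by simp))
    simpa using this
  have h2 := h1.smul (c := (s.factorial : ℝ) * (T ^ s)⁻¹) (d := (s.factorial : ℝ) * (T ^ s)⁻¹) (by rw [Real.norm_of_nonneg (by positivity)])
  have h3 : ((s.factorial : ℝ) * (T ^ s)⁻¹) • ((s.factorial : ℝ)⁻¹) • (T • B) ^ s = B ^ s := by
    rw [smul_pow, smul_smul, smul_smul]
    have : (s.factorial : ℝ) * (T ^ s)⁻¹ * (s.factorial : ℝ)⁻¹ * T ^ s = 1 := by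
      have : (s.factorial : ℝ) ≠ 0 := by positivity
      field_simp
    rw [this, one_smul]
  rwa [h3] at h2

lemma pow_block (P : ℝ) (hP : 0 ≤ P) : ∃ C : ℝ, 0 ≤ C ∧ ∀ S : Finset ℕ, (∀ p ∈ S, p.Prime) → ∀ s : ℕ, 1 ≤ s → (∀ p ∈ S, s ≤ p) →
    ∀ a b : ℕ → ℝ, (∀ p ∈ S, 0 ≤ a p ∧ 0 ≤ b p ∧ a p ≤ P * (p:ℝ)^(-(1/2:ℝ)) ∧ b p ≤ P * (p:ℝ)⁻¹) →
    nsq (blk S a b ^ s) ≤ (s:ℝ) ^ s * Real.exp (C * s * ∑ p ∈ S, (p:ℝ)⁻¹) := by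
  obtain ⟨C, hC, h⟩ := nsq_block P hP
  refine ⟨P ^ 2 + C, by positivity, fun S hS s hs hsp a b hab => ?_⟩
  have hs0 : (0:ℝ) < s := by exact_mod_cast hs
  have hs1 : (1:ℝ) ≤ s := by exact_mod_cast hs
  obtain ⟨T, hT⟩ : ∃ T, T = Real.sqrt s := ⟨_, rfl⟩
  have hT0 : 0 < T := by rw [hT]; positivity
  have hT2 : T ^ 2 = s := by rw [hT]; exact Real.sq_sqrt hs0.le
  have hTs : T ≤ s := by nlinarith
  have h1 := (pow_maj (blk_maj_self fun p hp => ⟨(hab p hp).1, (hab p hp).2.1⟩) s hT0).nsq_le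
  rw [nsq_smul, smul_blk] at h1
  have h2 := h S hS (s + 1) (by omega) (fun p => T * a p) (fun p => T * b p) (fun p => T * (p:ℝ)^(-(1/2:ℝ))) ?_
  · refine h1.trans ?_
    have hf : (s.factorial : ℝ) ≤ (s:ℝ) ^ s := by exact_mod_cast Nat.factorial_le_pow s
    have h3 : ((s.factorial : ℝ) * (T ^ s)⁻¹) ^ 2 ≤ (s:ℝ) ^ s := by
      rw [mul_pow, inv_pow, ← pow_mul, mul_comm s 2, pow_mul, hT2]
      rw [← div_eq_mul_inv, div_le_iff₀ (by positivity), ← pow_two]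
      exact pow_le_pow_left₀ (by positivity) hf 2
    refine mul_le_mul h3 (h2.trans ?_) (nsq_nonneg _) (by positivity)
    refine Real.exp_le_exp.2 ?_
    rw [Finset.mul_sum]
    refine Finset.sum_le_sum fun p hp => ?_
    have hp0 : (0:ℝ) < p := by exact_mod_cast (hS p hp).pos
    have hsp' : (s:ℝ) ≤ p := by exact_mod_cast hsp p hp
    obtain ⟨a0, b0, a1, b1⟩ := hab p hp
    have hy : ((p:ℝ)^(-(1/2:ℝ)))^2 = (p:ℝ)⁻¹ := by
      rw [← Real.rpow_natCast, ← Real.rpow_mul hp0.le]; norm_num; rw [Real.rpow_neg_one]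
    have e1 : (T * a p) ^ 2 ≤ P ^ 2 * s * (p:ℝ)⁻¹ := by
      have := pow_le_pow_left₀ a0 a1 2
      rw [mul_pow, hy] at this
      rw [mul_pow, hT2]
      calc (s:ℝ) * a p ^ 2 ≤ s * (P ^ 2 * (p:ℝ)⁻¹) := mul_le_mul_of_nonneg_left this hs0.le
        _ = _ := by ring
    have e2 : (T * (p:ℝ)^(-(1/2:ℝ))) ^ 4 ≤ s * (p:ℝ)⁻¹ := by
      have : (T * (p:ℝ)^(-(1/2:ℝ))) ^ 4 = ((s:ℝ) * (p:ℝ)⁻¹) ^ 2 := by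
        rw [← hT2, ← hy]; ring
      rw [this]
      have h5 : (s:ℝ) * (p:ℝ)⁻¹ ≤ 1 := by rw [← div_eq_mul_inv, div_le_one hp0]; exact hsp'
      have h6 : 0 ≤ (s:ℝ) * (p:ℝ)⁻¹ := by positivity
      nlinarith
    have := mul_le_mul_of_nonneg_left e2 hC
    nlinarith
  · intro p hp
    have hp0 : (0:ℝ) < p := by exact_mod_cast (hS p hp).pos
    have hsp' : (s:ℝ) ≤ p := by exact_mod_cast hsp p hp
    obtain ⟨a0, b0, a1, b1⟩ := hab p hp
    have hy : ((p:ℝ)^(-(1/2:ℝ)))^2 = (p:ℝ)⁻¹ := by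
      rw [← Real.rpow_natCast, ← Real.rpow_mul hp0.le]; norm_num; rw [Real.rpow_neg_one]
    refine ⟨by positivity, by positivity, by positivity, ?_, ?_, ?_⟩
    · refine (sq_le_one_iff₀ (by positivity)).1 ?_
      rw [mul_pow, hT2, hy, ← div_eq_mul_inv, div_le_one hp0]; exact hsp'
    · have := mul_le_mul_of_nonneg_left a1 hT0.le
      linarith
    · show T * b p ≤ P * (T * (p:ℝ)^(-(1/2:ℝ)))^2
      rw [mul_pow, hT2, hy]
      calc T * b p ≤ s * (P * (p:ℝ)⁻¹) := mul_le_mul hTs b1 b0 hs0.le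
        _ = _ := by ring

noncomputable def cblk (S : Finset ℕ) (u v : ℕ → ℂ) : MonoidAlgebra ℂ ℕ :=
  ∑ p ∈ S, (MonoidAlgebra.single p (u p) + MonoidAlgebra.single (p^2) (v p))

lemma evc_cblk {q : ℕ} (χ : DirichletCharacter ℂ q) (S : Finset ℕ) (u v : ℕ → ℂ) :
    evc χ (cblk S u v) = ∑ p ∈ S, (u p * χ p + v p * χ p ^ 2) := by
  unfold cblk
  rw [map_sum]
  refine Finset.sum_congr rfl fun p _ => ?_
  rw [map_add, evc_single, evc_single]; simp

lemma cblk_maj {S : Finset ℕ} {u v : ℕ → ℂ} {a b : ℕ → ℝ} (h : ∀ p ∈ S, ‖u p‖ ≤ a p ∧ ‖v p‖ ≤ b p) :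
    Maj (cblk S u v) (blk S a b) :=
  Maj.sum _ fun p hp => (Maj.single p (h p hp).1).add (Maj.single (p^2) (h p hp).2)

lemma single_SL {𝕜 : Type*} [NormedField 𝕜] {S : Finset ℕ} (hS : ∀ p ∈ S, p.Prime) {x : ℝ} (hx : ∀ p ∈ S, (p:ℝ) ≤ x) (c d : ℕ → 𝕜) :
    SL S (x ^ 2) (∑ p ∈ S, (MonoidAlgebra.single p (c p) + MonoidAlgebra.single (p^2) (d p))) :=
  SL.sum _ fun p hp => by
    have hpp := hS p hp
    have hp1 : (1:ℝ) ≤ p := by exact_mod_cast hpp.one_le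
    have hx' := hx p hp
    refine SL.add (SL.single _ hpp.ne_zero (by rw [hpp.primeFactors]; simpa using hp) (by nlinarith)) (SL.single _ (pow_ne_zero 2 hpp.ne_zero) ?_ ?_)
    · rw [Nat.primeFactors_pow p two_ne_zero, hpp.primeFactors]; simpa using hp
    · push_cast; exact pow_le_pow_left₀ (by linarith) hx' 2

lemma SL_prod {𝕜 : Type*} [NormedField 𝕜] {ι : Type*} [DecidableEq ι] (I : Finset ι) (S : ι → Finset ℕ) (L : ι → ℝ) (f : ι → MonoidAlgebra 𝕜 ℕ)
    (h : ∀ i ∈ I, SL (S i) (L i) (f i)) : SL (I.biUnion S) (∏ i ∈ I, L i) (∏ i ∈ I, f i) := by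
  induction I using Finset.induction_on with
  | empty => simpa using SL.one le_rfl
  | insert a I ha ih =>
    rw [Finset.prod_insert ha, Finset.prod_insert ha, Finset.biUnion_insert]
    exact (h a (Finset.mem_insert_self _ _)).mul (ih fun i hi => h i (Finset.mem_insert_of_mem hi))

lemma nsq_prod_disj {ι : Type*} [DecidableEq ι] (I : Finset ι) (S : ι → Finset ℕ) (L : ι → ℝ) (f : ι → MonoidAlgebra ℝ ℕ)
    (h : ∀ i ∈ I, SL (S i) (L i) (f i)) (hd : ∀ i ∈ I, ∀ j ∈ I, i ≠ j → Disjoint (S i) (S j)) :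
    nsq (∏ i ∈ I, f i) = ∏ i ∈ I, nsq (f i) := by
  induction I using Finset.induction_on with
  | empty => simpa using nsq_one
  | insert a I ha ih =>
    rw [Finset.prod_insert ha, Finset.prod_insert ha]
    have h1 := h a (Finset.mem_insert_self _ _)
    have h2 := SL_prod I S L f fun i hi => h i (Finset.mem_insert_of_mem hi)
    rw [nsq_mul_of_coprime _ _ (h1.coprime h2 ?_), ih (fun i hi => h i (Finset.mem_insert_of_mem hi)) fun i hi j hj => hd i (Finset.mem_insert_of_mem hi) j (Finset.mem_insert_of_mem hj)]
    rw [Finset.disjoint_biUnion_right]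
    intro i hi
    exact hd a (Finset.mem_insert_self _ _) i (Finset.mem_insert_of_mem hi) (by rintro rfl; exact ha hi)

lemma moment_lemma {q : ℕ} [NeZero q] (m : ℕ) (S : ℕ → Finset ℕ) (x : ℕ → ℝ) (n : ℕ → ℕ) (S' : Finset ℕ) (x' : ℝ) (s : ℕ)
    (hS : ∀ i < m, ∀ p ∈ S i, p.Prime ∧ (p:ℝ) ≤ x i) (hx : ∀ i < m, 1 ≤ x i) (hS' : ∀ p ∈ S', p.Prime ∧ (p:ℝ) ≤ x')
    (hd : ∀ i < m, ∀ j < m, i ≠ j → Disjoint (S i) (S j)) (hd' : ∀ i < m, Disjoint (S i) S')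
    (hlen : (∏ i ∈ Finset.range m, (x i ^ 2) ^ n i) * (x' ^ 2) ^ s < q)
    (u v u' v' : ℕ → ℂ) (a b a' b' : ℕ → ℝ) (hab : ∀ p, ‖u p‖ ≤ a p ∧ ‖v p‖ ≤ b p) (hab' : ∀ p, ‖u' p‖ ≤ a' p ∧ ‖v' p‖ ≤ b' p) :
    ∑ χ : DirichletCharacter ℂ q, (∏ i ∈ Finset.range m, ‖tex ℂ (n i) (evc χ (cblk (S i) u v))‖ ^ 2) * ‖evc χ (cblk S' u' v')‖ ^ (2 * s) ≤
      Nat.totient q * ((∏ i ∈ Finset.range m, nsq (tex ℝ (n i) (blk (S i) a b))) * nsq (blk S' a' b' ^ s)) := by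
  classical
  obtain ⟨A, hA⟩ : ∃ A, A = (∏ i ∈ Finset.range m, tex ℂ (n i) (cblk (S i) u v)) * cblk S' u' v' ^ s := ⟨_, rfl⟩
  have hSL : ∀ i ∈ Finset.range m, SL (S i) ((x i ^ 2) ^ n i) (tex ℂ (n i) (cblk (S i) u v)) := fun i hi => by
    have hi' := Finset.mem_range.1 hi
    exact (single_SL (fun p hp => (hS i hi' p hp).1) (fun p hp => (hS i hi' p hp).2) u v).tex' (one_le_pow₀ (hx i hi')) _
  have hSLr : ∀ i ∈ Finset.range m, SL (S i) ((x i ^ 2) ^ n i) (tex ℝ (n i) (blk (S i) a b)) := fun i hi => by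
    have hi' := Finset.mem_range.1 hi
    exact (single_SL (fun p hp => (hS i hi' p hp).1) (fun p hp => (hS i hi' p hp).2) a b).tex' (one_le_pow₀ (hx i hi')) _
  have hSL' : SL S' ((x' ^ 2) ^ s) (cblk S' u' v' ^ s) := (single_SL (fun p hp => (hS' p hp).1) (fun p hp => (hS' p hp).2) u' v').pow s
  have hSLr' : SL S' ((x' ^ 2) ^ s) (blk S' a' b' ^ s) := (single_SL (fun p hp => (hS' p hp).1) (fun p hp => (hS' p hp).2) a' b').pow s
  have hmv := mean_value (q := q) A (fun k hk => by
    rw [hA] at hk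
    have := (((SL_prod _ _ _ _ hSL).mul hSL') k hk).2.2
    exact_mod_cast this.trans_lt hlen)
  have hmaj : Maj A ((∏ i ∈ Finset.range m, tex ℝ (n i) (blk (S i) a b)) * blk S' a' b' ^ s) := by
    rw [hA]
    exact (Maj.prod _ fun i _ => (cblk_maj fun p _ => hab p).tex' _).mul ((cblk_maj fun p _ => hab' p).pow s)
  have h3 := hmaj.nsq_le
  rw [nsq_mul_of_coprime _ _ ((SL_prod _ _ _ _ hSLr).coprime hSLr' ?_), nsq_prod_disj _ _ _ _ hSLr ?_] at h3
  · calc _ = ∑ χ : DirichletCharacter ℂ q, ‖evc χ A‖ ^ 2 := by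
          refine Finset.sum_congr rfl fun χ _ => ?_
          rw [hA, map_mul, map_prod, map_pow, norm_mul, mul_pow, norm_prod, ← Finset.prod_pow, norm_pow, ← pow_mul, mul_comm s 2]
          simp only [evc_tex]
      _ ≤ _ := hmv.trans (mul_le_mul_of_nonneg_left h3 (by positivity))
  · intro i hi j hj; exact hd i (Finset.mem_range.1 hi) j (Finset.mem_range.1 hj)
  · rw [Finset.disjoint_biUnion_left]
    intro i hi; exact hd' i (Finset.mem_range.1 hi)


lemma exp_le_tex {z : ℂ} {n : ℕ} (hn : 2 ≤ n) (hz : 4 * ‖z‖ ≤ n) :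
    Real.exp z.re ≤ ‖tex ℂ n (z / 2)‖ ^ 2 * Real.exp (8 * Real.exp (-((n:ℝ) / 2))) := by
  have hn2 : (2:ℝ) ≤ n := by exact_mod_cast hn
  obtain ⟨w, hw⟩ : ∃ w, w = z / 2 := ⟨_, rfl⟩
  have hwn : ‖w‖ ≤ n / 8 := by
    rw [hw, norm_div]; simp; linarith
  have htex : tex ℂ n w = ∑ m ∈ Finset.range n, w ^ m / m.factorial := by
    unfold tex
    refine Finset.sum_congr rfl fun m _ => ?_
    rw [smul_eq_mul]; ring
  have h1 : ‖Complex.exp w - tex ℂ n w‖ ≤ ‖w‖ ^ n / n.factorial * 2 := by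
    rw [htex]
    refine Complex.exp_bound' ?_
    rw [div_le_iff₀ (by positivity)]
    push_cast; linarith
  have h2 : ‖w‖ ^ n / n.factorial ≤ Real.exp (-(7/8 * n)) * Real.exp (-((n:ℝ)/8)) := by
    have h3 := Real.pow_div_factorial_le_exp (x := (n:ℝ)) (by positivity) n
    have h4 : ‖w‖ ^ n ≤ ((n:ℝ)) ^ n * (1/8) ^ n := by
      rw [← mul_pow]
      exact pow_le_pow_left₀ (norm_nonneg _) (by linarith) n
    have h5 : ((1:ℝ)/8) ^ n ≤ Real.exp (-(2 * n)) := by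
      have : (1:ℝ)/8 ≤ Real.exp (-2) := by
        rw [Real.exp_neg, one_div]
        refine inv_anti₀ (Real.exp_pos _) ?_
        have := Real.exp_one_lt_d9
        have h2 : Real.exp 2 = Real.exp 1 ^ 2 := by rw [← Real.exp_nat_mul]; norm_num
        rw [h2]
        nlinarith [Real.exp_pos 1]
      calc ((1:ℝ)/8) ^ n ≤ Real.exp (-2) ^ n := pow_le_pow_left₀ (by norm_num) this n
        _ = _ := by rw [← Real.exp_nat_mul]; congr 1; ring
    calc ‖w‖ ^ n / n.factorial ≤ ((n:ℝ) ^ n * (1/8) ^ n) / n.factorial := by gcongr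
      _ = ((n:ℝ) ^ n / n.factorial) * (1/8) ^ n := by ring
      _ ≤ Real.exp n * Real.exp (-(2 * n)) := mul_le_mul h3 h5 (by positivity) (Real.exp_pos _).le
      _ = _ := by rw [← Real.exp_add, ← Real.exp_add]; congr 1; ring
  have h6 : Real.exp (-((n:ℝ)/8)) ≤ ‖Complex.exp w‖ := by
    rw [Complex.norm_exp]
    refine Real.exp_le_exp.2 ?_
    have := (abs_le.1 (Complex.abs_re_le_norm w)).1
    linarith
  obtain ⟨r, hr⟩ : ∃ r, r = 2 * Real.exp (-(7/8 * n)) := ⟨_, rfl⟩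
  have hr0 : 0 ≤ r := by rw [hr]; positivity
  have h7 : ‖Complex.exp w - tex ℂ n w‖ ≤ r * ‖Complex.exp w‖ := by
    refine h1.trans ?_
    calc _ ≤ Real.exp (-(7/8 * n)) * Real.exp (-((n:ℝ)/8)) * 2 := by linarith
      _ = r * Real.exp (-((n:ℝ)/8)) := by rw [hr]; ring
      _ ≤ _ := mul_le_mul_of_nonneg_left h6 hr0
  have h8 : ‖Complex.exp w‖ * (1 - r) ≤ ‖tex ℂ n w‖ := by
    have := norm_sub_norm_le (Complex.exp w) (tex ℂ n w)
    linarith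
  have hr1 : r ≤ 1/2 := by
    have : Real.exp (-(7/8 * n)) ≤ Real.exp (-(7/4)) := Real.exp_le_exp.2 (by linarith)
    have h9 : Real.exp (-(7/4:ℝ)) ≤ 1/4 := by
      rw [Real.exp_neg, one_div]
      refine inv_anti₀ (by norm_num) ?_
      have h10 : Real.exp (7/4) = Real.exp 1 * Real.exp (3/4) := by rw [← Real.exp_add]; norm_num
      have := Real.add_one_le_exp (3/4:ℝ)
      have := Real.exp_one_gt_d9
      rw [h10]; nlinarith
    linarith
  have h11 : Real.exp (-(2 * r)) ≤ 1 - r := by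
    -- exp(2 * r) (1 - r) ≥ 1
    have h12 := Real.quadratic_le_exp_of_nonneg (x := 2 * r) (by linarith)
    rw [Real.exp_neg]
    rw [inv_le_comm₀ (Real.exp_pos _) (by linarith)]
    refine le_trans ?_ h12
    rw [inv_le_comm₀ (by linarith) (by positivity)]
    rw [inv_le_iff_one_le_mul₀ (by positivity)]
    nlinarith [mul_nonneg hr0 hr0]
  have h13 : ‖Complex.exp w‖ ≤ ‖tex ℂ n w‖ * Real.exp (2 * r) := by
    have : ‖Complex.exp w‖ * Real.exp (-(2*r)) ≤ ‖tex ℂ n w‖ := (mul_le_mul_of_nonneg_left h11 (norm_nonneg _)).trans h8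
    calc ‖Complex.exp w‖ = ‖Complex.exp w‖ * Real.exp (-(2*r)) * Real.exp (2*r) := by rw [mul_assoc, ← Real.exp_add]; simp
      _ ≤ _ := mul_le_mul_of_nonneg_right this (Real.exp_pos _).le
  have h14 : Real.exp z.re = ‖Complex.exp w‖ ^ 2 := by
    rw [Complex.norm_exp, ← Real.exp_nat_mul, hw]; congr 1
    rw [Complex.div_ofNat_re]; push_cast; ring
  rw [h14, ← hw]
  calc _ ≤ (‖tex ℂ n w‖ * Real.exp (2 * r)) ^ 2 := pow_le_pow_left₀ (norm_nonneg _) h13 2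
    _ = ‖tex ℂ n w‖ ^ 2 * Real.exp (4 * r) := by rw [mul_pow, ← Real.exp_nat_mul]; congr 2; push_cast; ring
    _ ≤ _ := by
      refine mul_le_mul_of_nonneg_left (Real.exp_le_exp.2 ?_) (by positivity)
      rw [hr]
      have : Real.exp (-(7/8 * n)) ≤ Real.exp (-((n:ℝ)/2)) := Real.exp_le_exp.2 (by linarith)
      linarith

lemma harper_pt (J : ℕ) (G C0 : ℝ) (hC0 : 0 ≤ C0) (Ex : ℕ → ℝ) (hEx : ∀ l, 0 ≤ Ex l) (Pol : ℕ → ℕ → ℂ) (K : ℕ → ℝ) (n s : ℕ → ℕ) (D : ℝ)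
    (hG : ∀ l ≤ J, G ≤ C0 * Ex l * Real.exp (∑ i ∈ Finset.range (l + 1), Pol i l).re)
    (hK : ∀ i ≤ J, 0 < K i) (hn : ∀ i ≤ J, 4 * K i ≤ n i) (hn2 : ∀ i ≤ J, 2 ≤ n i)
    (h0 : ∀ l ≤ J, ‖Pol 0 l‖ ≤ K 0)
    (hD : ∑ i ∈ Finset.range (J + 1), 8 * Real.exp (-((n i:ℝ) / 2)) ≤ D) :
    G ≤ C0 * Real.exp D * (Ex J * (∏ i ∈ Finset.range (J + 1), ‖tex ℂ (n i) (Pol i J / 2)‖ ^ 2) +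
      ∑ j ∈ Finset.range J, ∑ l ∈ Finset.Icc (j + 1) J, Ex j * ((∏ i ∈ Finset.range (j + 1), ‖tex ℂ (n i) (Pol i j / 2)‖ ^ 2) *
        (‖Pol (j + 1) l‖ / K (j + 1)) ^ (2 * s (j + 1)))) := by
  classical
  have key : ∀ j ≤ J, (∀ i ≤ j, ‖Pol i j‖ ≤ K i) → G ≤ C0 * Real.exp D * (Ex j * (∏ i ∈ Finset.range (j + 1), ‖tex ℂ (n i) (Pol i j / 2)‖ ^ 2)) := by
    intro j hj hgood
    refine (hG j hj).trans ?_
    have h1 : Real.exp (∑ i ∈ Finset.range (j + 1), Pol i j).re ≤ (∏ i ∈ Finset.range (j + 1), ‖tex ℂ (n i) (Pol i j / 2)‖ ^ 2) * Real.exp D := by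
      rw [Complex.re_sum, Real.exp_sum]
      have h2 : ∏ i ∈ Finset.range (j + 1), Real.exp (Pol i j).re ≤ ∏ i ∈ Finset.range (j + 1), (‖tex ℂ (n i) (Pol i j / 2)‖ ^ 2 * Real.exp (8 * Real.exp (-((n i:ℝ) / 2)))) := by
        refine Finset.prod_le_prod (fun i _ => (Real.exp_pos _).le) fun i hi => ?_
        have hi' : i ≤ j := by have := Finset.mem_range.1 hi; omega
        refine exp_le_tex (hn2 i (hi'.trans hj)) ?_
        have := hgood i hi'
        have := hn i (hi'.trans hj)
        linarith
      refine h2.trans ?_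
      rw [Finset.prod_mul_distrib, ← Real.exp_sum]
      refine mul_le_mul_of_nonneg_left (Real.exp_le_exp.2 ?_) (Finset.prod_nonneg fun i _ => by positivity)
      refine le_trans (Finset.sum_le_sum_of_subset_of_nonneg ?_ fun _ _ _ => by positivity) hD
      intro i hi
      rw [Finset.mem_range] at hi ⊢; omega
    calc _ ≤ C0 * Ex j * ((∏ i ∈ Finset.range (j + 1), ‖tex ℂ (n i) (Pol i j / 2)‖ ^ 2) * Real.exp D) :=
          mul_le_mul_of_nonneg_left h1 (mul_nonneg hC0 (hEx j))
      _ = _ := by ring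
  have hC : 0 ≤ C0 * Real.exp D := mul_nonneg hC0 (Real.exp_pos _).le
  have hprod : ∀ j, 0 ≤ ∏ i ∈ Finset.range (j + 1), ‖tex ℂ (n i) (Pol i j / 2)‖ ^ 2 := fun j => Finset.prod_nonneg fun i _ => by positivity
  have hterm : ∀ j ∈ Finset.range J, ∀ l ∈ Finset.Icc (j + 1) J, 0 ≤ Ex j * ((∏ i ∈ Finset.range (j + 1), ‖tex ℂ (n i) (Pol i j / 2)‖ ^ 2) *
        (‖Pol (j + 1) l‖ / K (j + 1)) ^ (2 * s (j + 1))) := fun j _ l _ => by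
    refine mul_nonneg (hEx j) (mul_nonneg (hprod j) ?_)
    rw [pow_mul]; positivity
  by_cases hall : ∀ i ≤ J, ∀ l ≤ J, i ≤ l → ‖Pol i l‖ ≤ K i
  · refine (key J le_rfl fun i hi => hall i hi J le_rfl hi).trans ?_
    refine mul_le_mul_of_nonneg_left ?_ hC
    refine le_add_of_nonneg_right (Finset.sum_nonneg fun j hj => Finset.sum_nonneg fun l hl => hterm j hj l hl)
  · push Not at hall
    have hex : ∃ i, i ≤ J ∧ ∃ l ≤ J, i ≤ l ∧ K i < ‖Pol i l‖ := by
      obtain ⟨i, h1, l, h2⟩ := hall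
      exact ⟨i, h1, l, h2⟩
    obtain ⟨i, hi⟩ : ∃ i, i = Nat.find hex := ⟨_, rfl⟩
    obtain ⟨hiJ, l, hlJ, hil, hbad⟩ := Nat.find_spec hex
    rw [← hi] at hiJ hil hbad
    have hmin : ∀ i' < i, ∀ l ≤ J, i' ≤ l → ‖Pol i' l‖ ≤ K i' := by
      intro i' hi' l hl hil
      have := Nat.find_min hex (hi ▸ hi')
      push Not at this
      exact this (by omega) l hl hil
    obtain ⟨j, rfl⟩ : ∃ j, i = j + 1 := by
      rcases i with _ | j
      · exact absurd (h0 l hlJ) (not_le.2 hbad)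
      · exact ⟨j, rfl⟩
    have hjJ : j < J := by omega
    refine (key j hjJ.le fun i hi => hmin i (by omega) j hjJ.le hi).trans ?_
    refine mul_le_mul_of_nonneg_left ?_ hC
    have h1 : Ex j * (∏ i ∈ Finset.range (j + 1), ‖tex ℂ (n i) (Pol i j / 2)‖ ^ 2) ≤
        Ex j * ((∏ i ∈ Finset.range (j + 1), ‖tex ℂ (n i) (Pol i j / 2)‖ ^ 2) * (‖Pol (j + 1) l‖ / K (j + 1)) ^ (2 * s (j + 1))) := by
      refine mul_le_mul_of_nonneg_left ?_ (hEx j)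
      refine le_mul_of_one_le_right (hprod j) ?_
      refine one_le_pow₀ ?_
      rw [one_le_div (hK _ hiJ)]
      exact hbad.le
    refine h1.trans ?_
    have h2 := Finset.single_le_sum (f := fun l => Ex j * ((∏ i ∈ Finset.range (j + 1), ‖tex ℂ (n i) (Pol i j / 2)‖ ^ 2) *
        (‖Pol (j + 1) l‖ / K (j + 1)) ^ (2 * s (j + 1)))) (hterm j (Finset.mem_range.2 hjJ)) (Finset.mem_Icc.2 ⟨hil, hlJ⟩)
    have h3 := Finset.single_le_sum (f := fun j => ∑ l ∈ Finset.Icc (j + 1) J, Ex j * ((∏ i ∈ Finset.range (j + 1), ‖tex ℂ (n i) (Pol i j / 2)‖ ^ 2) *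
        (‖Pol (j + 1) l‖ / K (j + 1)) ^ (2 * s (j + 1)))) (fun j hj => Finset.sum_nonneg fun l hl => hterm j hj l hl) (Finset.mem_range.2 hjJ)
    refine h2.trans (h3.trans (le_add_of_nonneg_left (mul_nonneg (hEx J) (hprod J))))


lemma dy_pos {β : ℕ → ℝ} (hβ : ∀ i, β (i + 1) = 2 * β i) (h0 : 0 < β 0) (i : ℕ) : 0 < β i := by
  induction i with
  | zero => exact h0
  | succ i ih => rw [hβ]; linarith

lemma dy_mono {β : ℕ → ℝ} (hβ : ∀ i, β (i + 1) = 2 * β i) (h0 : 0 < β 0) {i j : ℕ} (h : i ≤ j) : β i ≤ β j := by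
  induction j, h using Nat.le_induction with
  | base => exact le_rfl
  | succ j _ ih => have := dy_pos hβ h0 j; rw [hβ]; linarith

lemma dy_sum {β : ℕ → ℝ} (hβ : ∀ i, β (i + 1) = 2 * β i) (h0 : 0 < β 0) (j : ℕ) : ∑ i ∈ Finset.range (j + 1), β i ≤ 2 * β j := by
  induction j with
  | zero => simp; linarith
  | succ j ih => rw [Finset.sum_range_succ, hβ]; linarith

lemma dy_sum4 {β : ℕ → ℝ} (hβ : ∀ i, β (i + 1) = 2 * β i) (h0 : 0 < β 0) (j : ℕ) : ∑ i ∈ Finset.range (j + 1), β i ^ (1/4:ℝ) ≤ 7 * β j ^ (1/4:ℝ) := by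
  induction j with
  | zero => simp; have := Real.rpow_nonneg h0.le (1/4:ℝ); norm_num at this; linarith
  | succ j ih =>
    rw [Finset.sum_range_succ]
    have hp := dy_pos hβ h0 j
    have h1 : β (j + 1) ^ (1/4:ℝ) = 2 ^ (1/4:ℝ) * β j ^ (1/4:ℝ) := by
      rw [hβ, Real.mul_rpow (by norm_num) hp.le]
    have h2 : (7/6:ℝ) ≤ 2 ^ (1/4:ℝ) := by
      have h4 : ((7/6:ℝ) ^ (4:ℕ)) ^ (1/4:ℝ) = 7/6 := by
        rw [← Real.rpow_natCast, ← Real.rpow_mul (by norm_num)]; norm_num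
      rw [← h4]
      exact Real.rpow_le_rpow (by norm_num) (by norm_num) (by norm_num)
    have h3 : 7/6 * β j ^ (1/4:ℝ) ≤ β (j + 1) ^ (1/4:ℝ) := by
      rw [h1]; exact mul_le_mul_of_nonneg_right h2 (Real.rpow_nonneg hp.le _)
    linarith

lemma dy_D {β : ℕ → ℝ} (hβ : ∀ i, β (i + 1) = 2 * β i) (h0 : 0 < β 0) {n : ℕ → ℕ} {J : ℕ} (hJ : β J ≤ 1) (hn : ∀ i ≤ J, 4 * β i ^ (-(3/4:ℝ)) ≤ n i) :
    ∑ i ∈ Finset.range (J + 1), 8 * Real.exp (-((n i:ℝ) / 2)) ≤ 8 := by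
  have h1 : ∀ i ∈ Finset.range (J + 1), 8 * Real.exp (-((n i:ℝ) / 2)) ≤ 4 * β i := by
    intro i hi
    have hi' : i ≤ J := by have := Finset.mem_range.1 hi; omega
    have hp := dy_pos hβ h0 i
    have hb1 : β i ≤ 1 := (dy_mono hβ h0 hi').trans hJ
    obtain ⟨K, hK⟩ : ∃ K, K = β i ^ (-(3/4:ℝ)) := ⟨_, rfl⟩
    have hK0 : 0 < K := by rw [hK]; positivity
    have h2 := hn i hi'
    rw [← hK] at h2
    have h3 : Real.exp (-((n i:ℝ) / 2)) ≤ Real.exp (-(2*K)) := Real.exp_le_exp.2 (by linarith)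
    have h4 := Real.quadratic_le_exp_of_nonneg (x := 2 * K) (by positivity)
    have h5 : Real.exp (-(2*K)) ≤ (2 * K ^ 2)⁻¹ := by
      rw [Real.exp_neg]
      refine inv_anti₀ (by positivity) (by nlinarith)
    have h6 : (K ^ 2)⁻¹ ≤ β i := by
      rw [hK, ← Real.rpow_natCast, ← Real.rpow_mul hp.le, ← Real.rpow_neg hp.le]
      calc β i ^ (-(-(3/4:ℝ) * (2:ℕ))) ≤ β i ^ (1:ℝ) := Real.rpow_le_rpow_of_exponent_ge hp hb1 (by norm_num)
        _ = _ := Real.rpow_one _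
    rw [mul_inv] at h5
    linarith
  refine (Finset.sum_le_sum h1).trans ?_
  rw [← Finset.mul_sum]
  have := dy_sum hβ h0 J
  linarith

lemma dy_len {β : ℕ → ℝ} (hβ : ∀ i, β (i + 1) = 2 * β i) (h0 : 0 < β 0) {n : ℕ → ℕ} {j : ℕ} {L : ℝ} (hL : 0 ≤ L) (hJ : β j ^ (1/4:ℝ) ≤ 1/140) (hn : ∀ i ≤ j, (n i:ℝ) ≤ 5 * β i ^ (-(3/4:ℝ))) :
    ∏ i ∈ Finset.range (j + 1), (Real.exp (β i * L) ^ 2) ^ n i ≤ Real.exp (L / 2) := by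
  have h1 : ∀ i ∈ Finset.range (j + 1), (Real.exp (β i * L) ^ 2) ^ n i ≤ Real.exp (10 * L * β i ^ (1/4:ℝ)) := by
    intro i hi
    have hi' : i ≤ j := by have := Finset.mem_range.1 hi; omega
    have hp := dy_pos hβ h0 i
    rw [← pow_mul, ← Real.exp_nat_mul]
    refine Real.exp_le_exp.2 ?_
    push_cast
    have h2 : β i * β i ^ (-(3/4:ℝ)) = β i ^ (1/4:ℝ) := by
      nth_rewrite 1 [← Real.rpow_one (β i)]
      rw [← Real.rpow_add hp]; norm_num
    calc 2 * (n i:ℝ) * (β i * L) = (2 * β i * L) * n i := by ring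
      _ ≤ (2 * β i * L) * (5 * β i ^ (-(3/4:ℝ))) := mul_le_mul_of_nonneg_left (hn i hi') (by positivity)
      _ = _ := by rw [← h2]; ring
  refine (Finset.prod_le_prod (fun i _ => by positivity) h1).trans ?_
  rw [← Real.exp_sum, ← Finset.mul_sum]
  refine Real.exp_le_exp.2 ?_
  have h3 := dy_sum4 hβ h0 j
  nlinarith

lemma dy_pow {β : ℕ → ℝ} (hβ : ∀ i, β (i + 1) = 2 * β i) (h0 : 0 < β 0) (j : ℕ) {J : ℕ} (h : j ≤ J) : ((J - j : ℕ) : ℝ) * β j ≤ β J := by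
  obtain ⟨d, rfl⟩ := Nat.exists_eq_add_of_le h
  clear h
  have h1 : β (j + d) = 2 ^ d * β j := by
    induction d with
    | zero => simp
    | succ d ih => rw [← add_assoc, hβ, ih, pow_succ]; ring
  rw [h1, show j + d - j = d by omega]
  refine mul_le_mul_of_nonneg_right ?_ (dy_pos hβ h0 j).le
  exact_mod_cast (Nat.lt_two_pow_self).le

lemma dy_tail {β : ℕ → ℝ} (hβ : ∀ i, β (i + 1) = 2 * β i) (h0 : 0 < β 0) {J : ℕ} (hJ : β J ≤ 1) : ∑ j ∈ Finset.range J, ((J - j : ℕ) : ℝ) * β (j + 1) ^ 2 ≤ 4 := by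
  have h1 : ∀ j ∈ Finset.range J, ((J - j : ℕ) : ℝ) * β (j + 1) ^ 2 ≤ 2 * β (j + 1) := by
    intro j hj
    have hj' := Finset.mem_range.1 hj
    have h2 := dy_pow hβ h0 j hj'.le
    have h3 := dy_pos hβ h0 (j + 1)
    have h4 : ((J - j : ℕ) : ℝ) * β (j + 1) ≤ 2 := by rw [hβ]; linarith
    calc _ = (((J - j : ℕ) : ℝ) * β (j + 1)) * β (j + 1) := by ring
      _ ≤ _ := mul_le_mul_of_nonneg_right h4 h3.le
  refine (Finset.sum_le_sum h1).trans ?_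
  rw [← Finset.mul_sum]
  have h5 := dy_sum hβ h0 J
  rw [Finset.sum_range_succ'] at h5
  linarith

lemma bad_num (C C1 : ℝ) (hC : 0 ≤ C) (hC1 : 0 ≤ C1) : ∃ η : ℝ, 0 < η ∧ ∀ b : ℝ, 0 < b → b ≤ η → ∀ s : ℕ, s = ⌊1 / (8 * b)⌋₊ →
    1 ≤ s ∧ (s:ℝ) * b ≤ 1 / 8 ∧ Real.exp (2 * C1 / b) * ((s:ℝ) ^ s * Real.exp (C * s) * ((b ^ (-(3/4:ℝ))) ^ (2 * s))⁻¹) ≤ 512 * b ^ 2 := by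
  obtain ⟨A, hA⟩ : ∃ A, A = 2 * (C + 32 * C1 + 1) := ⟨_, rfl⟩
  refine ⟨min (1/16) (Real.exp (-A)), by positivity, fun b hb hbη s hs => ?_⟩
  have hb1 : b ≤ 1/16 := hbη.trans (min_le_left _ _)
  have hb2 : b ≤ Real.exp (-A) := hbη.trans (min_le_right _ _)
  have h8 : 2 ≤ 1 / (8 * b) := by rw [le_div_iff₀ (by positivity)]; linarith
  have hle : (s:ℝ) ≤ 1 / (8 * b) := by rw [hs]; exact Nat.floor_le (by positivity)
  have hlt : 1 / (8 * b) < s + 1 := by rw [hs]; exact Nat.lt_floor_add_one _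
  have hge : 1 / (16 * b) ≤ s := by
    have : 1 / (16 * b) = (1 / (8 * b)) / 2 := by field_simp; norm_num
    rw [this]; linarith
  have hs1 : 1 ≤ s := by
    rw [hs]; exact Nat.le_floor (by push_cast; linarith)
  have hsb : (s:ℝ) * b ≤ 1 / 8 := by
    rw [le_div_iff₀ (by positivity)] at hle; linarith
  have hs0 : (0:ℝ) < s := by exact_mod_cast hs1
  refine ⟨hs1, hsb, ?_⟩
  have hinv : 1 / b ≤ 16 * s := by
    rw [div_le_iff₀ (by positivity)] at hge ⊢; linarith
  have e1 : Real.exp (2 * C1 / b) ≤ Real.exp (32 * C1 * s) := by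
    refine Real.exp_le_exp.2 ?_
    calc 2 * C1 / b = 2 * C1 * (1 / b) := by ring
      _ ≤ 2 * C1 * (16 * s) := mul_le_mul_of_nonneg_left hinv (by positivity)
      _ = _ := by ring
  have e2 : (s:ℝ) ^ s * ((b ^ (-(3/4:ℝ))) ^ (2 * s))⁻¹ ≤ (b ^ (1/2:ℝ)) ^ s := by
    have h1 : (((b ^ (-(3/4:ℝ))) ^ (2 * s))⁻¹ : ℝ) = (b ^ (3/2:ℝ)) ^ s := by
      rw [pow_mul, ← inv_pow]
      congr 1
      rw [← Real.rpow_natCast, ← Real.rpow_mul hb.le, ← Real.rpow_neg hb.le]; norm_num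
    rw [h1, ← mul_pow]
    refine pow_le_pow_left₀ (by positivity) ?_ s
    have h2 : b ^ (3/2:ℝ) = b * b ^ (1/2:ℝ) := by
      nth_rewrite 2 [← Real.rpow_one b]
      rw [← Real.rpow_add hb]; norm_num
    rw [h2, ← mul_assoc]
    have : 0 ≤ b ^ (1/2:ℝ) := by positivity
    nlinarith
  have e3 : b ^ (1/2:ℝ) ≤ Real.exp (-(C + 32 * C1 + 1)) := by
    calc b ^ (1/2:ℝ) ≤ (Real.exp (-A)) ^ (1/2:ℝ) := Real.rpow_le_rpow hb.le hb2 (by norm_num)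
      _ = _ := by rw [← Real.exp_mul, hA]; congr 1; ring
  have e4 : (b ^ (1/2:ℝ)) ^ s ≤ Real.exp (-(C + 32 * C1 + 1) * s) := by
    calc _ ≤ Real.exp (-(C + 32 * C1 + 1)) ^ s := pow_le_pow_left₀ (by positivity) e3 s
      _ = _ := by rw [← Real.exp_nat_mul]; congr 1; ring
  have e5 : Real.exp (-(s:ℝ)) ≤ 512 * b ^ 2 := by
    have h1 : Real.exp (-(s:ℝ)) ≤ Real.exp (-(1 / (16 * b))) := Real.exp_le_exp.2 (by linarith)
    have h2 := Real.quadratic_le_exp_of_nonneg (x := 1 / (16 * b)) (by positivity)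
    have h3 : (512 * b ^ 2)⁻¹ ≤ Real.exp (1 / (16 * b)) := by
      refine le_trans ?_ h2
      have : (512 * b ^ 2)⁻¹ = (1 / (16 * b)) ^ 2 / 2 := by field_simp; norm_num
      rw [this]
      have : 0 < 1 / (16 * b) := by positivity
      linarith
    rw [Real.exp_neg (1 / (16 * b))] at h1
    refine h1.trans ?_
    rw [inv_le_comm₀ (Real.exp_pos _) (by positivity)]; exact h3
  calc _ = Real.exp (2 * C1 / b) * Real.exp (C * s) * ((s:ℝ) ^ s * ((b ^ (-(3/4:ℝ))) ^ (2 * s))⁻¹) := by ring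
    _ ≤ Real.exp (32 * C1 * s) * Real.exp (C * s) * Real.exp (-(C + 32 * C1 + 1) * s) := by
      refine mul_le_mul (mul_le_mul_of_nonneg_right e1 (Real.exp_pos _).le) (e2.trans e4) (by positivity) (by positivity)
    _ = Real.exp (-(s:ℝ)) := by rw [← Real.exp_add, ← Real.exp_add]; congr 1; ring
    _ ≤ _ := e5

lemma primesUpTo_mono {x y : ℝ} (h : x ≤ y) : primesUpTo x ⊆ primesUpTo y := by
  unfold primesUpTo
  refine Finset.filter_subset_filter _ ?_
  intro n hn
  rw [Finset.mem_range] at hn ⊢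
  have := Nat.floor_mono h
  omega

lemma recip_sum : ∃ C : ℝ, 0 < C ∧ ∀ x : ℝ, 3 ≤ x → ∑ p ∈ primesUpTo (x ^ 2) \ primesUpTo x, (p:ℝ)⁻¹ ≤ C := by
  obtain ⟨C, hC, h⟩ := prime_log_div_sum
  refine ⟨2 * C, by positivity, fun x hx => ?_⟩
  have hl : 0 < Real.log x := Real.log_pos (by linarith)
  have h1 := h (x ^ 2) (by nlinarith)
  rw [Real.log_pow] at h1
  have h2 : Real.log x * ∑ p ∈ primesUpTo (x ^ 2) \ primesUpTo x, (p:ℝ)⁻¹ ≤ ∑ p ∈ primesUpTo (x ^ 2), Real.log p / p := by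
    rw [Finset.mul_sum]
    refine le_trans (Finset.sum_le_sum fun p hp => ?_) (Finset.sum_le_sum_of_subset_of_nonneg Finset.sdiff_subset fun p hp _ => ?_)
    · rw [Finset.mem_sdiff, mem_primesUpTo (by positivity), mem_primesUpTo (by linarith)] at hp
      have hxp : x < p := by
        by_contra hh
        exact hp.2 ⟨hp.1.1, not_lt.1 hh⟩
      rw [div_eq_mul_inv]
      refine mul_le_mul_of_nonneg_right ?_ (by positivity)
      exact Real.log_le_log (by linarith) hxp.le
    · rw [mem_primesUpTo (by positivity)] at hp
      have : (1:ℝ) ≤ p := by exact_mod_cast hp.1.one_le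
      exact div_nonneg (Real.log_nonneg this) (by linarith)
  push_cast at h1
  have h3 : Real.log x * ∑ p ∈ primesUpTo (x ^ 2) \ primesUpTo x, (p:ℝ)⁻¹ ≤ Real.log x * (2 * C) := by linarith
  exact le_of_mul_le_mul_left h3 hl

lemma sqrt_sum (N : ℕ) : ∑ n ∈ Finset.range (N + 1), ((n:ℝ)^(-(1/2:ℝ))) ≤ 2 * Real.sqrt N := by
  induction N with
  | zero => simp
  | succ N ih =>
    rw [Finset.sum_range_succ]
    have hN : (0:ℝ) < ((N + 1 : ℕ) : ℝ) := by positivity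
    have h1 : ((N + 1 : ℕ) : ℝ)^(-(1/2:ℝ)) = (Real.sqrt ((N + 1 : ℕ) : ℝ))⁻¹ := by
      rw [Real.rpow_neg hN.le, Real.sqrt_eq_rpow]
    rw [h1]
    obtain ⟨u, hu⟩ : ∃ u, u = Real.sqrt N := ⟨_, rfl⟩
    obtain ⟨w, hw⟩ : ∃ w, w = Real.sqrt ((N + 1 : ℕ) : ℝ) := ⟨_, rfl⟩
    rw [← hw]; rw [← hu] at ih
    have hw0 : 0 < w := by rw [hw]; exact Real.sqrt_pos.2 hN
    have hu0 : 0 ≤ u := by rw [hu]; exact Real.sqrt_nonneg _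
    have e1 : u ^ 2 = N := by rw [hu]; exact Real.sq_sqrt (by positivity)
    have e2 : w ^ 2 = N + 1 := by rw [hw, Real.sq_sqrt (by positivity)]; push_cast; ring
    have huw : u ≤ w := by nlinarith
    have : w⁻¹ ≤ 2 * (w - u) := by
      rw [inv_le_iff_one_le_mul₀ hw0]
      nlinarith
    linarith

lemma block0 {x P : ℝ} (hx : 1 ≤ x) (hP : 0 ≤ P) : ∑ p ∈ primesUpTo x, (P * (p:ℝ)^(-(1/2:ℝ)) + P * (p:ℝ)⁻¹) ≤ 4 * P * Real.sqrt x := by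
  have h1 : ∑ p ∈ primesUpTo x, ((p:ℝ)^(-(1/2:ℝ))) ≤ 2 * Real.sqrt x := by
    refine le_trans (Finset.sum_le_sum_of_subset_of_nonneg (Finset.filter_subset _ _) fun _ _ _ => by positivity) ((sqrt_sum ⌊x⌋₊).trans ?_)
    refine mul_le_mul_of_nonneg_left (Real.sqrt_le_sqrt (Nat.floor_le (by linarith))) (by norm_num)
  calc _ ≤ ∑ p ∈ primesUpTo x, (2 * P) * (p:ℝ)^(-(1/2:ℝ)) := by
        refine Finset.sum_le_sum fun p hp => ?_
        rw [mem_primesUpTo (by linarith)] at hp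
        have hp1 : (1:ℝ) ≤ p := by exact_mod_cast hp.1.one_le
        have : (p:ℝ)⁻¹ ≤ (p:ℝ)^(-(1/2:ℝ)) := by
          rw [← Real.rpow_neg_one]; exact Real.rpow_le_rpow_of_exponent_le hp1 (by norm_num)
        nlinarith
    _ = 2 * P * ∑ p ∈ primesUpTo x, (p:ℝ)^(-(1/2:ℝ)) := by rw [Finset.mul_sum]
    _ ≤ 2 * P * (2 * Real.sqrt x) := mul_le_mul_of_nonneg_left h1 (by positivity)
    _ = _ := by ring

def layer (T : ℕ → Finset ℕ) : ℕ → Finset ℕ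
  | 0 => T 0
  | (i + 1) => T (i + 1) \ T i

lemma layer_subset (T : ℕ → Finset ℕ) (i : ℕ) : layer T i ⊆ T i := by
  cases i with
  | zero => exact subset_rfl
  | succ i => exact Finset.sdiff_subset

lemma layer_sum {M : Type*} [AddCommMonoid M] {T : ℕ → Finset ℕ} (hT : ∀ i, T i ⊆ T (i + 1)) (f : ℕ → M) (j : ℕ) :
    ∑ i ∈ Finset.range (j + 1), ∑ p ∈ layer T i, f p = ∑ p ∈ T j, f p := by
  induction j with
  | zero => simp [layer]
  | succ j ih =>
    rw [Finset.sum_range_succ, ih, layer, add_comm, Finset.sum_sdiff (hT j)]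

lemma layer_disj {T : ℕ → Finset ℕ} (hT : ∀ i, T i ⊆ T (i + 1)) {i j : ℕ} (h : i ≠ j) : Disjoint (layer T i) (layer T j) := by
  have key : ∀ i j, i < j → Disjoint (layer T i) (layer T j) := by
    intro i j hij
    obtain ⟨d, rfl⟩ : ∃ d, j = d + 1 := ⟨j - 1, by omega⟩
    have : T i ⊆ T d := monotone_nat_of_le_succ (f := T) hT (by omega : i ≤ d)
    rw [layer]
    exact Finset.disjoint_of_subset_left ((layer_subset T i).trans this) Finset.disjoint_sdiff
  rcases lt_or_gt_of_ne h with h | h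
  · exact key i j h
  · exact (key j i h).symm


lemma evc_cblk_half {q : ℕ} (χ : DirichletCharacter ℂ q) (S : Finset ℕ) (u v : ℕ → ℂ) :
    evc χ (cblk S u v) / 2 = evc χ (cblk S (fun p => u p / 2) (fun p => v p / 2)) := by
  rw [evc_cblk, evc_cblk, Finset.sum_div]
  refine Finset.sum_congr rfl fun p _ => ?_
  ring

lemma harper_ev (P X0 η : ℝ) (hη : 0 < η) : ∃ L0 : ℝ, ∀ L : ℝ, L0 ≤ L →
    3 ≤ L ∧ 1 ≤ Real.log L ∧ X0 ≤ Real.log L ∧ Real.log L / L ≤ η ∧ 4 * P * Real.sqrt L ≤ (Real.log L / L) ^ (-(3/4:ℝ)) := by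
  have h1 : Filter.Tendsto Real.log Filter.atTop Filter.atTop := Real.tendsto_log_atTop
  have h2 : Filter.Tendsto (fun L : ℝ => Real.log L / L) Filter.atTop (nhds 0) := by
    have := Real.isLittleO_log_id_atTop.tendsto_div_nhds_zero
    simpa using this
  obtain ⟨ε, hε⟩ : ∃ ε : ℝ, ε = (4 * |P| + 1)⁻¹ := ⟨_, rfl⟩
  have hε0 : 0 < ε := by rw [hε]; positivity
  have e1 := h1.eventually_ge_atTop 1
  have e2 := h1.eventually_ge_atTop X0
  have e3 := h2.eventually (Iio_mem_nhds hη)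
  have hlt : (0:ℝ) < ε ^ (4/3:ℝ) := by positivity
  have h5 : Filter.Tendsto (fun L : ℝ => L ^ (-(1/3:ℝ)) * Real.log L) Filter.atTop (nhds 0) := by
    have := (isLittleO_log_rpow_atTop (r := (1/3:ℝ)) (by norm_num)).tendsto_div_nhds_zero
    refine this.congr' ?_
    filter_upwards [Filter.eventually_gt_atTop 0] with L hL
    rw [Real.rpow_neg hL.le]; field_simp
  have e4 := h5.eventually (Iio_mem_nhds hlt)
  obtain ⟨L0, hL0⟩ := Filter.eventually_atTop.1 (((Filter.eventually_ge_atTop 3).and e1).and (e2.and (e3.and e4)))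
  refine ⟨L0, fun L hL => ?_⟩
  obtain ⟨⟨a1, a2⟩, a3, a4, a5⟩ := hL0 L hL
  refine ⟨a1, a2, a3, le_of_lt a4, ?_⟩
  have hLp : 0 < L := by linarith
  have hlog : 0 < Real.log L := by linarith
  have h6 : (L ^ (-(1/3:ℝ)) * Real.log L) ^ (3/4:ℝ) ≤ ε := by
    calc _ ≤ (ε ^ (4/3:ℝ)) ^ (3/4:ℝ) := Real.rpow_le_rpow (by positivity) a5.le (by norm_num)
      _ = ε := by rw [← Real.rpow_mul hε0.le]; norm_num
  rw [Real.mul_rpow (by positivity) hlog.le, ← Real.rpow_mul hLp.le] at h6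
  have h7 : (Real.log L / L) ^ (-(3/4:ℝ)) = Real.sqrt L * (L ^ (-(1/3:ℝ) * (3/4)) * Real.log L ^ (3/4:ℝ))⁻¹ := by
    have e5 : Real.sqrt L * (L ^ (-(1/3:ℝ) * (3/4)))⁻¹ = L ^ (3/4:ℝ) := by
      rw [Real.sqrt_eq_rpow, ← Real.rpow_neg hLp.le, ← Real.rpow_add hLp]; norm_num
    rw [mul_inv, ← mul_assoc, e5, Real.rpow_neg (by positivity), Real.div_rpow hlog.le hLp.le, inv_div, div_eq_mul_inv]
  rw [h7]
  have h8 : 4 * P ≤ (L ^ (-(1/3:ℝ) * (3/4)) * Real.log L ^ (3/4:ℝ))⁻¹ := by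
    have : ε⁻¹ ≤ (L ^ (-(1/3:ℝ) * (3/4)) * Real.log L ^ (3/4:ℝ))⁻¹ := inv_anti₀ (by positivity) h6
    rw [hε, inv_inv] at this
    have := le_abs_self P
    linarith
  have := mul_le_mul_of_nonneg_left h8 (Real.sqrt_nonneg L)
  linarith

lemma prod_nsq_le (P : ℝ) (hP : 0 ≤ P) : ∃ C : ℝ, 0 ≤ C ∧ ∀ (T : ℕ → Finset ℕ) (Q : Finset ℕ) (n : ℕ → ℕ) (g : ℕ → ℝ) (j : ℕ), (∀ i, T i ⊆ T (i + 1)) →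
    T j ⊆ Q → (∀ i, ∀ p ∈ T i, p.Prime) → (∀ i ≤ j, 2 ≤ n i) → (∀ p, 0 ≤ g p ∧ g p ≤ P) →
    ∏ i ∈ Finset.range (j + 1), nsq (tex ℝ (n i) (blk (layer T i) (fun p => g p * (p:ℝ)^(-(1/2:ℝ)) / 2) (fun p => P * (p:ℝ)⁻¹ / 2))) ≤
      Real.exp C * Real.exp (1/4 * ∑ p ∈ Q, g p ^ 2 / p) := by
  obtain ⟨C, hC, h⟩ := nsq_block P hP
  have hsum : Summable (fun n : ℕ => ((n:ℝ) ^ 2)⁻¹) := Real.summable_nat_pow_inv.2 (by norm_num)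
  refine ⟨C * ∑' n : ℕ, ((n:ℝ) ^ 2)⁻¹, mul_nonneg hC (tsum_nonneg fun _ => by positivity), fun T Q n g j hT hQ hpr hn hg => ?_⟩
  have hy : ∀ p : ℕ, ((p:ℝ)^(-(1/2:ℝ)))^2 = (p:ℝ)⁻¹ := fun p => by
    rw [← Real.rpow_natCast, ← Real.rpow_mul (by positivity)]; norm_num; rw [Real.rpow_neg_one]
  have h1 : ∀ i ∈ Finset.range (j + 1), nsq (tex ℝ (n i) (blk (layer T i) (fun p => g p * (p:ℝ)^(-(1/2:ℝ)) / 2) (fun p => P * (p:ℝ)⁻¹ / 2))) ≤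
      Real.exp (∑ p ∈ layer T i, (1/4 * (g p ^ 2 / p) + C * ((p:ℝ)^2)⁻¹)) := by
    intro i hi
    have hi' : i ≤ j := by have := Finset.mem_range.1 hi; omega
    refine (h (layer T i) (fun p hp => hpr i p (layer_subset T i hp)) (n i) (hn i hi') _ _ (fun p => (p:ℝ)^(-(1/2:ℝ))) fun p hp => ?_).trans (le_of_eq ?_)
    · have hpp := hpr i p (layer_subset T i hp)
      have hp1 : (1:ℝ) ≤ p := by exact_mod_cast hpp.one_le
      obtain ⟨g0, g1⟩ := hg p
      have hyp : 0 ≤ (p:ℝ)^(-(1/2:ℝ)) := by positivity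
      refine ⟨by positivity, by positivity, hyp, Real.rpow_le_one_of_one_le_of_nonpos hp1 (by norm_num), ?_, ?_⟩
      · have := mul_le_mul_of_nonneg_right g1 hyp
        have := mul_nonneg hP hyp
        show g p * (p:ℝ)^(-(1/2:ℝ)) / 2 ≤ P * (p:ℝ)^(-(1/2:ℝ))
        have := mul_nonneg g0 hyp
        linarith
      · show P * (p:ℝ)⁻¹ / 2 ≤ P * ((p:ℝ)^(-(1/2:ℝ)))^2
        rw [hy]
        have : 0 ≤ P * (p:ℝ)⁻¹ := by positivity
        linarith
    · congr 1
      refine Finset.sum_congr rfl fun p _ => ?_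
      have e1 : ((p:ℝ)^(-(1/2:ℝ)))^4 = ((p:ℝ)^2)⁻¹ := by
        rw [show (4:ℕ) = 2 * 2 by norm_num, pow_mul, hy, inv_pow]
      show (g p * (p:ℝ)^(-(1/2:ℝ)) / 2) ^ 2 + C * ((p:ℝ)^(-(1/2:ℝ)))^4 = _
      rw [e1, div_pow, mul_pow, hy]; ring
  refine (Finset.prod_le_prod (fun i _ => nsq_nonneg _) h1).trans ?_
  rw [← Real.exp_sum, layer_sum hT, ← Real.exp_add]
  refine Real.exp_le_exp.2 ?_
  rw [Finset.sum_add_distrib, ← Finset.mul_sum, ← Finset.mul_sum, add_comm]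
  refine add_le_add (mul_le_mul_of_nonneg_left (hsum.sum_le_tsum _ fun _ _ => by positivity) hC) ?_
  refine mul_le_mul_of_nonneg_left (Finset.sum_le_sum_of_subset_of_nonneg hQ fun _ _ _ => by positivity) (by norm_num)

/-- Summation of the pointwise bounds. -/
lemma harper_sum {ι : Type*} [Fintype ι] (𝒳 : Finset ι) (J : ℕ) (G : ι → ℝ) (c W φ' E0 : ℝ) (hc : 0 ≤ c) (hW : 0 ≤ W) (hφ : 0 ≤ φ')
    (Ex R β K : ℕ → ℝ) (s : ℕ → ℕ) (hEx : ∀ l, 0 ≤ Ex l) (hK : ∀ i, 0 < K i)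
    (Fp : ι → ℕ → ℝ) (N : ι → ℕ → ℕ → ℝ) (hF0 : ∀ χ j, 0 ≤ Fp χ j) (hN0 : ∀ χ i l, 0 ≤ N χ i l)
    (hG : ∀ χ ∈ 𝒳, G χ ≤ c * (Ex J * Fp χ J + ∑ j ∈ Finset.range J, ∑ l ∈ Finset.Icc (j + 1) J, Ex j * (Fp χ j * (N χ (j + 1) l / K (j + 1)) ^ (2 * s (j + 1)))))
    (hm : ∑ χ, Fp χ J ≤ φ' * W)
    (hm2 : ∀ j < J, ∀ l ∈ Finset.Icc (j + 1) J, ∑ χ, Fp χ j * N χ (j + 1) l ^ (2 * s (j + 1)) ≤ φ' * W * R j)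
    (hE0 : Ex J ≤ E0)
    (hbad : ∀ j < J, Ex j * (R j * (K (j + 1) ^ (2 * s (j + 1)))⁻¹) ≤ 512 * β (j + 1) ^ 2)
    (htail : ∑ j ∈ Finset.range J, ((J - j : ℕ) : ℝ) * β (j + 1) ^ 2 ≤ 4) :
    ∑ χ ∈ 𝒳, G χ ≤ c * (φ' * W * (E0 + 2048)) := by
  have hnn : ∀ χ, 0 ≤ c * (Ex J * Fp χ J + ∑ j ∈ Finset.range J, ∑ l ∈ Finset.Icc (j + 1) J, Ex j * (Fp χ j * (N χ (j + 1) l / K (j + 1)) ^ (2 * s (j + 1)))) := by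
    intro χ
    refine mul_nonneg hc (add_nonneg (mul_nonneg (hEx _) (hF0 _ _)) (Finset.sum_nonneg fun j _ => Finset.sum_nonneg fun l _ => mul_nonneg (hEx _) (mul_nonneg (hF0 _ _) ?_)))
    exact pow_nonneg (div_nonneg (hN0 _ _ _) (hK _).le) _
  refine (Finset.sum_le_sum hG).trans ((Finset.sum_le_sum_of_subset_of_nonneg (Finset.subset_univ 𝒳) fun χ _ _ => hnn χ).trans ?_)
  rw [← Finset.mul_sum]
  refine mul_le_mul_of_nonneg_left ?_ hc
  rw [Finset.sum_add_distrib, ← Finset.mul_sum, mul_add]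
  refine add_le_add ?_ ?_
  · calc Ex J * ∑ χ, Fp χ J ≤ E0 * (φ' * W) := mul_le_mul hE0 hm (Finset.sum_nonneg fun _ _ => hF0 _ _) ((hEx J).trans hE0)
      _ = _ := by ring
  · rw [Finset.sum_comm]
    have h1 : ∀ j ∈ Finset.range J, ∑ χ, ∑ l ∈ Finset.Icc (j + 1) J, Ex j * (Fp χ j * (N χ (j + 1) l / K (j + 1)) ^ (2 * s (j + 1))) ≤
        (φ' * W * 512) * (((J - j : ℕ) : ℝ) * β (j + 1) ^ 2) := by
      intro j hj
      have hj' := Finset.mem_range.1 hj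
      rw [Finset.sum_comm]
      have h2 : ∀ l ∈ Finset.Icc (j + 1) J, ∑ χ, Ex j * (Fp χ j * (N χ (j + 1) l / K (j + 1)) ^ (2 * s (j + 1))) ≤ φ' * W * 512 * β (j + 1) ^ 2 := by
        intro l hl
        have h3 := hm2 j hj' l hl
        have hKp : 0 ≤ (K (j + 1) ^ (2 * s (j + 1)))⁻¹ := inv_nonneg.2 (pow_nonneg (hK _).le _)
        calc _ = Ex j * (K (j + 1) ^ (2 * s (j + 1)))⁻¹ * ∑ χ, Fp χ j * N χ (j + 1) l ^ (2 * s (j + 1)) := by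
              rw [Finset.mul_sum]
              refine Finset.sum_congr rfl fun χ _ => ?_
              rw [div_pow]; ring
          _ ≤ Ex j * (K (j + 1) ^ (2 * s (j + 1)))⁻¹ * (φ' * W * R j) := mul_le_mul_of_nonneg_left h3 (mul_nonneg (hEx _) hKp)
          _ = φ' * W * (Ex j * (R j * (K (j + 1) ^ (2 * s (j + 1)))⁻¹)) := by ring
          _ ≤ φ' * W * (512 * β (j + 1) ^ 2) := mul_le_mul_of_nonneg_left (hbad j hj') (mul_nonneg hφ hW)
          _ = _ := by ring
      refine (Finset.sum_le_sum h2).trans (le_of_eq ?_)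
      rw [Finset.sum_const, Nat.card_Icc, nsmul_eq_mul, show J + 1 - (j + 1) = J - j by omega]; ring
    refine (Finset.sum_le_sum h1).trans ?_
    rw [← Finset.mul_sum]
    calc _ ≤ (φ' * W * 512) * 4 := mul_le_mul_of_nonneg_left htail (by positivity)
      _ = _ := by ring


theorem harper (P C1 X0 : ℝ) (hP : 0 ≤ P) (hC1 : 0 ≤ C1) : ∃ (C : ℝ) (q0 : ℕ), 0 < C ∧ ∀ (q : ℕ) [NeZero q], q0 ≤ q →
    ∀ (𝒳 : Finset (DirichletCharacter ℂ q)) (G : DirichletCharacter ℂ q → ℝ) (C0 : ℝ) (u v : ℝ → ℕ → ℂ) (g : ℕ → ℝ), 0 ≤ C0 →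
    (∀ p, 0 ≤ g p ∧ g p ≤ P) →
    (∀ X, X0 ≤ X → ∀ p, ‖u X p‖ ≤ g p * (p:ℝ)^(-(1/2:ℝ)) ∧ ‖v X p‖ ≤ P * (p:ℝ)⁻¹) →
    (∀ χ ∈ 𝒳, ∀ X, X0 ≤ X → G χ ≤ C0 * Real.exp (C1 * Real.log q / X) *
      Real.exp (∑ p ∈ primesUpTo (Real.exp X), (u X p * χ p + v X p * χ p ^ 2)).re) →
    ∑ χ ∈ 𝒳, G χ ≤ C * Nat.totient q * C0 * Real.exp (1/4 * ∑ p ∈ primesUpTo q, g p ^ 2 / p) := by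
  classical
  obtain ⟨Ca, hCa, hprod⟩ := prod_nsq_le P hP
  obtain ⟨Cb, hCb, hpow⟩ := pow_block P hP
  obtain ⟨Cr, hCr, hrec⟩ := recip_sum
  obtain ⟨η1, hη1, hbn⟩ := bad_num (Cb * Cr) C1 (by positivity) hC1
  obtain ⟨η, hη⟩ : ∃ η : ℝ, η = min η1 ((1/140) ^ (4:ℕ)) := ⟨_, rfl⟩
  have hη0 : 0 < η := by rw [hη]; positivity
  have hηη1 : η ≤ η1 := by rw [hη]; exact min_le_left _ _
  have hη4 : η ≤ (1/140) ^ (4:ℕ) := by rw [hη]; exact min_le_right _ _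
  have hηone : η ≤ 1 := hη4.trans (by norm_num)
  obtain ⟨L0, hL0⟩ := harper_ev P X0 η hη0
  refine ⟨Real.exp 8 * (Real.exp Ca * (Real.exp (2 * C1 / η) + 2048)), ⌈Real.exp L0⌉₊ + 1, by positivity, ?_⟩
  intro q _ hq 𝒳 G C0 u v g hC0 hg huv hG
  obtain ⟨L, hL⟩ : ∃ L, L = Real.log q := ⟨_, rfl⟩
  have hqpos : (0:ℝ) < q := by exact_mod_cast Nat.pos_of_ne_zero (NeZero.ne q)
  have hqL : Real.exp L = q := by rw [hL, Real.exp_log hqpos]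
  have hL0L : L0 ≤ L := by
    rw [hL, Real.le_log_iff_exp_le hqpos]
    have h1 := Nat.le_ceil (Real.exp L0)
    have h2 : ((⌈Real.exp L0⌉₊ + 1 : ℕ) : ℝ) ≤ q := by exact_mod_cast hq
    push_cast at h2; linarith
  obtain ⟨hL3, hlog1, hX0L, hβη, hblock⟩ := hL0 L hL0L
  rw [← hL] at hG
  have hLpos : 0 < L := by linarith
  obtain ⟨β, hβ⟩ : ∃ β : ℕ → ℝ, ∀ i, β i = 2 ^ i * (Real.log L / L) := ⟨fun i => 2 ^ i * (Real.log L / L), fun _ => rfl⟩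
  have hβs : ∀ i, β (i + 1) = 2 * β i := fun i => by rw [hβ, hβ, pow_succ]; ring
  have hβ0' : β 0 = Real.log L / L := by rw [hβ]; simp
  have hβ0 : 0 < β 0 := by rw [hβ0']; exact div_pos (by linarith) hLpos
  have hβp := dy_pos hβs hβ0
  have hβzL : β 0 * L = Real.log L := by rw [hβ0']; field_simp
  obtain ⟨J, hJ1, hJ2⟩ := exists_nat_pow_near (x := η / β 0) (y := (2:ℝ)) (by rw [one_le_div hβ0, hβ0']; exact hβη) (by norm_num)
  rw [le_div_iff₀ hβ0, hβ0', ← hβ] at hJ1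
  rw [div_lt_iff₀ hβ0, hβ0', ← hβ, hβs] at hJ2
  have hβJ : ∀ i ≤ J, β i ≤ η := fun i hi => (dy_mono hβs hβ0 hi).trans hJ1
  have hβJ1 : β J ≤ 1 := hJ1.trans hηone
  obtain ⟨T, hT⟩ : ∃ T : ℕ → Finset ℕ, ∀ i, T i = primesUpTo (Real.exp (β i * L)) := ⟨fun i => primesUpTo (Real.exp (β i * L)), fun _ => rfl⟩
  have hTm : ∀ i, T i ⊆ T (i + 1) := fun i => by
    rw [hT, hT]
    refine primesUpTo_mono (Real.exp_le_exp.2 (mul_le_mul_of_nonneg_right (dy_mono hβs hβ0 (Nat.le_succ i)) hLpos.le))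
  have hTp : ∀ i, ∀ p ∈ T i, p.Prime ∧ (p:ℝ) ≤ Real.exp (β i * L) := fun i p hp => by
    rw [hT, mem_primesUpTo (Real.exp_pos _).le] at hp; exact hp
  have hSp : ∀ i, ∀ p ∈ layer T i, p.Prime ∧ (p:ℝ) ≤ Real.exp (β i * L) := fun i p hp => hTp i p (layer_subset T i hp)
  have hTQ : ∀ j ≤ J, T j ⊆ primesUpTo q := fun j hj => by
    rw [hT, ← hqL]
    refine primesUpTo_mono (Real.exp_le_exp.2 ?_)
    have := (hβJ j hj).trans hηone
    nlinarith
  have hXl : ∀ l, X0 ≤ β l * L := fun l => by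
    have : β 0 * L ≤ β l * L := mul_le_mul_of_nonneg_right (dy_mono hβs hβ0 (Nat.zero_le l)) hLpos.le
    linarith
  obtain ⟨K, hK⟩ : ∃ K : ℕ → ℝ, ∀ i, K i = β i ^ (-(3/4:ℝ)) := ⟨fun i => β i ^ (-(3/4:ℝ)), fun _ => rfl⟩
  have hKp : ∀ i, 0 < K i := fun i => by rw [hK]; have := hβp i; positivity
  have hK1 : ∀ i ≤ J, 1 ≤ K i := fun i hi => by
    rw [hK]; exact Real.one_le_rpow_of_pos_of_le_one_of_nonpos (hβp i) ((hβJ i hi).trans hηone) (by norm_num)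
  obtain ⟨n, hn⟩ : ∃ n : ℕ → ℕ, ∀ i, n i = ⌈4 * K i⌉₊ := ⟨fun i => ⌈4 * K i⌉₊, fun _ => rfl⟩
  have hn4 : ∀ i, 4 * K i ≤ n i := fun i => by rw [hn]; exact Nat.le_ceil _
  have hn5 : ∀ i ≤ J, (n i : ℝ) ≤ 5 * K i := fun i hi => by
    rw [hn]
    have := Nat.ceil_lt_add_one (a := 4 * K i) (by have := hKp i; positivity)
    have := hK1 i hi
    linarith
  have hn2 : ∀ i ≤ J, 2 ≤ n i := fun i hi => by
    have h1 := hn4 i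
    have h2 := hK1 i hi
    have : (2:ℝ) ≤ n i := by linarith
    exact_mod_cast this
  obtain ⟨s, hs⟩ : ∃ s : ℕ → ℕ, ∀ i, s i = ⌊1 / (8 * β i)⌋₊ := ⟨fun i => ⌊1 / (8 * β i)⌋₊, fun _ => rfl⟩
  obtain ⟨Pol, hPol⟩ : ∃ Pol : DirichletCharacter ℂ q → ℕ → ℕ → ℂ, ∀ χ i l, Pol χ i l = evc χ (cblk (layer T i) (u (β l * L)) (v (β l * L))) :=
    ⟨fun χ i l => evc χ (cblk (layer T i) (u (β l * L)) (v (β l * L))), fun _ _ _ => rfl⟩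
  -- coefficient bounds
  have huv' : ∀ l, ∀ p, ‖u (β l * L) p‖ ≤ g p * (p:ℝ)^(-(1/2:ℝ)) ∧ ‖v (β l * L) p‖ ≤ P * (p:ℝ)⁻¹ := fun l p => huv _ (hXl l) p
  have huv2 : ∀ l, ∀ p, ‖u (β l * L) p / 2‖ ≤ g p * (p:ℝ)^(-(1/2:ℝ)) / 2 ∧ ‖v (β l * L) p / 2‖ ≤ P * (p:ℝ)⁻¹ / 2 := fun l p => by
    rw [norm_div, norm_div, Complex.norm_ofNat]
    exact ⟨by linarith [(huv' l p).1], by linarith [(huv' l p).2]⟩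
  have hlen : ∀ j ≤ J, ∏ i ∈ Finset.range (j + 1), (Real.exp (β i * L) ^ 2) ^ n i ≤ Real.exp (L / 2) := fun j hj => by
    refine dy_len hβs hβ0 hLpos.le ?_ fun i hi => by rw [← hK]; exact hn5 i (hi.trans hj)
    calc β j ^ (1/4:ℝ) ≤ (((1:ℝ)/140) ^ (4:ℕ)) ^ (1/4:ℝ) := Real.rpow_le_rpow (hβp j).le ((hβJ j hj).trans hη4) (by norm_num)
      _ = 1/140 := by rw [← Real.rpow_natCast, ← Real.rpow_mul (by norm_num)]; norm_num
  obtain ⟨M, hM⟩ : ∃ M, M = Real.exp (1/4 * ∑ p ∈ primesUpTo q, g p ^ 2 / p) := ⟨_, rfl⟩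
  have hM0 : 0 < M := by rw [hM]; positivity
  have hnsq : ∀ j ≤ J, ∏ i ∈ Finset.range (j + 1), nsq (tex ℝ (n i) (blk (layer T i) (fun p => g p * (p:ℝ)^(-(1/2:ℝ)) / 2) (fun p => P * (p:ℝ)⁻¹ / 2))) ≤
      Real.exp Ca * M := fun j hj => by
    rw [hM]
    exact hprod T _ n g j hTm (hTQ j hj) (fun i p hp => (hTp i p hp).1) (fun i hi => hn2 i (hi.trans hj)) hg
  have hx1 : ∀ i, 1 ≤ Real.exp (β i * L) := fun i => Real.one_le_exp (mul_nonneg (hβp i).le hLpos.le)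
  have main := harper_sum 𝒳 J G (C0 * Real.exp 8) (Real.exp Ca * M) (Nat.totient q) (Real.exp (2 * C1 / η)) (by positivity) (by positivity) (by positivity)
    (fun l => Real.exp (C1 / β l)) (fun j => (s (j + 1) : ℝ) ^ s (j + 1) * Real.exp (Cb * Cr * s (j + 1))) β K s (fun _ => (Real.exp_pos _).le) hKp
    (fun χ j => ∏ i ∈ Finset.range (j + 1), ‖tex ℂ (n i) (Pol χ i j / 2)‖ ^ 2) (fun χ i l => ‖Pol χ i l‖) (fun χ j => Finset.prod_nonneg fun i _ => by positivity) (fun χ i l => norm_nonneg _)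
    ?_ ?_ ?_ ?_ ?_ (dy_tail hβs hβ0 hβJ1)
  · refine main.trans (le_of_eq ?_)
    rw [← hM]; ring
  · -- pointwise
    intro χ hχ
    refine harper_pt J (G χ) C0 hC0 (fun l => Real.exp (C1 / β l)) (fun _ => (Real.exp_pos _).le) (Pol χ) K n s 8 ?_ (fun i _ => hKp i) (fun i _ => hn4 i) hn2 ?_ ?_
    · intro l hl
      refine (hG χ hχ (β l * L) (hXl l)).trans (le_of_eq ?_)
      have e1 : C1 * L / (β l * L) = C1 / β l := by field_simp
      have e2 : ∑ i ∈ Finset.range (l + 1), Pol χ i l = ∑ p ∈ primesUpTo (Real.exp (β l * L)), (u (β l * L) p * χ p + v (β l * L) p * χ p ^ 2) := by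
        rw [← hT, ← layer_sum hTm]
        refine Finset.sum_congr rfl fun i _ => ?_
        rw [hPol, evc_cblk]
      rw [e1, e2]
    · intro l hl
      rw [hPol, evc_cblk]
      calc _ ≤ ∑ p ∈ layer T 0, (P * (p:ℝ)^(-(1/2:ℝ)) + P * (p:ℝ)⁻¹) := by
            refine norm_sum_le_of_le _ fun p hp => ?_
            have hχ1 : ‖χ p‖ ≤ 1 := DirichletCharacter.norm_le_one χ _
            obtain ⟨h1, h2⟩ := huv' l p
            have h3 : g p * (p:ℝ)^(-(1/2:ℝ)) ≤ P * (p:ℝ)^(-(1/2:ℝ)) := mul_le_mul_of_nonneg_right (hg p).2 (by positivity)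
            refine (norm_add_le _ _).trans (add_le_add ?_ ?_)
            · rw [norm_mul]
              calc _ ≤ ‖u (β l * L) p‖ * 1 := mul_le_mul_of_nonneg_left hχ1 (norm_nonneg _)
                _ ≤ _ := by linarith
            · rw [norm_mul, norm_pow]
              calc _ ≤ ‖v (β l * L) p‖ * 1 := mul_le_mul_of_nonneg_left (pow_le_one₀ (norm_nonneg _) hχ1) (norm_nonneg _)
                _ ≤ _ := by linarith
        _ = ∑ p ∈ primesUpTo L, (P * (p:ℝ)^(-(1/2:ℝ)) + P * (p:ℝ)⁻¹) := by
            rw [layer, hT, hβzL, Real.exp_log hLpos]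
        _ ≤ 4 * P * Real.sqrt L := block0 (by linarith) hP
        _ ≤ K 0 := by rw [hK, hβ0']; exact hblock
    · exact dy_D hβs hβ0 hβJ1 fun i _ => by rw [← hK]; exact hn4 i
  · -- all good moments
    have h1 := moment_lemma (q := q) (J + 1) (layer T) (fun i => Real.exp (β i * L)) n ∅ 1 0 (fun i _ => hSp i) (fun i _ => hx1 i) (by simp)
      (fun i _ j _ hij => layer_disj hTm hij) (fun i _ => by simp)
      (by
        rw [pow_zero, mul_one]
        refine (hlen J le_rfl).trans_lt ?_
        rw [← hqL]; exact Real.exp_lt_exp.2 (by linarith))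
      (fun p => u (β J * L) p / 2) (fun p => v (β J * L) p / 2) 0 0 _ _ 0 0 (huv2 J) (by simp)
    simp only [mul_zero, pow_zero, mul_one, nsq_one] at h1
    simp only [hPol, evc_cblk_half]
    exact h1.trans (mul_le_mul_of_nonneg_left (hnsq J le_rfl) (by positivity))
  · intro j hj l hl
    obtain ⟨hs1, hsb, -⟩ := hbn (β (j + 1)) (hβp _) ((hβJ (j + 1) hj).trans hηη1) (s (j + 1)) (hs _)
    have h1 := moment_lemma (q := q) (j + 1) (layer T) (fun i => Real.exp (β i * L)) n (layer T (j + 1)) (Real.exp (β (j + 1) * L)) (s (j + 1)) (fun i _ => hSp i) (fun i _ => hx1 i) (hSp _)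
      (fun i _ j _ hij => layer_disj hTm hij) (fun i hi => layer_disj hTm (by omega))
      (by
        calc _ ≤ Real.exp (L / 2) * Real.exp (L / 4) := by
              refine mul_le_mul (hlen j hj.le) ?_ (by positivity) (by positivity)
              rw [← pow_mul, ← Real.exp_nat_mul]
              refine Real.exp_le_exp.2 ?_
              push_cast
              nlinarith
          _ = Real.exp (3 * L / 4) := by rw [← Real.exp_add]; congr 1; ring
          _ < _ := by rw [← hqL]; exact Real.exp_lt_exp.2 (by linarith))
      (fun p => u (β j * L) p / 2) (fun p => v (β j * L) p / 2) (u (β l * L)) (v (β l * L)) _ _ _ _ (huv2 j) (huv' l)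
    have hxj : 3 ≤ Real.exp (β j * L) := by
      calc 3 ≤ Real.exp (β 0 * L) := by rw [hβzL, Real.exp_log hLpos]; exact hL3
        _ ≤ _ := Real.exp_le_exp.2 (mul_le_mul_of_nonneg_right (dy_mono hβs hβ0 (Nat.zero_le j)) hLpos.le)
    have h2 := hpow (layer T (j + 1)) (fun p hp => (hSp _ p hp).1) (s (j + 1)) hs1 (fun p hp => by
        rw [layer, Finset.mem_sdiff, hT j, mem_primesUpTo (Real.exp_pos _).le] at hp
        have hpx : Real.exp (β j * L) < p := by
          by_contra hh
          exact hp.2 ⟨(hTp _ p hp.1).1, not_lt.1 hh⟩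
        have hLx : L ≤ Real.exp (β j * L) := by
          calc L = Real.exp (β 0 * L) := by rw [hβzL, Real.exp_log hLpos]
            _ ≤ _ := Real.exp_le_exp.2 (mul_le_mul_of_nonneg_right (dy_mono hβs hβ0 (Nat.zero_le j)) hLpos.le)
        have hsL : (s (j + 1) : ℝ) ≤ L := by
          have h3 : β 0 ≤ β (j + 1) := dy_mono hβs hβ0 (Nat.zero_le _)
          have h4 : (s (j + 1) : ℝ) * β 0 ≤ 1 / 8 := le_trans (mul_le_mul_of_nonneg_left h3 (by positivity)) hsb
          have h5 : (s (j + 1) : ℝ) * β 0 ≤ L * β 0 := by rw [mul_comm L, hβzL]; linarith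
          exact le_of_mul_le_mul_right h5 hβ0
        have : (s (j + 1) : ℝ) ≤ p := by linarith
        exact_mod_cast this)
      (fun p => g p * (p:ℝ)^(-(1/2:ℝ))) (fun p => P * (p:ℝ)⁻¹) (fun p _ => ⟨mul_nonneg (hg p).1 (by positivity), by positivity, mul_le_mul_of_nonneg_right (hg p).2 (by positivity), le_rfl⟩)
    have h3 : ∑ p ∈ layer T (j + 1), (p:ℝ)⁻¹ ≤ Cr := by
      have h4 := hrec _ hxj
      have h5 : Real.exp (β j * L) ^ 2 = Real.exp (β (j + 1) * L) := by
        rw [← Real.exp_nat_mul, hβs]; congr 1; push_cast; ring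
      rw [h5, ← hT, ← hT] at h4
      exact h4
    have h4 : nsq (blk (layer T (j + 1)) (fun p => g p * (p:ℝ)^(-(1/2:ℝ))) (fun p => P * (p:ℝ)⁻¹) ^ s (j + 1)) ≤
        (s (j + 1) : ℝ) ^ s (j + 1) * Real.exp (Cb * Cr * s (j + 1)) := by
      refine h2.trans (mul_le_mul_of_nonneg_left (Real.exp_le_exp.2 ?_) (by positivity))
      calc Cb * s (j + 1) * ∑ p ∈ layer T (j + 1), (p:ℝ)⁻¹ ≤ Cb * s (j + 1) * Cr := mul_le_mul_of_nonneg_left h3 (by positivity)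
        _ = _ := by ring
    simp only [hPol, evc_cblk_half]
    refine h1.trans ?_
    rw [mul_assoc]
    refine mul_le_mul_of_nonneg_left ?_ (by positivity)
    exact mul_le_mul (hnsq j hj.le) h4 (nsq_nonneg _) (by positivity)
  · refine Real.exp_le_exp.2 ?_
    rw [div_le_div_iff₀ (hβp J) hη0]
    nlinarith
  · intro j hj
    obtain ⟨-, -, hb⟩ := hbn (β (j + 1)) (hβp _) ((hβJ (j + 1) hj).trans hηη1) (s (j + 1)) (hs _)
    have e1 : 2 * C1 / β (j + 1) = C1 / β j := by
      rw [hβs]; have := (hβp j).ne'; field_simp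
    rw [e1, ← hK] at hb
    exact hb


lemma prim_ne_one {q : ℕ} [NeZero q] (hq : 1 < q) {χ : DirichletCharacter ℂ q} (h : χ.IsPrimitive) : χ ≠ 1 := by
  rintro rfl
  rw [DirichletCharacter.isPrimitive_def, DirichletCharacter.conductor_one] at h
  omega

lemma prime_cpow_norm {p : ℕ} (hp : p.Prime) (t : ℝ) : ‖(p:ℂ)^(-(t*I))‖ = 1 := by
  have := Complex.norm_natCast_cpow_of_pos hp.pos (-(t*I))
  rw [this]; simp

lemma g_sq {ι : Type} [Fintype ι] (e t : ι → ℝ) {p : ℕ} (hp : p.Prime) :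
    ‖∑ a, (e a : ℂ) * (p:ℂ)^(-(t a*I))‖ ^ 2 = ∑ a, ∑ b, e a * e b * Real.cos ((t a - t b) * Real.log p) := by
  have h1 : (∑ a, (e a : ℂ) * (p:ℂ)^(-(t a*I))) * (starRingEnd ℂ) (∑ a, (e a : ℂ) * (p:ℂ)^(-(t a*I))) =
      ∑ a, ∑ b, ((e a * e b : ℝ) : ℂ) * (p:ℂ)^(-(((0:ℝ):ℂ) + ((t a - t b : ℝ):ℂ)*I)) := by
    rw [map_sum, Finset.sum_mul_sum]
    refine Finset.sum_congr rfl fun a _ => Finset.sum_congr rfl fun b _ => ?_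
    have hp0 : (p:ℂ) ≠ 0 := by exact_mod_cast hp.ne_zero
    have h2 : (starRingEnd ℂ) ((p:ℂ)^(-(t b*I))) = (p:ℂ)^(t b*I) := by
      rw [Complex.cpow_def_of_ne_zero hp0, Complex.cpow_def_of_ne_zero hp0, ← Complex.exp_conj, ← Complex.natCast_log]
      rw [map_mul, Complex.conj_ofReal]
      simp
    rw [map_mul, h2, Complex.conj_ofReal]
    have h3 : (p:ℂ)^(-(((0:ℝ):ℂ) + ((t a - t b : ℝ):ℂ)*I)) = (p:ℂ)^(-(t a*I)) * (p:ℂ)^(t b*I) := by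
      rw [← Complex.cpow_add _ _ hp0]; congr 1; push_cast; ring
    rw [h3]; push_cast; ring
  have h4 := congrArg Complex.re h1
  rw [Complex.mul_conj, Complex.ofReal_re, Complex.normSq_eq_norm_sq] at h4
  rw [h4, Complex.re_sum]
  refine Finset.sum_congr rfl fun a _ => ?_
  rw [Complex.re_sum]
  refine Finset.sum_congr rfl fun b _ => ?_
  rw [Complex.re_ofReal_mul, prime_cpow_re p hp]
  simp

theorem moment_app (P : ℝ) (hP : 0 ≤ P) : ∃ (C A' : ℝ) (q0 : ℕ), 0 < C ∧ 0 ≤ A' ∧ ∀ (q : ℕ) [NeZero q], q0 ≤ q → 3 ≤ q →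
    ∀ (𝒳 : Finset (DirichletCharacter ℂ q)), (∀ χ ∈ 𝒳, χ.IsPrimitive ∧ χ.Even ∧ dirichletRH χ) →
    ∀ (ι : Type) [Fintype ι] (e t : ι → ℝ) (τ : ℝ), (∀ a, 0 ≤ e a) → ∑ a, e a = P → (∀ a, |t a| ≤ |τ| + 1) → (∀ a b, |t a - t b| ≤ 1) →
    ∑ χ ∈ 𝒳, ∏ a, ‖DirichletCharacter.LFunction χ (1/2 + t a * I)‖ ^ e a ≤
      C * Nat.totient q * (4 + |τ|) ^ A' * Real.log q ^ (P ^ 2 / 4) * ∏ a, ∏ b, (1 + |t a - t b| * Real.log q) ^ (-(e a * e b / 4)) := by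
  classical
  obtain ⟨A, B, C, w1, w2, hA, hB, hC, hw, hkey⟩ := key_ineq2
  obtain ⟨Ch, q0, hCh, hharp⟩ := harper P (A / 2 * P) (4 * A) hP (by positivity)
  obtain ⟨Cc, hCc, hcos⟩ := prime_cos_sum
  refine ⟨Ch * (C + 1) ^ P * Real.exp (P ^ 2 / 4 * Cc), B * P, q0, by positivity, by positivity, ?_⟩
  intro q _ hq0 hq3 𝒳 h𝒳 ι _ e t τ he heP ht htt
  obtain ⟨L, hL⟩ : ∃ L, L = Real.log q := ⟨_, rfl⟩
  have hq3' : (3:ℝ) ≤ q := by exact_mod_cast hq3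
  have hLpos : 0 < L := by rw [hL]; exact Real.log_pos (by linarith)
  have main := hharp q hq0 𝒳 (fun χ => ∏ a, ‖DirichletCharacter.LFunction χ (1/2 + t a * I)‖ ^ e a) ((C + 1) ^ P * (4 + |τ|) ^ (B * P))
    (fun X p => if p.Prime then ∑ a, (e a : ℂ) * (p:ℂ)^(-(t a*I)) * w1 X p else 0)
    (fun X p => if p.Prime then ∑ a, (e a : ℂ) * ((p:ℂ)^(-(t a*I)))^2 * w2 X p else 0)
    (fun p => if p.Prime then ‖∑ a, (e a : ℂ) * (p:ℂ)^(-(t a*I))‖ else 0) (by positivity) ?_ ?_ ?_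
  · refine main.trans ?_
    have h1 : 1/4 * ∑ p ∈ primesUpTo q, (if p.Prime then ‖∑ a, (e a : ℂ) * (p:ℂ)^(-(t a*I))‖ else 0) ^ 2 / p ≤
        P ^ 2 / 4 * Real.log L + P ^ 2 / 4 * Cc + ∑ a, ∑ b, (-(e a * e b / 4)) * Real.log (1 + |t a - t b| * L) := by
      have h2 : ∑ p ∈ primesUpTo q, (if p.Prime then ‖∑ a, (e a : ℂ) * (p:ℂ)^(-(t a*I))‖ else 0) ^ 2 / p =
          ∑ a, ∑ b, e a * e b * ∑ p ∈ primesUpTo q, Real.cos ((t a - t b) * Real.log p) / p := by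
        calc _ = ∑ p ∈ primesUpTo q, ∑ a, ∑ b, e a * e b * (Real.cos ((t a - t b) * Real.log p) / p) := by
              refine Finset.sum_congr rfl fun p hp => ?_
              rw [mem_primesUpTo (by positivity)] at hp
              rw [if_pos hp.1, g_sq e t hp.1, Finset.sum_div]
              refine Finset.sum_congr rfl fun a _ => ?_
              rw [Finset.sum_div]
              refine Finset.sum_congr rfl fun b _ => ?_
              ring
          _ = _ := by
              rw [Finset.sum_comm]
              refine Finset.sum_congr rfl fun a _ => ?_
              rw [Finset.sum_comm]
              refine Finset.sum_congr rfl fun b _ => ?_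
              rw [Finset.mul_sum]
      have h3 : ∑ a, ∑ b, e a * e b * ∑ p ∈ primesUpTo q, Real.cos ((t a - t b) * Real.log p) / p ≤
          ∑ a, ∑ b, e a * e b * (Real.log L - Real.log (1 + |t a - t b| * L) + Cc) := by
        refine Finset.sum_le_sum fun a _ => Finset.sum_le_sum fun b _ => ?_
        refine mul_le_mul_of_nonneg_left ?_ (mul_nonneg (he a) (he b))
        rw [hL]
        exact hcos q (t a - t b) hq3' (htt a b)
      have h4 : ∑ a, ∑ b, e a * e b * (Real.log L - Real.log (1 + |t a - t b| * L) + Cc) =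
          P ^ 2 * (Real.log L + Cc) + 4 * ∑ a, ∑ b, (-(e a * e b / 4)) * Real.log (1 + |t a - t b| * L) := by
        rw [← heP, pow_two, Finset.sum_mul_sum, Finset.sum_mul, Finset.mul_sum, ← Finset.sum_add_distrib]
        refine Finset.sum_congr rfl fun a _ => ?_
        rw [Finset.sum_mul, Finset.mul_sum, ← Finset.sum_add_distrib]
        refine Finset.sum_congr rfl fun b _ => ?_
        ring
      rw [h2]
      linarith
    have h5 : ∏ a, ∏ b, (1 + |t a - t b| * L) ^ (-(e a * e b / 4)) = Real.exp (∑ a, ∑ b, (-(e a * e b / 4)) * Real.log (1 + |t a - t b| * L)) := by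
      rw [Real.exp_sum]
      refine Finset.prod_congr rfl fun a _ => ?_
      rw [Real.exp_sum]
      refine Finset.prod_congr rfl fun b _ => ?_
      rw [Real.rpow_def_of_pos (by positivity), mul_comm]
    have h6 : L ^ (P ^ 2 / 4) = Real.exp (P ^ 2 / 4 * Real.log L) := by
      rw [Real.rpow_def_of_pos hLpos, mul_comm]
    rw [← hL, h5, h6]
    calc _ ≤ Ch * (Nat.totient q) * ((C + 1) ^ P * (4 + |τ|) ^ (B * P)) * Real.exp (P ^ 2 / 4 * Real.log L + P ^ 2 / 4 * Cc + ∑ a, ∑ b, (-(e a * e b / 4)) * Real.log (1 + |t a - t b| * L)) :=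
          mul_le_mul_of_nonneg_left (Real.exp_le_exp.2 h1) (by positivity)
      _ = _ := by rw [Real.exp_add, Real.exp_add]; ring
  · intro p
    split_ifs with hp
    · refine ⟨norm_nonneg _, ?_⟩
      rw [← heP]
      refine norm_sum_le_of_le _ fun a _ => ?_
      rw [norm_mul, prime_cpow_norm hp, mul_one, Complex.norm_real, Real.norm_of_nonneg (he a)]
    · exact ⟨le_rfl, hP⟩
  · intro X hX p
    split_ifs with hp
    · obtain ⟨a1, a2, a3, a4⟩ := hw X (by linarith) p hp
      constructor
      · rw [← Finset.sum_mul, norm_mul, Complex.norm_real, Real.norm_of_nonneg a1]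
        exact mul_le_mul_of_nonneg_left a2 (norm_nonneg _)
      · rw [← heP, Finset.sum_mul]
        refine norm_sum_le_of_le _ fun a _ => ?_
        rw [norm_mul, norm_mul, norm_pow, prime_cpow_norm hp, one_pow, mul_one, Complex.norm_real, Complex.norm_real, Real.norm_of_nonneg (he a), Real.norm_of_nonneg a3]
        exact mul_le_mul_of_nonneg_left a4 (he a)
    · simp only [norm_zero, zero_mul, le_refl, true_and]
      positivity
  · intro χ hχ X hX
    obtain ⟨x1, x2, x3⟩ := h𝒳 χ hχ
    have hX0 : 0 < X := by linarith
    calc _ ≤ ∏ a, ((C + 1) ^ e a * (4 + |τ|) ^ (B * e a) * Real.exp (e a * (A / 2 * L / X)) *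
          Real.exp (e a * (∑ p ∈ primesUpTo (Real.exp X), (χ p * (p:ℂ)^(-(t a*I)) * w1 X p + (χ p * (p:ℂ)^(-(t a*I)))^2 * w2 X p)).re)) := by
          refine Finset.prod_le_prod (fun a _ => by positivity) fun a _ => ?_
          have h1 := hkey q χ (prim_ne_one (by omega) x1) x1 x2 x3 X hX (t a)
          rw [← hL] at h1
          have h2 : C * (3 + |t a|) ^ B ≤ (C + 1) * (4 + |τ|) ^ B := by
            refine mul_le_mul (by linarith) (Real.rpow_le_rpow (by positivity) (by linarith [ht a]) hB) (by positivity) (by positivity)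
          have h3 := h1.trans (mul_le_mul_of_nonneg_right (mul_le_mul_of_nonneg_right h2 (Real.exp_pos _).le) (Real.exp_pos _).le)
          refine (Real.rpow_le_rpow (norm_nonneg _) h3 (he a)).trans (le_of_eq ?_)
          rw [Real.mul_rpow (by positivity) (by positivity), Real.mul_rpow (by positivity) (by positivity), Real.mul_rpow (by positivity) (by positivity),
            ← Real.rpow_mul (by positivity), ← Real.exp_mul, ← Real.exp_mul, mul_comm (A / 2 * L / X), mul_comm _ (e a)]
          congr 2
          rw [mul_comm]
      _ = (C + 1) ^ P * (4 + |τ|) ^ (B * P) * Real.exp (A / 2 * P * L / X) * Real.exp (∑ a, e a * (∑ p ∈ primesUpTo (Real.exp X), (χ p * (p:ℂ)^(-(t a*I)) * w1 X p + (χ p * (p:ℂ)^(-(t a*I)))^2 * w2 X p)).re) := by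
          rw [Finset.prod_mul_distrib, Finset.prod_mul_distrib, Finset.prod_mul_distrib, ← Real.exp_sum, ← Real.exp_sum, ← Real.rpow_sum_of_pos (by positivity), ← Real.rpow_sum_of_pos (by positivity), ← Finset.mul_sum, ← Finset.sum_mul, heP]
          congr 3
          ring
      _ = _ := by
          rw [hL]
          congr 2
          have : ∀ (a : ι) (z : ℂ), e a * z.re = ((e a : ℂ) * z).re := fun a z => by rw [Complex.re_ofReal_mul]
          simp only [this]
          rw [← Complex.re_sum]
          congr 1
          simp only [Finset.mul_sum]
          rw [Finset.sum_comm]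
          refine Finset.sum_congr rfl fun p hp => ?_
          rw [mem_primesUpTo (Real.exp_pos _).le] at hp
          rw [if_pos hp.1, if_pos hp.1, Finset.sum_mul, Finset.sum_mul, ← Finset.sum_add_distrib]
          refine Finset.sum_congr rfl fun a _ => ?_
          ring


lemma dist_sum_le (c : ℝ) (hc : 1 < c) : ∃ Z : ℝ, 0 < Z ∧ ∀ (N : ℕ) (x : Fin N),
    ∑ y : Fin N, (1 + |((x:ℕ):ℝ) - ((y:ℕ):ℝ)|) ^ (-c) ≤ Z := by
  have hs : Summable fun n : ℕ => ((n:ℝ) + 1) ^ (-c) := by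
    have := (Real.summable_nat_rpow (p := -c)).2 (by linarith)
    have h2 := (summable_nat_add_iff 1).2 this
    refine h2.congr fun n => ?_
    push_cast; rfl
  have hnn : ∀ n : ℕ, 0 ≤ ((n:ℝ) + 1) ^ (-c) := fun n => by positivity
  refine ⟨2 * (∑' n : ℕ, ((n:ℝ) + 1) ^ (-c)) + 1, ?_, ?_⟩
  · have : 0 ≤ ∑' n : ℕ, ((n:ℝ) + 1) ^ (-c) := tsum_nonneg hnn
    positivity
  intro N x
  rw [Fin.sum_univ_eq_sum_range (fun y => (1 + |((x:ℕ):ℝ) - (y:ℝ)|) ^ (-c)) N]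
  rw [← Finset.sum_filter_add_sum_filter_not (Finset.range N) (fun y => y ≤ (x:ℕ))]
  have h1 : ∑ y ∈ (Finset.range N).filter (fun y => y ≤ (x:ℕ)), (1 + |((x:ℕ):ℝ) - (y:ℝ)|) ^ (-c) ≤ ∑' n : ℕ, ((n:ℝ) + 1) ^ (-c) := by
    calc _ = ∑ y ∈ (Finset.range N).filter (fun y => y ≤ (x:ℕ)), ((((x:ℕ) - y : ℕ):ℝ) + 1) ^ (-c) := by
          refine Finset.sum_congr rfl fun y hy => ?_
          rw [Finset.mem_filter] at hy
          have : (y:ℝ) ≤ ((x:ℕ):ℝ) := by exact_mod_cast hy.2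
          rw [Nat.cast_sub hy.2, abs_of_nonneg (by linarith), add_comm]
      _ = ∑ n ∈ ((Finset.range N).filter (fun y => y ≤ (x:ℕ))).image (fun y => (x:ℕ) - y), ((n:ℝ) + 1) ^ (-c) := by
          rw [Finset.sum_image]
          intro a ha b hb hab
          simp only [Finset.coe_filter, Finset.mem_range, Set.mem_ofPred_eq] at ha hb hab
          omega
      _ ≤ _ := hs.sum_le_tsum _ fun n _ => hnn n
  have h2 : ∑ y ∈ (Finset.range N).filter (fun y => ¬ y ≤ (x:ℕ)), (1 + |((x:ℕ):ℝ) - (y:ℝ)|) ^ (-c) ≤ ∑' n : ℕ, ((n:ℝ) + 1) ^ (-c) := by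
    calc _ = ∑ y ∈ (Finset.range N).filter (fun y => ¬ y ≤ (x:ℕ)), (((y - (x:ℕ) : ℕ):ℝ) + 1) ^ (-c) := by
          refine Finset.sum_congr rfl fun y hy => ?_
          rw [Finset.mem_filter] at hy
          have h3 : (x:ℕ) ≤ y := by omega
          have : ((x:ℕ):ℝ) ≤ (y:ℝ) := by exact_mod_cast h3
          rw [Nat.cast_sub h3, abs_of_nonpos (by linarith), add_comm]
          ring_nf
      _ = ∑ n ∈ ((Finset.range N).filter (fun y => ¬ y ≤ (x:ℕ))).image (fun y => y - (x:ℕ)), ((n:ℝ) + 1) ^ (-c) := by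
          rw [Finset.sum_image]
          intro a ha b hb hab
          simp only [Finset.coe_filter, Finset.mem_range, Set.mem_ofPred_eq] at ha hb hab
          omega
      _ ≤ _ := hs.sum_le_tsum _ fun n _ => hnn n
  linarith

lemma star_lemma {ι : Type} [Fintype ι] [DecidableEq ι] (F : ι → ι → ℝ) (w : ι → ℝ) (hw : ∀ a, 0 ≤ w a) (hc : 1 < ∑ a, w a)
    (hF : ∀ a b, a ≠ b → w a + w b ≤ 2 * F a b) : ∃ K : ℝ, 0 < K ∧ ∀ N : ℕ,
    ∑ j : ι → Fin N, ∏ a, ∏ b, (1 + |((j a:ℕ):ℝ) - ((j b:ℕ):ℝ)|) ^ (-(F a b)) ≤ K * N := by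
  obtain ⟨c, hcd⟩ : ∃ c, c = ∑ a, w a := ⟨_, rfl⟩
  rw [← hcd] at hc
  obtain ⟨Z, hZ, hZs⟩ := dist_sum_le c hc
  refine ⟨Z ^ Fintype.card ι, by positivity, ?_⟩
  intro N
  obtain ⟨D, hD⟩ : ∃ D : Fin N → Fin N → ℝ, ∀ x y, D x y = 1 + |((x:ℕ):ℝ) - ((y:ℕ):ℝ)| := ⟨_, fun _ _ => rfl⟩
  have hZs' : ∀ x : Fin N, ∑ y : Fin N, D x y ^ (-c) ≤ Z := fun x => by simp only [hD]; exact hZs N x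
  simp only [← hD]
  have hD1 : ∀ x y, 1 ≤ D x y := fun x y => by rw [hD]; linarith [abs_nonneg (((x:ℕ):ℝ) - ((y:ℕ):ℝ))]
  have hDs : ∀ x y, D x y = D y x := fun x y => by rw [hD, hD, abs_sub_comm]
  have hD0 : ∀ x y, 0 < D x y := fun x y => by linarith [hD1 x y]
  have hDd : ∀ x, D x x = 1 := fun x => by rw [hD]; simp
  have hpt : ∀ j : ι → Fin N, ∏ a, ∏ b, (D (j a) (j b)) ^ (-(F a b)) ≤ ∑ a, (w a / c) * ∏ b, D (j a) (j b) ^ (-c) := by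
    intro j
    have e1 : ∏ a, ∏ b, (D (j a) (j b)) ^ (-(F a b)) ≤ ∏ a, ∏ b, ((D (j a) (j b)) ^ (-(w a / 2)) * (D (j a) (j b)) ^ (-(w b / 2))) := by
      refine Finset.prod_le_prod (fun a _ => Finset.prod_nonneg fun b _ => (Real.rpow_pos_of_pos (hD0 _ _) _).le) fun a _ =>
        Finset.prod_le_prod (fun b _ => (Real.rpow_pos_of_pos (hD0 _ _) _).le) fun b _ => ?_
      rw [← Real.rpow_add (hD0 _ _)]
      by_cases hab : a = b
      · subst hab; rw [hDd]; simp
      · exact Real.rpow_le_rpow_of_exponent_le (hD1 _ _) (by linarith [hF a b hab])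
    have e2 : ∏ a, ∏ b, ((D (j a) (j b)) ^ (-(w a / 2)) * (D (j a) (j b)) ^ (-(w b / 2))) = ∏ a, (∏ b, D (j a) (j b) ^ (-c)) ^ (w a / c) := by
      simp only [Finset.prod_mul_distrib]
      rw [Finset.prod_comm (f := fun a b => (D (j a) (j b)) ^ (-(w b / 2)))]
      rw [← Finset.prod_mul_distrib]
      refine Finset.prod_congr rfl fun a _ => ?_
      rw [← Finset.prod_mul_distrib, ← Real.finsetProd_rpow _ _ (fun b _ => (Real.rpow_pos_of_pos (hD0 _ _) _).le)]
      refine Finset.prod_congr rfl fun b _ => ?_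
      rw [hDs (j b) (j a), ← Real.rpow_add (hD0 _ _), ← Real.rpow_mul (hD0 _ _).le]
      congr 1
      field_simp
      ring
    have e3 := Real.geom_mean_le_arith_mean_weighted Finset.univ (fun a => w a / c) (fun a => ∏ b, D (j a) (j b) ^ (-c))
      (fun a _ => div_nonneg (hw a) (by linarith)) (by rw [← Finset.sum_div, ← hcd]; exact div_self (by linarith))
      (fun a _ => Finset.prod_nonneg fun b _ => (Real.rpow_pos_of_pos (hD0 _ _) _).le)
    exact e1.trans (e2.le.trans e3)
  have hone : ∀ a : ι, ∑ j : ι → Fin N, ∏ b, D (j a) (j b) ^ (-c) ≤ Z ^ Fintype.card ι * N := by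
    intro a
    calc _ ≤ ∑ j : ι → Fin N, ∑ x : Fin N, ∏ b, D x (j b) ^ (-c) := by
          refine Finset.sum_le_sum fun j _ => ?_
          exact Finset.single_le_sum (f := fun x => ∏ b, D x (j b) ^ (-c)) (fun x _ => Finset.prod_nonneg fun b _ => (Real.rpow_pos_of_pos (hD0 _ _) _).le) (Finset.mem_univ (j a))
      _ = ∑ x : Fin N, ∏ _b : ι, ∑ y : Fin N, D x y ^ (-c) := by
          rw [Finset.sum_comm]
          refine Finset.sum_congr rfl fun x _ => ?_
          rw [Finset.prod_univ_sum, Fintype.piFinset_univ]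
      _ ≤ ∑ x : Fin N, Z ^ Fintype.card ι := by
          refine Finset.sum_le_sum fun x _ => ?_
          rw [Finset.prod_const, Finset.card_univ]
          exact pow_le_pow_left₀ (Finset.sum_nonneg fun y _ => (Real.rpow_pos_of_pos (hD0 _ _) _).le) (hZs' x) _
      _ = _ := by simp [mul_comm]
  calc _ ≤ ∑ j : ι → Fin N, ∑ a, (w a / c) * ∏ b, D (j a) (j b) ^ (-c) := Finset.sum_le_sum fun j _ => hpt j
    _ = ∑ a, (w a / c) * ∑ j : ι → Fin N, ∏ b, D (j a) (j b) ^ (-c) := by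
        rw [Finset.sum_comm]
        simp only [Finset.mul_sum]
    _ ≤ ∑ a, (w a / c) * (Z ^ Fintype.card ι * N) := Finset.sum_le_sum fun a _ =>
        mul_le_mul_of_nonneg_left (hone a) (div_nonneg (hw a) (by linarith))
    _ = _ := by rw [← Finset.sum_mul, ← Finset.sum_div, ← hcd, div_self (by linarith), one_mul]

lemma grid_moment {ι : Type} [Fintype ι] [DecidableEq ι] (e : ι → ℝ) (P : ℝ) (he : ∀ a, 0 ≤ e a) (heP : ∑ a, e a = P) (G : ι → ι → ℝ)
    (w : ι → ℝ) (hw : ∀ a, 0 ≤ w a) (hc : 1 < ∑ a, w a)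
    (hF : ∀ a b, a ≠ b → w a + w b ≤ 2 * (e a * e b / 4 + G a b)) :
    ∃ (C A' : ℝ) (q0 : ℕ), 0 < C ∧ 0 ≤ A' ∧ ∀ (q : ℕ) [NeZero q], q0 ≤ q → 3 ≤ q →
    ∀ (𝒳 : Finset (DirichletCharacter ℂ q)), (∀ χ ∈ 𝒳, χ.IsPrimitive ∧ χ.Even ∧ dirichletRH χ) →
    ∀ (N : ℕ) (τ : ℝ), (N:ℝ) ≤ Real.log q + 1 →
    ∑ χ ∈ 𝒳, ∑ j : ι → Fin N, (∏ a, ‖DirichletCharacter.LFunction χ (1/2 + ((τ + ((j a:ℕ):ℝ) / Real.log q : ℝ):ℂ) * I)‖ ^ e a) *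
      ∏ a, ∏ b, (1 + |((j a:ℕ):ℝ) - ((j b:ℕ):ℝ)|) ^ (-(G a b)) ≤
    C * Nat.totient q * (4 + |τ|) ^ A' * Real.log q ^ (P ^ 2 / 4) * N := by
  have hP : 0 ≤ P := by rw [← heP]; exact Finset.sum_nonneg fun a _ => he a
  obtain ⟨C, A', q0, hC, hA', hmom⟩ := moment_app P hP
  obtain ⟨K, hK, hstar⟩ := star_lemma (fun a b => e a * e b / 4 + G a b) w hw hc hF
  refine ⟨C * K, A', q0, by positivity, hA', ?_⟩
  intro q _ hq0 hq3 𝒳 h𝒳 N τ hN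
  have hq3' : (3:ℝ) ≤ q := by exact_mod_cast hq3
  have hL : 0 < Real.log q := Real.log_pos (by linarith)
  rw [Finset.sum_comm]
  have hlt : ∀ x : Fin N, 0 ≤ ((x:ℕ):ℝ) / Real.log q ∧ ((x:ℕ):ℝ) / Real.log q ≤ 1 := by
    intro x
    refine ⟨by positivity, ?_⟩
    rw [div_le_one hL]
    have : ((x:ℕ):ℝ) + 1 ≤ N := by exact_mod_cast x.2
    linarith
  calc _ ≤ ∑ j : ι → Fin N, C * Nat.totient q * (4 + |τ|) ^ A' * Real.log q ^ (P ^ 2 / 4) *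
        ∏ a, ∏ b, (1 + |((j a:ℕ):ℝ) - ((j b:ℕ):ℝ)|) ^ (-(e a * e b / 4 + G a b)) := by
        refine Finset.sum_le_sum fun j _ => ?_
        rw [← Finset.sum_mul]
        have h1 := hmom q hq0 hq3 𝒳 h𝒳 ι e (fun a => τ + ((j a:ℕ):ℝ) / Real.log q) τ he heP
          (fun a => (abs_add_le _ _).trans (by rw [abs_of_nonneg (hlt (j a)).1]; linarith [(hlt (j a)).2]))
          (fun a b => by rw [abs_le]; constructor <;> linarith [hlt (j a), hlt (j b)])
        refine (mul_le_mul_of_nonneg_right h1 (by positivity)).trans (le_of_eq ?_)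
        rw [mul_assoc]
        congr 1
        rw [← Finset.prod_mul_distrib]
        refine Finset.prod_congr rfl fun a _ => ?_
        rw [← Finset.prod_mul_distrib]
        refine Finset.prod_congr rfl fun b _ => ?_
        have h2 : |τ + ((j a:ℕ):ℝ) / Real.log q - (τ + ((j b:ℕ):ℝ) / Real.log q)| * Real.log q = |((j a:ℕ):ℝ) - ((j b:ℕ):ℝ)| := by
          rw [add_sub_add_left_eq_sub, ← sub_div, abs_div, abs_of_pos hL, div_mul_cancel₀ _ hL.ne']
        rw [h2, ← Real.rpow_add (by positivity)]
        congr 1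
        ring
    _ ≤ C * Nat.totient q * (4 + |τ|) ^ A' * Real.log q ^ (P ^ 2 / 4) * (K * N) := by
        rw [← Finset.mul_sum]
        exact mul_le_mul_of_nonneg_left (hstar N) (by positivity)
    _ = _ := by ring


lemma rpow_le_one_add {x δ : ℝ} (hx : 0 ≤ x) (h0 : 0 ≤ δ) (h1 : δ ≤ 1) : x ^ δ ≤ 1 + x := by
  rcases le_total x 1 with h | h
  · linarith [Real.rpow_le_one hx h h0]
  · have := Real.rpow_le_rpow_of_exponent_le h h1
    rw [Real.rpow_one] at this
    linarith

lemma split_pt {m : ℕ} (hm : 1 ≤ m) {p δ : ℝ} (h0 : 0 ≤ δ) (h1 : δ ≤ 1) (hp : p = m + δ) {A S r : ℝ} (hA : 0 ≤ A) (hS : 0 ≤ S) (hr : 0 < r) :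
    A * S ^ δ ≤ A ^ (p / m) * r ^ δ + A ^ ((p - 1) / m) * r ^ (δ - 1) * S := by
  rcases hA.eq_or_lt with h | hA
  · rw [← h]
    rw [zero_mul]
    positivity
  have hm0 : (0:ℝ) < m := by exact_mod_cast hm
  obtain ⟨g, hg⟩ : ∃ g, g = A ^ (1 / (m:ℝ)) := ⟨_, rfl⟩
  have hgp : 0 < g := by rw [hg]; positivity
  have e1 : A = g ^ (m:ℝ) := by rw [hg, ← Real.rpow_mul hA.le, one_div_mul_cancel hm0.ne', Real.rpow_one]
  have e2 : A ^ (p / m) = g ^ p := by rw [hg, ← Real.rpow_mul hA.le]; congr 1; ring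
  have e3 : A ^ ((p - 1) / m) = g ^ (p - 1) := by rw [hg, ← Real.rpow_mul hA.le]; congr 1; ring
  rw [e2, e3, e1]
  have h2 := rpow_le_one_add (x := S / (g * r)) (by positivity) h0 h1
  rw [Real.div_rpow hS (by positivity), div_le_iff₀ (by positivity)] at h2
  refine (mul_le_mul_of_nonneg_left h2 (by positivity)).trans (le_of_eq ?_)
  rw [hp, Real.mul_rpow hgp.le hr.le, Real.rpow_add hgp, Real.rpow_sub_one hr.ne', Real.rpow_sub_one hgp.ne', Real.rpow_add hgp]
  field_simp

lemma det_ineq {m N : ℕ} (hm : 1 ≤ m) {p δ : ℝ} (h0 : 0 ≤ δ) (h1 : δ ≤ 1) (hp : p = m + δ) (a : Fin N → ℝ) (ha : ∀ x, 0 ≤ a x)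
    (r : (Fin m → Fin N) → ℝ) (hr : ∀ j, 0 < r j) :
    (∑ x, a x) ^ p ≤ ∑ j : Fin m → Fin N, (∏ i, a (j i) ^ (p / m)) * r j ^ δ +
      ∑ j : Option (Fin m) → Fin N, (∏ i, a (j i) ^ ((i.elim 1 fun _ => (p - 1) / m : ℝ))) * r (fun i => j (some i)) ^ (δ - 1) := by
  have hS : 0 ≤ ∑ x, a x := Finset.sum_nonneg fun x _ => ha x
  have hm0 : (0:ℝ) < m := by exact_mod_cast hm
  have e1 : (∑ x, a x) ^ p = ∑ j : Fin m → Fin N, (∏ i, a (j i)) * (∑ x, a x) ^ δ := by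
    rw [← Finset.sum_mul]
    have : ∑ j : Fin m → Fin N, (∏ i, a (j i)) = (∑ x, a x) ^ m := by
      have := Finset.prod_univ_sum (fun _ : Fin m => (Finset.univ : Finset (Fin N))) (fun _ x => a x)
      rw [Fintype.piFinset_univ] at this
      rw [← this]; simp
    rw [this, hp, Real.rpow_add_of_nonneg hS hm0.le h0, Real.rpow_natCast]
  have e2 : ∑ j : Option (Fin m) → Fin N, (∏ i, a (j i) ^ ((i.elim 1 fun _ => (p - 1) / m : ℝ))) * r (fun i => j (some i)) ^ (δ - 1) =
      ∑ j : Fin m → Fin N, (∏ i, a (j i) ^ ((p - 1) / m)) * r j ^ (δ - 1) * ∑ x, a x := by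
    rw [← (Equiv.piOptionEquivProd (β := fun _ => Fin N)).symm.sum_comp, Fintype.sum_prod_type, Finset.sum_comm]
    refine Finset.sum_congr rfl fun j _ => ?_
    rw [Finset.mul_sum]
    refine Finset.sum_congr rfl fun x _ => ?_
    rw [Fintype.prod_option]
    simp [Equiv.piOptionEquivProd]
    ring
  rw [e1, e2, ← Finset.sum_add_distrib]
  refine Finset.sum_le_sum fun j _ => ?_
  rw [Real.finsetProd_rpow _ _ (fun i _ => ha _), Real.finsetProd_rpow _ _ (fun i _ => ha _)]
  exact split_pt hm h0 h1 hp (Finset.prod_nonneg fun i _ => ha _) hS (hr j)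

theorem grid_sum (p : ℝ) (hp : 4 < p) :
    ∃ (C A' : ℝ) (q0 : ℕ), 0 < C ∧ 0 ≤ A' ∧ ∀ (q : ℕ) [NeZero q], q0 ≤ q → 3 ≤ q →
    ∀ (𝒳 : Finset (DirichletCharacter ℂ q)), (∀ χ ∈ 𝒳, χ.IsPrimitive ∧ χ.Even ∧ dirichletRH χ) →
    ∀ (N : ℕ) (τ : ℝ), (N:ℝ) ≤ Real.log q + 1 →
    ∑ χ ∈ 𝒳, (∑ x : Fin N, ‖DirichletCharacter.LFunction χ (1/2 + ((τ + ((x:ℕ):ℝ) / Real.log q : ℝ):ℂ) * I)‖) ^ p ≤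
    C * Nat.totient q * (4 + |τ|) ^ A' * Real.log q ^ (p ^ 2 / 4) * N := by
  obtain ⟨m, hmd⟩ : ∃ m, m = ⌊p⌋₊ := ⟨_, rfl⟩
  obtain ⟨δ, hδ⟩ : ∃ δ, δ = p - m := ⟨_, rfl⟩
  have hδ0 : 0 ≤ δ := by
    rw [hδ, hmd]; linarith [Nat.floor_le (show 0 ≤ p by linarith)]
  have hδ1 : δ < 1 := by
    rw [hδ, hmd]; linarith [Nat.lt_floor_add_one p]
  have hm4 : 4 ≤ m := by rw [hmd]; exact Nat.le_floor (by push_cast; linarith)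
  have hm4' : (4:ℝ) ≤ m := by exact_mod_cast hm4
  have hpd : p = m + δ := by linarith
  have hm0 : (0:ℝ) < m := by linarith
  -- first family
  have hc1 : 1 < (m:ℝ) * ((p / m) * (p / m) / 4 - δ / 10) := by
    have : (m:ℝ) * ((p / m) * (p / m) / 4 - δ / 10) = (m:ℝ)/4 + δ/2 + δ^2/(4*m) - m*δ/10 := by
      rw [hpd]; field_simp; ring
    rw [this]
    rcases hm4.eq_or_lt with h | h
    · have h4 : (m:ℝ) = 4 := by rw [← h]; norm_num
      rw [h4]
      have : 0 < δ := by rw [h4] at hpd; linarith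
      have : 0 ≤ δ^2/(4*4) := by positivity
      linarith
    · have h5 : (5:ℝ) ≤ m := by exact_mod_cast h
      have : 0 ≤ δ^2/(4*m) := by positivity
      nlinarith
  obtain ⟨C1, A1, q1, hC1, hA1, hm1⟩ := grid_moment (ι := Fin m) (fun _ => p / m) p (fun _ => by positivity)
    (by simp; field_simp) (fun _ _ => -(δ / 10)) (fun _ => (p / m) * (p / m) / 4 - δ / 10)
    (fun _ => by by_contra hcon; push Not at hcon; nlinarith) (by rw [Finset.sum_const, Finset.card_univ, Fintype.card_fin, nsmul_eq_mul]; exact hc1)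
    (fun a b _ => by linarith)
  -- second family
  obtain ⟨η, hη⟩ : ∃ η, η = 1 - δ := ⟨_, rfl⟩
  obtain ⟨s, hs⟩ : ∃ s, s = (p - 1) / m := ⟨_, rfl⟩
  have hsη : s = 1 - η / m := by rw [hs, hη, hpd]; field_simp; ring
  have hη0 : 0 < η := by linarith
  have hη1 : η ≤ 1 := by linarith
  have hηm : η / m ≤ η / 4 := div_le_div_of_nonneg_left hη0.le (by norm_num) hm4'
  have hηm0 : 0 < η / m := by positivity
  have hs1 : 1 - η / 4 ≤ s := by linarith
  have hs2 : s ≤ 1 := by linarith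
  have hww : 0 ≤ s * s / 4 + η / 10 := by
    have := mul_self_nonneg s
    linarith
  have hwu : 0 ≤ s / 2 - (s * s / 4 + η / 10) := by nlinarith
  have hc2 : 1 < (s / 2 - (s * s / 4 + η / 10)) + m * (s * s / 4 + η / 10) := by
    nlinarith [mul_nonneg (show (0:ℝ) ≤ m - 4 by linarith) hww]
  obtain ⟨C2, A2, q2, hC2, hA2, hm2⟩ := grid_moment (ι := Option (Fin m)) (fun a => a.elim 1 fun _ => (p - 1) / m) p
    (fun a => by cases a <;> simp <;> exact div_nonneg (by linarith) hm0.le)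
    (by rw [Fintype.sum_option]; simp; field_simp; ring)
    (fun a b => a.elim 0 fun _ => b.elim 0 fun _ => η / 10)
    (fun a => a.elim (s / 2 - (s * s / 4 + η / 10)) fun _ => s * s / 4 + η / 10)
    (fun a => by cases a; exact hwu; exact hww)
    (by rw [Fintype.sum_option]; simp only [Option.elim_none, Option.elim_some]; rw [Finset.sum_const, Finset.card_univ, Fintype.card_fin, nsmul_eq_mul]; exact hc2)
    (fun a b hab => by
      rw [← hs]
      cases a <;> cases b <;> simp at hab ⊢ <;> linarith)
  refine ⟨C1 + C2, max A1 A2, max q1 q2, by positivity, le_max_of_le_left hA1, ?_⟩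
  intro q _ hq0 hq3 𝒳 h𝒳 N τ hN
  have b1 := hm1 q (le_of_max_le_left hq0) hq3 𝒳 h𝒳 N τ hN
  have b2 := hm2 q (le_of_max_le_right hq0) hq3 𝒳 h𝒳 N τ hN
  have hq3' : (3:ℝ) ≤ q := by exact_mod_cast hq3
  have hL : 0 < Real.log q := Real.log_pos (by linarith)
  calc _ ≤ _ := Finset.sum_le_sum fun χ _ => det_ineq (by omega : 1 ≤ m) hδ0 hδ1.le hpd
          (fun x : Fin N => ‖DirichletCharacter.LFunction χ (1/2 + ((τ + ((x:ℕ):ℝ) / Real.log q : ℝ):ℂ) * I)‖) (fun x => norm_nonneg _)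
          (fun j => ∏ a, ∏ b, (1 + |((j a:ℕ):ℝ) - ((j b:ℕ):ℝ)|) ^ (1/10:ℝ))
          (fun j => Finset.prod_pos fun a _ => Finset.prod_pos fun b _ => by positivity)
    _ ≤ C1 * Nat.totient q * (4 + |τ|) ^ A1 * Real.log q ^ (p ^ 2 / 4) * N + C2 * Nat.totient q * (4 + |τ|) ^ A2 * Real.log q ^ (p ^ 2 / 4) * N := by
        rw [Finset.sum_add_distrib]
        refine add_le_add (le_trans (le_of_eq ?_) b1) (le_trans (le_of_eq ?_) b2)
        · refine Finset.sum_congr rfl fun χ _ => Finset.sum_congr rfl fun j _ => ?_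
          congr 1
          rw [← Real.finsetProd_rpow _ _ (fun a _ => by positivity)]
          refine Finset.prod_congr rfl fun a _ => ?_
          rw [← Real.finsetProd_rpow _ _ (fun a _ => by positivity)]
          refine Finset.prod_congr rfl fun b _ => ?_
          rw [← Real.rpow_mul (by positivity)]
          congr 1; ring
        · refine Finset.sum_congr rfl fun χ _ => Finset.sum_congr rfl fun j _ => ?_
          congr 1
          rw [Fintype.prod_option]
          simp only [Fintype.prod_option, Option.elim_none, Option.elim_some, neg_zero, Real.rpow_zero, Finset.prod_const_one, one_mul]
          rw [← Real.finsetProd_rpow _ _ (fun a _ => by positivity)]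
          refine Finset.prod_congr rfl fun a _ => ?_
          rw [← Real.finsetProd_rpow _ _ (fun a _ => by positivity)]
          refine Finset.prod_congr rfl fun b _ => ?_
          rw [← Real.rpow_mul (by positivity)]
          congr 1; rw [hη]; ring
    _ ≤ C1 * Nat.totient q * (4 + |τ|) ^ (max A1 A2) * Real.log q ^ (p ^ 2 / 4) * N + C2 * Nat.totient q * (4 + |τ|) ^ (max A1 A2) * Real.log q ^ (p ^ 2 / 4) * N := by
        have h4 : 1 ≤ 4 + |τ| := by linarith [abs_nonneg τ]
        have x1 := Real.rpow_le_rpow_of_exponent_le h4 (le_max_left A1 A2)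
        have x2 := Real.rpow_le_rpow_of_exponent_le h4 (le_max_right A1 A2)
        gcongr
    _ = _ := by ring


lemma weight_integrable {F : ℝ → ℝ} (hF : Continuous F) {K r : ℝ} {M : ℕ} (hM : r + 2 ≤ M)
    (hb : ∀ t, |F t| ≤ K * (1 + |t|) ^ r) : MeasureTheory.Integrable (fun t : ℝ => F t * ((1 + |t|) ^ M)⁻¹) := by
  have h0 : MeasureTheory.Integrable (fun t : ℝ => K * (1 + ‖t‖) ^ (-(2:ℝ))) :=
    (integrable_one_add_norm (E := ℝ) (by simp)).const_mul K
  refine h0.mono' (Continuous.aestronglyMeasurable ?_) (Filter.Eventually.of_forall fun t => ?_)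
  · refine hF.mul (Continuous.inv₀ (by fun_prop) fun t => by positivity)
  · have h1 : (0:ℝ) < 1 + |t| := by positivity
    have hK : 0 ≤ K := by
      have := (abs_nonneg _).trans (hb t)
      exact nonneg_of_mul_nonneg_left this (by positivity)
    rw [norm_mul, Real.norm_eq_abs, Real.norm_eq_abs, Real.norm_eq_abs, abs_of_nonneg (a := ((1 + |t|) ^ M)⁻¹) (by positivity)]
    calc _ ≤ K * (1 + |t|) ^ r * ((1 + |t|) ^ M)⁻¹ := mul_le_mul_of_nonneg_right (hb t) (by positivity)
      _ = K * (1 + |t|) ^ (r - M) := by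
          rw [Real.rpow_sub h1, Real.rpow_natCast]; ring
      _ ≤ _ := mul_le_mul_of_nonneg_left (Real.rpow_le_rpow_of_exponent_le (by linarith [abs_nonneg t]) (by linarith)) hK

lemma young_lite {p I W J : ℝ} (hp : 1 < p) (hI : 0 ≤ I) (hW : 0 < W) (hJ : 0 ≤ J)
    (h : ∀ l : ℝ, 0 < l → I ≤ l * W + l ^ (1 - p) * J) : I ^ p ≤ 2 ^ p * W ^ (p - 1) * J := by
  rcases hI.eq_or_lt with h0 | h0
  · rw [← h0, Real.zero_rpow (by linarith)]; positivity
  have h1 := h (I / (2 * W)) (by positivity)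
  have h2 : I / (2 * W) * W = I / 2 := by field_simp
  rw [h2] at h1
  have h3 : I / 2 ≤ (I / (2 * W)) ^ (1 - p) * J := by linarith
  have h4 : (I / (2 * W)) ^ (1 - p) = (2 * W) ^ (p - 1) / I ^ (p - 1) := by
    rw [show 1 - p = -(p - 1) by ring, Real.rpow_neg (by positivity), Real.div_rpow h0.le (by positivity), inv_div]
  rw [h4, div_mul_eq_mul_div, le_div_iff₀ (by positivity), Real.mul_rpow (by norm_num) hW.le] at h3
  have h5 : I ^ p = I * I ^ (p - 1) := by rw [Real.rpow_sub_one h0.ne']; field_simp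
  have h6 : (2:ℝ) ^ p = 2 * 2 ^ (p - 1) := by rw [Real.rpow_sub_one (by norm_num)]; field_simp
  rw [h5, h6]
  linarith

lemma x_le_young {p x l : ℝ} (hp : 1 < p) (hx : 0 ≤ x) (hl : 0 < l) : x ≤ l + l ^ (1 - p) * x ^ p := by
  rcases le_total x l with h | h
  · have : 0 ≤ l ^ (1 - p) * x ^ p := by positivity
    linarith
  · have hx0 : 0 < x := by linarith
    have h1 : (1:ℝ) ≤ (x / l) ^ (p - 1) := Real.one_le_rpow ((one_le_div hl).2 h) (by linarith)
    have h2 : l ^ (1 - p) * x ^ p = x * (x / l) ^ (p - 1) := by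
      rw [Real.div_rpow hx0.le hl.le, show 1 - p = -(p - 1) by ring, Real.rpow_neg hl.le, Real.rpow_sub_one hx0.ne']
      field_simp
    rw [h2]
    nlinarith

lemma Lnorm_cont {q : ℕ} [NeZero q] {χ : DirichletCharacter ℂ q} (hχ : χ ≠ 1) (h : ℝ) :
    Continuous fun t : ℝ => ‖DirichletCharacter.LFunction χ (1/2 + ((t + h : ℝ):ℂ) * I)‖ := by
  have := (DirichletCharacter.differentiable_LFunction hχ).continuous
  fun_prop

lemma Lnorm_bd {q : ℕ} [NeZero q] {χ : DirichletCharacter ℂ q} (hχ : χ ≠ 1) (t : ℝ) {h : ℝ} (h0 : 0 ≤ h) (h1 : h ≤ 1) :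
    ‖DirichletCharacter.LFunction χ (1/2 + ((t + h : ℝ):ℂ) * I)‖ ≤ 64 * q * (1 + |t|) := by
  refine (L_growth hχ (by simp; norm_num)).trans ?_
  have : ‖(1/2 + ((t + h : ℝ):ℂ) * I)‖ ≤ 2 * (1 + |t|) := by
    refine (norm_add_le _ _).trans ?_
    rw [norm_mul, Complex.norm_I, Complex.norm_real, Real.norm_eq_abs]
    have := abs_add_le t h
    rw [abs_of_nonneg h0] at this
    norm_num
    linarith [abs_nonneg t]
  have hq : (0:ℝ) ≤ 32 * q := by positivity
  nlinarith

lemma weight_shift (t : ℝ) {h : ℝ} (M : ℕ) (h0 : 0 ≤ h) (h1 : h ≤ 1) : ((1 + |t + h|) ^ M)⁻¹ ≤ 2 ^ M * ((1 + |t|) ^ M)⁻¹ := by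
  have h2 : 1 + |t| ≤ 2 * (1 + |t + h|) := by
    have := abs_sub (t + h) h
    rw [add_sub_cancel_right, abs_of_nonneg h0] at this
    linarith [abs_nonneg (t + h)]
  have h3 := pow_le_pow_left₀ (by positivity) h2 M
  rw [mul_pow] at h3
  rw [inv_le_iff_one_le_mul₀ (by positivity), mul_assoc, mul_comm, mul_assoc, ← mul_comm (2 ^ M)]
  rw [← one_mul (1:ℝ)] at *
  have h4 : (0:ℝ) < (1 + |t|) ^ M := by positivity
  simp only [one_mul] at *
  rw [inv_mul_eq_div, le_div_iff₀ h4]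
  linarith

/-- Averaging over the grid. -/
lemma grid_avg {q : ℕ} [NeZero q] {χ : DirichletCharacter ℂ q} (hχ : χ ≠ 1) (N M : ℕ) (hM : 3 ≤ M) (g : Fin N → ℝ) (hg : ∀ x, 0 ≤ g x ∧ g x ≤ 1) :
    N * ∫ t : ℝ, ‖DirichletCharacter.LFunction χ (1/2 + t * I)‖ * ((1 + |t|) ^ M)⁻¹ ≤
      2 ^ M * ∫ t : ℝ, (∑ x : Fin N, ‖DirichletCharacter.LFunction χ (1/2 + ((t + g x : ℝ):ℂ) * I)‖) * ((1 + |t|) ^ M)⁻¹ := by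
  have hM' : (3:ℝ) ≤ M := by exact_mod_cast hM
  have hIntg : ∀ h : ℝ, 0 ≤ h → h ≤ 1 → MeasureTheory.Integrable (fun t : ℝ => ‖DirichletCharacter.LFunction χ (1/2 + ((t + h : ℝ):ℂ) * I)‖ * ((1 + |t|) ^ M)⁻¹) := by
    intro h h0 h1
    refine weight_integrable (Lnorm_cont hχ h) (K := 64 * q) (r := 1) (by linarith) fun t => ?_
    rw [abs_of_nonneg (norm_nonneg _), Real.rpow_one]
    exact Lnorm_bd hχ t h0 h1
  have h1 : ∀ x : Fin N, ∫ t : ℝ, ‖DirichletCharacter.LFunction χ (1/2 + t * I)‖ * ((1 + |t|) ^ M)⁻¹ ≤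
      2 ^ M * ∫ t : ℝ, ‖DirichletCharacter.LFunction χ (1/2 + ((t + g x : ℝ):ℂ) * I)‖ * ((1 + |t|) ^ M)⁻¹ := by
    intro x
    have e1 := MeasureTheory.integral_add_right_eq_self (μ := MeasureTheory.volume) (fun t : ℝ => ‖DirichletCharacter.LFunction χ (1/2 + t * I)‖ * ((1 + |t|) ^ M)⁻¹) (g x)
    rw [← e1, ← MeasureTheory.integral_const_mul]
    refine MeasureTheory.integral_mono ?_ ((hIntg _ (hg x).1 (hg x).2).const_mul _) fun t => ?_
    · have := hIntg 0 le_rfl zero_le_one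
      simp only [add_zero] at this
      exact this.comp_add_right (g x)
    · dsimp only
      rw [mul_left_comm]
      exact mul_le_mul_of_nonneg_left (weight_shift t M (hg x).1 (hg x).2) (norm_nonneg _)
  calc _ = ∑ x : Fin N, ∫ t : ℝ, ‖DirichletCharacter.LFunction χ (1/2 + t * I)‖ * ((1 + |t|) ^ M)⁻¹ := by simp
    _ ≤ ∑ x : Fin N, 2 ^ M * ∫ t : ℝ, ‖DirichletCharacter.LFunction χ (1/2 + ((t + g x : ℝ):ℂ) * I)‖ * ((1 + |t|) ^ M)⁻¹ := Finset.sum_le_sum fun x _ => h1 x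
    _ = _ := by
        rw [← Finset.mul_sum, ← MeasureTheory.integral_finsetSum _ (fun x _ => hIntg _ (hg x).1 (hg x).2)]
        simp only [Finset.sum_mul]


theorem moment_large (k : ℝ) (hk : 2 < k) : ∃ (C : ℝ) (q0 : ℕ), 0 < C ∧ ∀ (q : ℕ) [NeZero q], q0 ≤ q →
    ∀ (𝒳 : Finset (DirichletCharacter ℂ q)), (∀ χ ∈ 𝒳, χ.IsPrimitive ∧ χ.Even ∧ dirichletRH χ) →
    ∑ χ ∈ 𝒳, ‖dirichletTheta χ 1‖ ^ (2 * k) ≤ C * (Nat.totient q) * (q : ℝ) ^ (k / 2) * Real.log q ^ ((k - 1) ^ 2) := by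
  obtain ⟨p, hp⟩ : ∃ p, p = 2 * k := ⟨_, rfl⟩
  have hp4 : 4 < p := by linarith
  obtain ⟨C1, A', q0, hC1, hA', hgrid⟩ := grid_sum p hp4
  obtain ⟨M, hMd⟩ : ∃ M, M = ⌈A'⌉₊ + ⌈p⌉₊ + 3 := ⟨_, rfl⟩
  have hM3 : 3 ≤ M := by omega
  have hMA : A' + 2 ≤ M := by
    rw [hMd]; push_cast; linarith [Nat.le_ceil A', Nat.cast_nonneg (α := ℝ) ⌈p⌉₊]
  have hMp : p + 2 ≤ M := by
    rw [hMd]; push_cast; linarith [Nat.le_ceil p, Nat.cast_nonneg (α := ℝ) ⌈A'⌉₊]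
  have hM3' : (3:ℝ) ≤ M := by exact_mod_cast hM3
  obtain ⟨Ct, hCt, htheta⟩ := theta_le_integral M hM3
  have hWi : MeasureTheory.Integrable (fun t : ℝ => (1:ℝ) * ((1 + |t|) ^ M)⁻¹) :=
    weight_integrable (F := fun _ => 1) continuous_const (K := 1) (r := 0) (by linarith) fun t => by simp
  obtain ⟨W, hW⟩ : ∃ W, W = 1 + ∫ t : ℝ, (1:ℝ) * ((1 + |t|) ^ M)⁻¹ := ⟨_, rfl⟩
  have hW0 : 0 ≤ ∫ t : ℝ, (1:ℝ) * ((1 + |t|) ^ M)⁻¹ := MeasureTheory.integral_nonneg fun t => by positivity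
  have hWp : 0 < W := by linarith
  have hVi : MeasureTheory.Integrable (fun t : ℝ => (4 + |t|) ^ A' * ((1 + |t|) ^ M)⁻¹) := by
    refine weight_integrable (F := fun t => (4 + |t|) ^ A') (Continuous.rpow_const (by fun_prop) fun t => Or.inr hA') (K := 4 ^ A') (r := A') hMA fun t => ?_
    rw [abs_of_nonneg (by positivity), ← Real.mul_rpow (by norm_num) (by positivity)]
    exact Real.rpow_le_rpow (by positivity) (by linarith [abs_nonneg t]) hA'
  obtain ⟨V, hV⟩ : ∃ V, V = 1 + ∫ t : ℝ, (4 + |t|) ^ A' * ((1 + |t|) ^ M)⁻¹ := ⟨_, rfl⟩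
  have hV0 : 0 ≤ ∫ t : ℝ, (4 + |t|) ^ A' * ((1 + |t|) ^ M)⁻¹ := MeasureTheory.integral_nonneg fun t => by positivity
  have hVp : 0 < V := by linarith
  refine ⟨Ct ^ p * (2 ^ M) ^ p * (2 ^ p * W ^ (p - 1)) * (C1 * V), max q0 3, by positivity, ?_⟩
  intro q _ hq 𝒳 h𝒳
  have hq3 : 3 ≤ q := le_of_max_le_right hq
  have hq3' : (3:ℝ) ≤ q := by exact_mod_cast hq3
  obtain ⟨L, hL⟩ : ∃ L, L = Real.log q := ⟨_, rfl⟩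
  have hLp : 0 < L := by rw [hL]; exact Real.log_pos (by linarith)
  obtain ⟨N, hN⟩ : ∃ N, N = ⌈L⌉₊ := ⟨_, rfl⟩
  have hN1 : L ≤ N := by rw [hN]; exact Nat.le_ceil L
  have hN2 : (N:ℝ) ≤ L + 1 := by rw [hN]; exact (Nat.ceil_lt_add_one hLp.le).le
  have hNp : (0:ℝ) < N := by linarith
  obtain ⟨S, hS⟩ : ∃ S : DirichletCharacter ℂ q → ℝ → ℝ, ∀ χ t, S χ t = ∑ x : Fin N, ‖DirichletCharacter.LFunction χ (1/2 + ((t + ((x:ℕ):ℝ) / L : ℝ):ℂ) * I)‖ := ⟨_, fun _ _ => rfl⟩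
  have hg : ∀ x : Fin N, 0 ≤ ((x:ℕ):ℝ) / L ∧ ((x:ℕ):ℝ) / L ≤ 1 := by
    intro x
    refine ⟨by positivity, ?_⟩
    rw [div_le_one hLp]
    have : ((x:ℕ):ℝ) + 1 ≤ N := by exact_mod_cast x.2
    linarith
  have hS0 : ∀ χ t, 0 ≤ S χ t := fun χ t => by rw [hS]; exact Finset.sum_nonneg fun x _ => norm_nonneg _
  have hne : ∀ χ ∈ 𝒳, χ ≠ 1 := fun χ hχ => prim_ne_one (by omega) (h𝒳 χ hχ).1
  have hSc : ∀ χ ∈ 𝒳, Continuous (S χ) := by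
    intro χ hχ
    have : S χ = fun t => ∑ x : Fin N, ‖DirichletCharacter.LFunction χ (1/2 + ((t + ((x:ℕ):ℝ) / L : ℝ):ℂ) * I)‖ := funext (hS χ)
    rw [this]
    exact continuous_finsetSum _ fun x _ => Lnorm_cont (hne χ hχ) _
  have hSb : ∀ χ ∈ 𝒳, ∀ t, S χ t ≤ N * (64 * q) * (1 + |t|) := by
    intro χ hχ t
    rw [hS]
    refine (Finset.sum_le_card_nsmul _ _ (64 * q * (1 + |t|)) fun x _ => Lnorm_bd (hne χ hχ) t (hg x).1 (hg x).2).trans (le_of_eq ?_)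
    rw [Finset.card_univ, Fintype.card_fin, nsmul_eq_mul]; ring
  have hSi : ∀ χ ∈ 𝒳, MeasureTheory.Integrable (fun t : ℝ => S χ t * ((1 + |t|) ^ M)⁻¹) := by
    intro χ hχ
    refine weight_integrable (hSc χ hχ) (K := N * (64 * q)) (r := 1) (by linarith) fun t => ?_
    rw [abs_of_nonneg (hS0 χ t), Real.rpow_one]
    exact hSb χ hχ t
  have hSpi : ∀ χ ∈ 𝒳, MeasureTheory.Integrable (fun t : ℝ => S χ t ^ p * ((1 + |t|) ^ M)⁻¹) := by
    intro χ hχ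
    refine weight_integrable (F := fun t => S χ t ^ p) ((hSc χ hχ).rpow_const fun t => Or.inr (by linarith)) (K := (N * (64 * q)) ^ p) (r := p) hMp fun t => ?_
    have := hS0 χ t
    rw [abs_of_nonneg (by positivity), ← Real.mul_rpow (by positivity) (by positivity)]
    exact Real.rpow_le_rpow this (hSb χ hχ t) (by linarith)
  have hJ0 : ∀ χ, 0 ≤ ∫ t : ℝ, S χ t ^ p * ((1 + |t|) ^ M)⁻¹ := fun χ => MeasureTheory.integral_nonneg fun t => by
    have := hS0 χ t
    positivity
  have hI0 : ∀ χ, 0 ≤ ∫ t : ℝ, S χ t * ((1 + |t|) ^ M)⁻¹ := fun χ => MeasureTheory.integral_nonneg fun t => by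
    have := hS0 χ t
    positivity
  have hIJ : ∀ χ ∈ 𝒳, (∫ t : ℝ, S χ t * ((1 + |t|) ^ M)⁻¹) ^ p ≤ 2 ^ p * W ^ (p - 1) * ∫ t : ℝ, S χ t ^ p * ((1 + |t|) ^ M)⁻¹ := by
    intro χ hχ
    refine young_lite (by linarith) (hI0 χ) hWp (hJ0 χ) fun l hl => ?_
    have e1 : ∫ t : ℝ, S χ t * ((1 + |t|) ^ M)⁻¹ ≤ ∫ t : ℝ, (l * (1 * ((1 + |t|) ^ M)⁻¹) + l ^ (1 - p) * (S χ t ^ p * ((1 + |t|) ^ M)⁻¹)) := by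
      refine MeasureTheory.integral_mono (hSi χ hχ) ((hWi.const_mul _).add ((hSpi χ hχ).const_mul _)) fun t => ?_
      have h1 := mul_le_mul_of_nonneg_right (x_le_young (p := p) (by linarith) (hS0 χ t) hl) (show 0 ≤ ((1 + |t|) ^ M)⁻¹ by positivity)
      dsimp only
      linarith
    rw [MeasureTheory.integral_add (hWi.const_mul _) ((hSpi χ hχ).const_mul _), MeasureTheory.integral_const_mul l, MeasureTheory.integral_const_mul (l ^ (1 - p))] at e1
    rw [hW, mul_add]
    linarith
  have hJsum : ∑ χ ∈ 𝒳, ∫ t : ℝ, S χ t ^ p * ((1 + |t|) ^ M)⁻¹ ≤ C1 * Nat.totient q * L ^ (p ^ 2 / 4) * N * V := by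
    rw [← MeasureTheory.integral_finsetSum _ hSpi]
    have e1 : ∫ t : ℝ, ∑ χ ∈ 𝒳, S χ t ^ p * ((1 + |t|) ^ M)⁻¹ ≤ ∫ t : ℝ, C1 * Nat.totient q * L ^ (p ^ 2 / 4) * N * ((4 + |t|) ^ A' * ((1 + |t|) ^ M)⁻¹) := by
      refine MeasureTheory.integral_mono (MeasureTheory.integrable_finsetSum _ hSpi) (hVi.const_mul _) fun t => ?_
      dsimp only
      rw [← Finset.sum_mul]
      have h1 := hgrid q (le_of_max_le_left hq) hq3 𝒳 h𝒳 N t (by rw [← hL]; exact hN2)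
      rw [← hL] at h1
      simp only [← hS] at h1
      refine (mul_le_mul_of_nonneg_right h1 (by positivity)).trans (le_of_eq ?_)
      ring
    rw [MeasureTheory.integral_const_mul] at e1
    refine e1.trans (mul_le_mul_of_nonneg_left (by linarith) (by positivity))
  have hth : ∀ χ ∈ 𝒳, ‖dirichletTheta χ 1‖ ^ p ≤ Ct ^ p * (2 ^ M) ^ p * (2 ^ p * W ^ (p - 1)) * (q:ℝ) ^ (p / 4) * (N:ℝ) ^ (-p) * ∫ t : ℝ, S χ t ^ p * ((1 + |t|) ^ M)⁻¹ := by
    intro χ hχ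
    have h1 := (htheta q (by omega) χ (hne χ hχ) (h𝒳 χ hχ).2.1).2
    have h2 := grid_avg (hne χ hχ) N M hM3 (fun x => ((x:ℕ):ℝ) / L) hg
    simp only [← hS] at h2
    rw [mul_comm, ← le_div_iff₀ hNp] at h2
    have h3 := h1.trans (mul_le_mul_of_nonneg_left h2 (by positivity))
    have h4 := Real.rpow_le_rpow (norm_nonneg _) h3 (show 0 ≤ p by linarith)
    refine h4.trans ?_
    have hI := hI0 χ
    rw [Real.mul_rpow (by positivity) (by positivity), Real.mul_rpow (by positivity) (by positivity), Real.div_rpow (by positivity) (by positivity),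
      Real.mul_rpow (by positivity) (by positivity), ← Real.rpow_mul (by positivity), Real.rpow_neg hNp.le, show (1:ℝ)/4*p = p/4 by ring]
    have h5 := mul_le_mul_of_nonneg_left (hIJ χ hχ) (show 0 ≤ Ct ^ p * (q:ℝ) ^ (p / 4) * (2 ^ M) ^ p * ((N:ℝ) ^ p)⁻¹ by positivity)
    refine le_trans (le_of_eq ?_) (h5.trans (le_of_eq ?_)) <;> ring
  rw [← hp, ← hL]
  calc _ ≤ _ := Finset.sum_le_sum hth
    _ ≤ Ct ^ p * (2 ^ M) ^ p * (2 ^ p * W ^ (p - 1)) * (q:ℝ) ^ (p / 4) * (N:ℝ) ^ (-p) * (C1 * Nat.totient q * L ^ (p ^ 2 / 4) * N * V) := by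
        rw [← Finset.mul_sum]
        exact mul_le_mul_of_nonneg_left hJsum (by positivity)
    _ = Ct ^ p * (2 ^ M) ^ p * (2 ^ p * W ^ (p - 1)) * (C1 * V) * Nat.totient q * (q:ℝ) ^ (k / 2) * (L ^ (p ^ 2 / 4) * (N:ℝ) ^ (1 - p)) := by
        rw [show p / 4 = k / 2 by rw [hp]; ring, show 1 - p = -p + 1 by ring, Real.rpow_add hNp, Real.rpow_one]
        ring
    _ ≤ _ := by
        refine mul_le_mul_of_nonneg_left ?_ (by positivity)
        have h1 : (N:ℝ) ^ (1 - p) ≤ L ^ (1 - p) := Real.rpow_le_rpow_of_nonpos hLp hN1 (by linarith)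
        refine (mul_le_mul_of_nonneg_left h1 (by positivity)).trans (le_of_eq ?_)
        rw [← Real.rpow_add hLp]
        congr 1
        rw [hp]; ring

open Classical in
lemma moment_each (k : ℝ) (q : ℕ) : ∃ B : ℝ, 0 ≤ B ∧ ∀ [NeZero q], 1 < q →
    ∑ χ ∈ Finset.univ.filter (fun χ : DirichletCharacter ℂ q => χ.IsPrimitive ∧ χ (-1) = 1), ‖dirichletTheta χ 1‖ ^ (2 * k) ≤
      B * (Nat.totient q) * (q : ℝ) ^ (k / 2) * Real.log q ^ ((k - 1) ^ 2) := by
  by_cases hq : 1 < q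
  · haveI : NeZero q := ⟨by omega⟩
    have hq' : (1:ℝ) < q := by exact_mod_cast hq
    have hR : 0 < (Nat.totient q) * (q : ℝ) ^ (k / 2) * Real.log q ^ ((k - 1) ^ 2) := by
      have h1 : (0:ℝ) < Nat.totient q := by exact_mod_cast Nat.totient_pos.2 (by omega)
      have h2 := Real.log_pos hq'
      positivity
    refine ⟨(∑ χ ∈ Finset.univ.filter (fun χ : DirichletCharacter ℂ q => χ.IsPrimitive ∧ χ (-1) = 1), ‖dirichletTheta χ 1‖ ^ (2 * k)) / ((Nat.totient q) * (q : ℝ) ^ (k / 2) * Real.log q ^ ((k - 1) ^ 2)), ?_, ?_⟩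
    · exact div_nonneg (Finset.sum_nonneg fun χ _ => by positivity) hR.le
    · intro _ _
      rw [mul_assoc, mul_assoc, ← mul_assoc (Nat.totient q : ℝ), div_mul_cancel₀ _ hR.ne']
  · exact ⟨0, le_rfl, fun h => absurd h hq⟩

open Classical in
theorem stmt1 (k : ℝ) (hk : 2 < k) :
    ∃ C : ℝ, 0 < C ∧ ∀ (q : ℕ) [NeZero q], 1 < q →
      (∀ χ : DirichletCharacter ℂ q, dirichletRH χ) →
      ∑ χ ∈ Finset.univ.filter
          (fun χ : DirichletCharacter ℂ q => χ.IsPrimitive ∧ χ (-1) = 1),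
        ‖dirichletTheta χ 1‖ ^ (2 * k)
      ≤ C * (Nat.totient q) * (q : ℝ) ^ (k / 2) * Real.log q ^ ((k - 1) ^ 2) := by
  obtain ⟨C, q0, hC, hlarge⟩ := moment_large k hk
  choose B hB0 hB using moment_each k
  refine ⟨C + ∑ n ∈ Finset.range q0, B n, by
    have := Finset.sum_nonneg fun n (_ : n ∈ Finset.range q0) => hB0 n
    linarith, ?_⟩
  intro q _ hq hRH
  have hq' : (1:ℝ) < q := by exact_mod_cast hq
  have hl := Real.log_pos hq'
  have hsum := Finset.sum_nonneg fun n (_ : n ∈ Finset.range q0) => hB0 n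
  rcases lt_or_ge q q0 with h | h
  · refine (hB q hq).trans ?_
    have h1 : B q ≤ C + ∑ n ∈ Finset.range q0, B n := by
      have := Finset.single_le_sum (fun n (_ : n ∈ Finset.range q0) => hB0 n) (Finset.mem_range.2 h)
      linarith
    gcongr
  · refine (hlarge q h _ fun χ hχ => ?_).trans ?_
    · exact ⟨(Finset.mem_filter.1 hχ).2.1, (Finset.mem_filter.1 hχ).2.2, hRH χ⟩
    · gcongr
      linarith
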